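/- Let d = 3, and suppose |Ω| < min{γ_x, γ_y}, and either (c₀ ≥ 0 and c₁ ≥ 0) or (c₁ ≤ 0 and c₀ + c₁ ≥ 0). Then the energy functional E of the rotating spin-orbit coupled spin-1 BEC attains its infimum on M = {Φ : φ_j ∈ H¹(ℝ³)∩L²_V(ℝ³), ‖Φ‖₂² = 1}, i.e., a ground state exists. -/

import Mathlib

open MeasureTheory Complex

noncomputable section

abbrev Pt (d : ℕ) := EuclideanSpace ℝ (Fin d)

/-- Classical partial derivative `∂_j f`, junk `0` if `j ≥ d`. -/
def pdC (d : ℕ) (f : Pt d → ℂ) (j : ℕ) (x : Pt d) : ℂ :=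
  if h : j < d then fderiv ℝ f x (EuclideanSpace.single ⟨j, h⟩ 1) else 0

def nthC (d : ℕ) (x : Pt d) (j : ℕ) : ℝ := if h : j < d then x ⟨j, h⟩ else 0

/-- `L₀ = i∂ₓ + ∂_y`. -/
def L0op (d : ℕ) (f : Pt d → ℂ) (x : Pt d) : ℂ := Complex.I * pdC d f 0 x + pdC d f 1 x

/-- `L₁ = i∂ₓ − ∂_y`. -/
def L1op (d : ℕ) (f : Pt d → ℂ) (x : Pt d) : ℂ := Complex.I * pdC d f 0 x - pdC d f 1 x

/-- Rotation operator `L_z = −i(x∂_y − y∂ₓ)`. -/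
def Lzop (d : ℕ) (f : Pt d → ℂ) (x : Pt d) : ℂ :=
  -Complex.I * (((nthC d x 0 : ℝ) : ℂ) * pdC d f 1 x - ((nthC d x 1 : ℝ) : ℂ) * pdC d f 0 x)

/-- `|∇f|²`. -/
def gradsq (d : ℕ) (f : Pt d → ℂ) (x : Pt d) : ℝ := ∑ j : Fin d, ‖pdC d f j x‖ ^ 2

/-- Total density `ρ = |φ₁|² + |φ₀|² + |φ₋₁|²`. -/
def rho (d : ℕ) (φ1 φ0 φm1 : Pt d → ℂ) (x : Pt d) : ℝ :=
  ‖φ1 x‖ ^ 2 + ‖φ0 x‖ ^ 2 + ‖φm1 x‖ ^ 2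

/-- Spin vector magnitude squared `|F|²`. -/
def Fsq (d : ℕ) (φ1 φ0 φm1 : Pt d → ℂ) (x : Pt d) : ℝ :=
  2 * ((((starRingEnd ℂ) (φ1 x) + (starRingEnd ℂ) (φm1 x)) * φ0 x).re) ^ 2
    + 2 * ((φ0 x * ((starRingEnd ℂ) (φm1 x) - (starRingEnd ℂ) (φ1 x))).im) ^ 2
    + (‖φ1 x‖ ^ 2 - ‖φm1 x‖ ^ 2) ^ 2

/-- The (real) SOC integrand `Φ†SΦ = φ̄₁L₀φ₀ + φ̄₀(L₀φ₋₁ + L₁φ₁) + φ̄₋₁L₁φ₀`. -/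
def socDen (d : ℕ) (φ1 φ0 φm1 : Pt d → ℂ) (x : Pt d) : ℝ :=
  ((starRingEnd ℂ) (φ1 x) * L0op d φ0 x
    + (starRingEnd ℂ) (φ0 x) * (L0op d φm1 x + L1op d φ1 x)
    + (starRingEnd ℂ) (φm1 x) * L1op d φ0 x).re

/-- The (real) rotation integrand `φ̄ L_z φ`. -/
def rotDen (d : ℕ) (φ : Pt d → ℂ) (x : Pt d) : ℝ :=
  ((starRingEnd ℂ) (φ x) * Lzop d φ x).re

/-- Kinetic energy. -/
def Ekin (d : ℕ) (φ1 φ0 φm1 : Pt d → ℂ) : ℝ :=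
  (1 / 2 : ℝ) * ∫ x, (gradsq d φ1 x + gradsq d φ0 x + gradsq d φm1 x)

/-- Potential energy. -/
def Epot (d : ℕ) (V : Pt d → ℝ) (φ1 φ0 φm1 : Pt d → ℂ) : ℝ :=
  ∫ x, V x * rho d φ1 φ0 φm1 x

/-- Interaction (spin) energy. -/
def Espin (d : ℕ) (c0 c1 : ℝ) (φ1 φ0 φm1 : Pt d → ℂ) : ℝ :=
  ∫ x, (c0 / 2 * (rho d φ1 φ0 φm1 x) ^ 2 + c1 / 2 * Fsq d φ1 φ0 φm1 x)

/-- Rotation energy. -/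
def Erot (d : ℕ) (Ω : ℝ) (φ1 φ0 φm1 : Pt d → ℂ) : ℝ :=
  -Ω * ∫ x, (rotDen d φ1 x + rotDen d φ0 x + rotDen d φm1 x)

/-- Spin-orbit coupling energy. -/
def Esoc (d : ℕ) (γ : ℝ) (φ1 φ0 φm1 : Pt d → ℂ) : ℝ :=
  -γ * ∫ x, socDen d φ1 φ0 φm1 x

/-- Total energy of the rotating SOC spin-1 BEC. -/
def Etot (d : ℕ) (V : Pt d → ℝ) (c0 c1 Ω γ : ℝ) (φ1 φ0 φm1 : Pt d → ℂ) : ℝ :=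
  Ekin d φ1 φ0 φm1 + Epot d V φ1 φ0 φm1 + Espin d c0 c1 φ1 φ0 φm1
    + Erot d Ω φ1 φ0 φm1 + Esoc d γ φ1 φ0 φm1

/-- The constraint manifold `M`: triples in `H¹ ∩ L²_V` (with all energy integrands
integrable) of unit total mass. -/
def InM (d : ℕ) (V : Pt d → ℝ) (φ1 φ0 φm1 : Pt d → ℂ) : Prop :=
  Differentiable ℝ φ1 ∧ Differentiable ℝ φ0 ∧ Differentiable ℝ φm1 ∧
  Integrable (fun x => rho d φ1 φ0 φm1 x) ∧
  Integrable (fun x => gradsq d φ1 x + gradsq d φ0 x + gradsq d φm1 x) ∧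
  Integrable (fun x => V x * rho d φ1 φ0 φm1 x) ∧
  Integrable (fun x => (rho d φ1 φ0 φm1 x) ^ 2) ∧
  Integrable (fun x => Fsq d φ1 φ0 φm1 x) ∧
  Integrable (fun x => rotDen d φ1 x + rotDen d φ0 x + rotDen d φm1 x) ∧
  Integrable (fun x => socDen d φ1 φ0 φm1 x) ∧
  (∫ x, rho d φ1 φ0 φm1 x) = 1

section
open scoped ENNReal NNReal Topology FourierTransform ContDiff SchwartzMap
open Filter

lemma lint_sq_le {α : Type*} [MeasurableSpace α] (ν : Measure α) [IsProbabilityMeasure ν]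
    {f : α → ℝ≥0∞} (hf : AEMeasurable f ν) : (∫⁻ x, f x ∂ν) ^ 2 ≤ ∫⁻ x, f x ^ 2 ∂ν := by
  have h := ENNReal.lintegral_mul_le_Lp_mul_Lq ν (p := 2) (q := 2) (by constructor <;> norm_num) hf
    (g := fun _ => 1) aemeasurable_const
  simp only [Pi.mul_apply, mul_one, ENNReal.one_rpow, lintegral_const, measure_univ] at h
  calc (∫⁻ x, f x ∂ν) ^ 2 ≤ ((∫⁻ x, f x ^ (2:ℝ) ∂ν) ^ (1 / (2:ℝ))) ^ 2 := by gcongr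
    _ = ∫⁻ x, f x ^ 2 ∂ν := by
      rw [← ENNReal.rpow_natCast, ← ENNReal.rpow_mul]
      norm_num

lemma eLpNorm_two_sq {α F : Type*} [MeasurableSpace α] [NormedAddCommGroup F] (ν : Measure α)
    (f : α → F) : eLpNorm f 2 ν ^ 2 = ∫⁻ x, ‖f x‖ₑ ^ 2 ∂ν := by
  have := eLpNorm_nnreal_pow_eq_lintegral (μ := ν) (f := f) (p := 2) (by norm_num)
  simpa using this

lemma eLpNorm_two_le_iff {α F : Type*} [MeasurableSpace α] [NormedAddCommGroup F] (ν : Measure α)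
    (f : α → F) (C : ℝ≥0∞) : eLpNorm f 2 ν ≤ C ↔ ∫⁻ x, ‖f x‖ₑ ^ 2 ∂ν ≤ C ^ 2 := by
  rw [← eLpNorm_two_sq, ENNReal.pow_le_pow_left_iff (by norm_num)]

def TL (u : Pt 3 → ℂ) (K : ℝ≥0) : Prop :=
  ∀ h : Pt 3, eLpNorm (fun x => u (x + h) - u x) 2 volume ≤ K * ‖h‖ₑ

lemma transl_pt {φ : Pt 3 → ℂ} (hφ : Differentiable ℝ φ) (x h : Pt 3) :
    ‖φ (x + h) - φ x‖ₑ ^ 2 ≤ ∫⁻ t in Set.Ioc (0:ℝ) 1, (‖fderiv ℝ φ (x + t • h)‖ₑ * ‖h‖ₑ) ^ 2 := by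
  have hm : Measurable (fun t : ℝ => fderiv ℝ φ (x + t • h)) :=
    (measurable_fderiv ℝ φ).comp (by fun_prop)
  have hm1 : Measurable (fun t : ℝ => fderiv ℝ φ (x + t • h) h) :=
    (measurable_fderiv_apply_const ℝ φ h).comp (by fun_prop)
  have hm2 : Measurable (fun t : ℝ => (‖fderiv ℝ φ (x + t • h)‖ₑ * ‖h‖ₑ)) := by fun_prop
  have : IsProbabilityMeasure (volume.restrict (Set.Ioc (0:ℝ) 1)) := ⟨by simp⟩
  refine le_trans ?_ (lint_sq_le (volume.restrict (Set.Ioc (0:ℝ) 1)) hm2.aemeasurable)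
  gcongr
  have key : ∫⁻ t in Set.Ioc (0:ℝ) 1, ‖fderiv ℝ φ (x + t • h) h‖ₑ ≤
      ∫⁻ t in Set.Ioc (0:ℝ) 1, (‖fderiv ℝ φ (x + t • h)‖ₑ * ‖h‖ₑ) := by
    gcongr with t
    exact ContinuousLinearMap.le_opENorm _ _
  refine le_trans ?_ key
  by_cases htop : ∫⁻ t in Set.Ioc (0:ℝ) 1, ‖fderiv ℝ φ (x + t • h) h‖ₑ = ⊤
  · rw [htop]; exact le_top
  have hint : IntervalIntegrable (fun t : ℝ => fderiv ℝ φ (x + t • h) h) volume 0 1 := by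
    rw [intervalIntegrable_iff_integrableOn_Ioc_of_le (by norm_num)]
    exact ⟨hm1.aestronglyMeasurable, lt_top_iff_ne_top.2 htop⟩
  have hd : ∀ t ∈ Set.uIcc (0:ℝ) 1, HasDerivAt (fun t : ℝ => φ (x + t • h))
      (fderiv ℝ φ (x + t • h) h) t := by
    intro t _
    have h1 : HasDerivAt (fun t : ℝ => x + t • h) h t := by
      simpa using ((hasDerivAt_id t).smul_const h).const_add x
    exact (hφ (x + t • h)).hasFDerivAt.comp_hasDerivAt t h1
  have hF := intervalIntegral.integral_eq_sub_of_hasDerivAt hd hint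
  simp only [one_smul, zero_smul, add_zero] at hF
  rw [← hF, intervalIntegral.integral_of_le (by norm_num)]
  exact enorm_integral_le_lintegral_enorm _

lemma transl_le {φ : Pt 3 → ℂ} (hφ : Differentiable ℝ φ) (h : Pt 3) :
    eLpNorm (fun x => φ (x + h) - φ x) 2 volume ≤ eLpNorm (fderiv ℝ φ) 2 volume * ‖h‖ₑ := by
  rw [eLpNorm_two_le_iff, mul_pow, eLpNorm_two_sq]
  have hm : Measurable (fderiv ℝ φ) := measurable_fderiv ℝ φ
  calc ∫⁻ x, ‖φ (x + h) - φ x‖ₑ ^ 2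
      ≤ ∫⁻ x, ∫⁻ t in Set.Ioc (0:ℝ) 1, (‖fderiv ℝ φ (x + t • h)‖ₑ * ‖h‖ₑ) ^ 2 := by
        gcongr with x
        exact transl_pt hφ x h
    _ = ∫⁻ t in Set.Ioc (0:ℝ) 1, ∫⁻ x, (‖fderiv ℝ φ (x + t • h)‖ₑ * ‖h‖ₑ) ^ 2 := by
        apply lintegral_lintegral_swap
        have : Measurable (fun p : Pt 3 × ℝ => fderiv ℝ φ (p.1 + p.2 • h)) :=
          hm.comp (by fun_prop)
        apply Measurable.aemeasurable
        simp only [Function.uncurry_def]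
        fun_prop
    _ = ∫⁻ t in Set.Ioc (0:ℝ) 1, ∫⁻ x, (‖fderiv ℝ φ x‖ₑ * ‖h‖ₑ) ^ 2 := by
        congr 1; ext t
        exact lintegral_add_right_eq_self (fun x => (‖fderiv ℝ φ x‖ₑ * ‖h‖ₑ) ^ 2) (t • h)
    _ = (∫⁻ x, ‖fderiv ℝ φ x‖ₑ ^ 2) * ‖h‖ₑ ^ 2 := by
        simp only [lintegral_const, Measure.restrict_apply_univ, Real.volume_Ioc, sub_zero,
          ENNReal.ofReal_one, mul_one, mul_pow]
        rw [lintegral_mul_const]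
        fun_prop
  
lemma TL_of_diff {φ : Pt 3 → ℂ} (hφ : Differentiable ℝ φ) {K : ℝ≥0}
    (hK : eLpNorm (fderiv ℝ φ) 2 volume ≤ K) : TL φ K := fun h =>
  (transl_le hφ h).trans (by gcongr)

/-- Plancherel for `L¹ ∩ L²`. -/
lemma fourier_ae_eq {u : Pt 3 → ℂ} (h1 : Integrable u) (h2 : MemLp u 2) :
    (𝓕 (h2.toLp u) : Lp ℂ 2 (volume : Measure (Pt 3))) =ᵐ[volume] 𝓕 u := by
  have hloc : LocallyIntegrable (𝓕 (h2.toLp u) : Lp ℂ 2 (volume : Measure (Pt 3))) volume :=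
    (Lp.memLp _).locallyIntegrable (by norm_num)
  have hcont : Continuous (𝓕 u) := 
    VectorFourier.fourierIntegral_continuous Real.continuous_fourierChar (by exact continuous_inner) h1
  apply ae_eq_of_integral_contDiff_smul_eq hloc hcont.locallyIntegrable
  intro g hg hgc
  have hgC : HasCompactSupport (fun x => (g x : ℂ)) := hgc.comp_left (g := fun r : ℝ => (r:ℂ)) (by simp)
  have hgS : ContDiff ℝ ∞ (fun x => (g x : ℂ)) := Complex.ofRealCLM.contDiff.comp hg
  let G : 𝓢(Pt 3, ℂ) := hgC.toSchwartzMap hgS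
  have hG : ∀ x, G x = g x := fun x => rfl
  have e1 := Lp.fourier_toTemperedDistribution_eq (h2.toLp u)
  have e2 := congrArg (fun T => T G) e1
  simp only [TemperedDistribution.fourier_apply, Lp.toTemperedDistribution_apply] at e2
  have e3 : ∫ x, (𝓕 G) x • (h2.toLp u) x = ∫ x, (𝓕 G) x • u x := by
    apply integral_congr_ae
    filter_upwards [h2.coeFn_toLp] with x hx
    rw [hx]
  rw [e3] at e2
  have e4 := VectorFourier.integral_fourierIntegral_smul_eq_flip (μ := (volume : Measure (Pt 3)))
    (ν := volume) (L := innerₗ (Pt 3)) (f := G) (g := u) Real.continuous_fourierChar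
    continuous_inner G.integrable h1
  have e5 : (innerₗ (Pt 3)).flip = innerₗ (Pt 3) := by ext; simp
  rw [e5] at e4
  have e6 : ∫ x, (𝓕 G) x • u x = ∫ x, G x • (𝓕 u) x := e4
  rw [e6] at e2
  simp only [hG] at e2
  simpa using e2.symm

lemma plancherel_le {u : Pt 3 → ℂ} (h1 : Integrable u) (h2 : MemLp u 2) :
    eLpNorm (𝓕 u) 2 volume = eLpNorm u 2 volume := by
  rw [← eLpNorm_congr_ae (fourier_ae_eq h1 h2), ← Lp.enorm_def, ← Lp.enorm_toLp h2]
  rw [← ofReal_norm_eq_enorm, ← ofReal_norm_eq_enorm, Lp.norm_fourier_eq]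

end

section
open scoped ENNReal NNReal Topology FourierTransform ContDiff SchwartzMap Convolution
open Filter

lemma fatou_eLp {F : Type*} [NormedAddCommGroup F] {p : ℝ≥0∞} {f : ℕ → Pt 3 → F} {g : Pt 3 → F} {C : ℝ≥0∞}
    (hf : ∀ n, AEStronglyMeasurable (f n) volume) 
    (hlim : ∀ᵐ x, Tendsto (fun n => f n x) atTop (𝓝 (g x)))
    (hb : ∀ n, eLpNorm (f n) p volume ≤ C) : eLpNorm g p volume ≤ C := by
  refine (Lp.eLpNorm_lim_le_liminf_eLpNorm hf g hlim).trans ?_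
  refine liminf_le_of_le (by isBoundedDefault) (fun b hb' => ?_)
  obtain ⟨n, hn⟩ := hb'.exists
  exact hn.trans (hb n)

abbrev ee (j : Fin 3) : Pt 3 := EuclideanSpace.single j (1:ℝ)

lemma norm_le_sum_coord (x : Pt 3) : ‖x‖ ≤ ∑ j, |x j| := by
  have : x = ∑ j, (x j) • ee j := by
    ext i; simp [Finset.sum_apply, Pi.single_apply]
  calc ‖x‖ = ‖∑ j, (x j) • ee j‖ := by rw [← this]
    _ ≤ ∑ j, ‖(x j) • ee j‖ := norm_sum_le _ _
    _ = _ := by simp [norm_smul]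

lemma opnorm_le_sum (T : Pt 3 →L[ℝ] ℂ) : ‖T‖ ≤ ∑ j, ‖T (ee j)‖ := by
  apply ContinuousLinearMap.opNorm_le_bound _ (by positivity)
  intro x
  have : x = ∑ j, (x j) • ee j := by
    ext i; simp [Finset.sum_apply, Pi.single_apply]
  calc ‖T x‖ = ‖∑ j, (x j) • T (ee j)‖ := by conv_lhs => rw [this]
                                             simp
    _ ≤ ∑ j, ‖(x j) • T (ee j)‖ := norm_sum_le _ _
    _ ≤ ∑ j, ‖T (ee j)‖ * ‖x‖ := by
      gcongr with j
      rw [norm_smul, mul_comm]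
      gcongr
      exact PiLp.norm_apply_le x j
    _ = _ := by rw [Finset.sum_mul]

/-- The quotient sequence. -/
lemma quot_le {u : Pt 3 → ℂ} {K : ℝ≥0} (hu : TL u K) (e : Pt 3) (n : ℕ) :
    eLpNorm (fun x => ((n:ℂ)+1) * (u (x + ((n:ℝ)+1)⁻¹ • e) - u x)) 2 volume ≤ K * ‖e‖ₑ := by
  have h := hu (((n:ℝ)+1)⁻¹ • e)
  have e1 : (fun x => ((n:ℂ)+1) * (u (x + ((n:ℝ)+1)⁻¹ • e) - u x)) =
    ((n:ℂ)+1) • (fun x => (u (x + ((n:ℝ)+1)⁻¹ • e) - u x)) := by ext; simp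
  rw [e1, eLpNorm_const_smul]
  calc _ ≤ ‖(n:ℂ)+1‖ₑ * (K * ‖((n:ℝ)+1)⁻¹ • e‖ₑ) := by gcongr
    _ = K * ‖e‖ₑ := by
      have : ‖(n:ℂ)+1‖ₑ = ‖(n:ℝ)+1‖ₑ := by
        rw [← ofReal_norm, ← ofReal_norm]; congr 1
        rw [show (n:ℂ)+1 = ((n+1:ℝ):ℂ) by push_cast; rfl, Complex.norm_real]
      rw [enorm_smul, this]
      have h2 : ‖(n:ℝ)+1‖ₑ * ‖((n:ℝ)+1)⁻¹‖ₑ = 1 := by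
        rw [← enorm_mul, mul_inv_cancel₀ (by positivity)]; simp
      calc _ = K * ‖e‖ₑ * (‖(n:ℝ)+1‖ₑ * ‖((n:ℝ)+1)⁻¹‖ₑ) := by ring
        _ = _ := by rw [h2, mul_one]

lemma tendsto_inv_nat : Tendsto (fun n : ℕ => ((n:ℝ)+1)⁻¹) atTop (𝓝[≠] 0) := by
  rw [tendsto_nhdsWithin_iff]
  refine ⟨by simpa using tendsto_one_div_add_atTop_nhds_zero_nat (𝕜 := ℝ), .of_forall fun n => ?_⟩
  simp; positivity

lemma quot_tendsto {g : ℝ → ℂ} {g' : ℂ} (h : HasDerivAt g g' 0) :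
    Tendsto (fun n : ℕ => ((n:ℂ)+1) * (g (((n:ℝ)+1)⁻¹) - g 0)) atTop (𝓝 g') := by
  have := (hasDerivAt_iff_tendsto_slope.1 h).comp tendsto_inv_nat
  refine this.congr fun n => ?_
  simp [slope_def_module]

lemma TL_fderiv {u : Pt 3 → ℂ} {K : ℝ≥0} (hu : TL u K) (hd : Differentiable ℝ u) (e : Pt 3) :
    eLpNorm (fun x => fderiv ℝ u x e) 2 volume ≤ K * ‖e‖ₑ := by
  apply fatou_eLp (f := fun (n:ℕ) x => ((n:ℂ)+1) * (u (x + ((n:ℝ)+1)⁻¹ • e) - u x)) _ _ (quot_le hu e)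
  · intro n
    have := hd.continuous
    exact Continuous.aestronglyMeasurable (by fun_prop)
  · refine .of_forall fun x => ?_
    have h1 : HasDerivAt (fun t : ℝ => u (x + t • e)) (fderiv ℝ u x e) 0 := by
      have h1 : HasDerivAt (fun t : ℝ => x + t • e) e 0 := by
        simpa using ((hasDerivAt_id (0:ℝ)).smul_const e).const_add x
      have h2 : HasFDerivAt u (fderiv ℝ u x) (x + (0:ℝ) • e) := by simpa using (hd x).hasFDerivAt
      exact h2.comp_hasDerivAt 0 h1
    simpa using quot_tendsto h1

lemma int_shift {u : Pt 3 → ℂ} (h1 : Integrable u) (h : Pt 3) : Integrable (fun x => u (x + h)) :=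
  h1.comp_add_right h
lemma mem_shift {u : Pt 3 → ℂ} {p : ℝ≥0∞} (h1 : MemLp u p) (h : Pt 3) : MemLp (fun x => u (x + h)) p :=
  h1.comp_measurePreserving (measurePreserving_add_right volume h)

lemma fourier_cont {u : Pt 3 → ℂ} (h1 : Integrable u) : Continuous (𝓕 u) := 
    VectorFourier.fourierIntegral_continuous Real.continuous_fourierChar (by exact continuous_inner) h1

lemma fourier_shift {u : Pt 3 → ℂ} (h1 : Integrable u) (h ξ : Pt 3) :
    𝓕 (fun x => u (x + h) - u x) ξ = ((Real.fourierChar (inner ℝ h ξ) : ℂ) - 1) * 𝓕 u ξ := by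
  have e := congrFun (VectorFourier.fourierIntegral_comp_add_right Real.fourierChar (volume : Measure (Pt 3))
    (innerₗ (Pt 3)) u h) ξ
  have e1 : 𝓕 (fun x => u (x + h)) ξ = Real.fourierChar (inner ℝ h ξ) • 𝓕 u ξ := e
  have e2 : 𝓕 (fun x => u (x + h) - u x) ξ = 𝓕 (fun x => u (x + h)) ξ - 𝓕 u ξ := by
    simp only [Real.fourier_eq, smul_sub]
    rw [integral_sub]
    · exact (Real.fourierIntegral_convergent_iff ξ).2 (int_shift h1 h)
    · exact (Real.fourierIntegral_convergent_iff ξ).2 h1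
  rw [e2, e1, Circle.smul_def, smul_eq_mul]; ring

lemma TL_fourier_coord {u : Pt 3 → ℂ} {K : ℝ≥0} (hu : TL u K) (h1 : Integrable u) (h2 : MemLp u 2)
    (e : Pt 3) :
    eLpNorm (fun ξ => (2 * Real.pi * I * (inner ℝ e ξ : ℝ)) * 𝓕 u ξ) 2 volume ≤ K * ‖e‖ₑ := by
  apply fatou_eLp (f := fun (n:ℕ) ξ => ((n:ℂ)+1) *
    (((Real.fourierChar (inner ℝ (((n:ℝ)+1)⁻¹ • e) ξ) : ℂ) - 1) * 𝓕 u ξ))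
  · intro n
    have := fourier_cont h1
    apply Continuous.aestronglyMeasurable
    have h3 := Real.continuous_fourierChar
    fun_prop
  · refine .of_forall fun ξ => ?_
    have h3 : HasDerivAt (fun t : ℝ => (Real.fourierChar (t * inner ℝ e ξ) : ℂ))
      (2 * Real.pi * I * (inner ℝ e ξ : ℝ)) 0 := by
      have h4 := (Real.hasDerivAt_fourierChar (0 * inner ℝ e ξ)).scomp (0:ℝ) 
        ((hasDerivAt_id (0:ℝ)).mul_const (inner ℝ e ξ))
      refine h4.congr_deriv ?_
      simp
      ring
    have h5 := (quot_tendsto h3).mul_const (𝓕 u ξ)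
    refine h5.congr fun n => ?_
    simp [inner_smul_left]
    ring
  · intro n
    refine le_trans (le_of_eq ?_) (quot_le hu e n)
    have hI : Integrable (fun x => u (x + ((n:ℝ)+1)⁻¹ • e) - u x) := (int_shift h1 (((n:ℝ)+1)⁻¹ • e)).sub h1
    have hM : MemLp (fun x => u (x + ((n:ℝ)+1)⁻¹ • e) - u x) 2 := (mem_shift h2 (((n:ℝ)+1)⁻¹ • e)).sub h2
    have e1 : ∀ f : Pt 3 → ℂ, (fun x => ((n:ℂ)+1) * f x) = ((n:ℂ)+1) • f := fun f => by ext; simp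
    rw [e1, e1 (fun x => u (x + ((n:ℝ)+1)⁻¹ • e) - u x), eLpNorm_const_smul, eLpNorm_const_smul]
    congr 1
    rw [← plancherel_le hI hM]
    congr 1; ext ξ
    exact (fourier_shift h1 _ ξ).symm

/-- `u ∈ L¹∩L²` with Lipschitz translations has `|ξ| û ∈ L²`. -/
lemma TL_fourier {u : Pt 3 → ℂ} {K : ℝ≥0} (hu : TL u K) (h1 : Integrable u) (h2 : MemLp u 2) :
    MemLp (fun ξ => ‖ξ‖ * ‖𝓕 u ξ‖) 2 := by
  have hc := fourier_cont h1
  have hj : ∀ j, MemLp (fun ξ : Pt 3 => (2 * Real.pi * I * (inner ℝ (ee j) ξ : ℝ)) * 𝓕 u ξ) 2 := by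
    intro j
    refine ⟨Continuous.aestronglyMeasurable (by fun_prop), (TL_fourier_coord hu h1 h2 (ee j)).trans_lt ?_⟩
    exact ENNReal.mul_lt_top (by simp) (by simp)
  have hs : MemLp (fun ξ : Pt 3 => ∑ j, ‖(2 * Real.pi * I * (inner ℝ (ee j) ξ : ℝ)) * 𝓕 u ξ‖) 2 :=
    memLp_finsetSum _ fun j _ => (hj j).norm
  refine hs.of_le (Continuous.aestronglyMeasurable (by fun_prop)) (.of_forall fun ξ => ?_)
  rw [Real.norm_of_nonneg (by positivity), Real.norm_of_nonneg (by positivity)]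
  simp only [norm_mul, ← Finset.sum_mul]
  gcongr
  refine (norm_le_sum_coord ξ).trans ?_
  gcongr with j
  simp only [Complex.norm_real, Complex.norm_I, Complex.norm_ofNat, EuclideanSpace.inner_single_left,
    Real.norm_eq_abs, map_one, one_mul, mul_one]
  have := Real.pi_gt_three
  rw [abs_of_pos Real.pi_pos]
  nlinarith [abs_nonneg (ξ j)]

lemma fourier_inv_ae {u : Pt 3 → ℂ} (h1 : Integrable u) (h2 : Integrable (𝓕 u)) :
    u =ᵐ[volume] 𝓕⁻ (𝓕 u) := by
  have hcont : Continuous (𝓕⁻ (𝓕 u)) := by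
    rw [Real.fourierInv_eq_fourier_comp_neg]
    exact fourier_cont h2.comp_neg
  apply ae_eq_of_integral_contDiff_smul_eq h1.locallyIntegrable hcont.locallyIntegrable
  intro g hg hgc
  have hgC : HasCompactSupport (fun x => (g x : ℂ)) := hgc.comp_left (g := fun r : ℝ => (r:ℂ)) (by simp)
  have hgS : ContDiff ℝ ∞ (fun x => (g x : ℂ)) := Complex.ofRealCLM.contDiff.comp hg
  let G : 𝓢(Pt 3, ℂ) := hgC.toSchwartzMap hgS
  have hG : ∀ x, G x = g x := fun x => rfl
  have flip : ∀ {f k : Pt 3 → ℂ}, Integrable f → Integrable k →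
      ∫ x, (𝓕 f) x • k x = ∫ x, f x • (𝓕 k) x := by
    intro f k hf hk
    have e4 := VectorFourier.integral_fourierIntegral_smul_eq_flip (μ := (volume : Measure (Pt 3)))
      (ν := volume) (L := innerₗ (Pt 3)) (f := f) (g := k) Real.continuous_fourierChar
      continuous_inner hf hk
    have e5 : (innerₗ (Pt 3)).flip = innerₗ (Pt 3) := by ext; simp
    rw [e5] at e4
    exact e4
  have a1 : ∫ x, (𝓕 u) x • (𝓕⁻ G : 𝓢(Pt 3, ℂ)) x = ∫ x, u x • G x := by
    rw [flip h1 (𝓕⁻ G : 𝓢(Pt 3, ℂ)).integrable]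
    have : 𝓕 (⇑(𝓕⁻ G : 𝓢(Pt 3, ℂ))) = ⇑G := by
      rw [← SchwartzMap.fourier_coe]; simp
    rw [this]
  have a2 : ∫ x, (𝓕⁻ (𝓕 u)) x • G x = ∫ x, (𝓕 u) x • (𝓕⁻ G : 𝓢(Pt 3, ℂ)) x := by
    rw [Real.fourierInv_eq_fourier_comp_neg, flip h2.comp_neg G.integrable]
    rw [← integral_neg_eq_self]
    simp only [neg_neg]
    congr 1
  have a3 := a1.symm.trans a2.symm
  simp only [hG] at a3
  simp only [Complex.real_smul]
  simpa [mul_comm] using a3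

end

section
open scoped ENNReal NNReal Topology FourierTransform ContDiff SchwartzMap Convolution
open Filter

lemma mink (ν : Measure (Pt 3)) [IsProbabilityMeasure ν] {F : Pt 3 → Pt 3 → ℂ}
    (hF : StronglyMeasurable (Function.uncurry F)) {C : ℝ≥0∞}
    (h : ∀ᵐ t ∂ν, eLpNorm (fun x => F x t) 2 volume ≤ C) :
    eLpNorm (fun x => ∫ t, F x t ∂ν) 2 volume ≤ C := by
  rw [eLpNorm_two_le_iff]
  have hm : Measurable fun p : Pt 3 × Pt 3 => ‖F p.1 p.2‖ₑ := hF.enorm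
  calc ∫⁻ x, ‖∫ t, F x t ∂ν‖ₑ ^ 2 ≤ ∫⁻ x, (∫⁻ t, ‖F x t‖ₑ ∂ν) ^ 2 := by
        gcongr; exact enorm_integral_le_lintegral_enorm _
    _ ≤ ∫⁻ x, ∫⁻ t, ‖F x t‖ₑ ^ 2 ∂ν := by
        gcongr with x
        exact lint_sq_le ν (hm.comp measurable_prodMk_left).aemeasurable
    _ = ∫⁻ t, ∫⁻ x, ‖F x t‖ₑ ^ 2 ∂volume ∂ν := by
        rw [lintegral_lintegral_swap]
        exact (hm.pow_const 2).aemeasurable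
    _ ≤ ∫⁻ t, C ^ 2 ∂ν := by
        apply lintegral_mono_ae
        filter_upwards [h] with t ht
        exact (eLpNorm_two_le_iff _ _ _).1 ht
    _ = C ^ 2 := by simp

def molB (n : ℕ) : ContDiffBump (0 : Pt 3) :=
  ⟨((n:ℝ)+1)⁻¹ / 2, ((n:ℝ)+1)⁻¹, by positivity, by
    have : 0 < ((n:ℝ)+1)⁻¹ := by positivity
    linarith⟩

def mol (n : ℕ) : Pt 3 → ℝ := (molB n).normed volume

lemma mol_nonneg (n : ℕ) (x) : 0 ≤ mol n x := (molB n).nonneg_normed x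
lemma mol_smooth (n : ℕ) : ContDiff ℝ ∞ (mol n) := (molB n).contDiff_normed
lemma mol_compact (n : ℕ) : HasCompactSupport (mol n) := (molB n).hasCompactSupport_normed
lemma mol_cont (n : ℕ) : Continuous (mol n) := (mol_smooth n).continuous
lemma mol_int (n : ℕ) : ∫ x, mol n x = 1 := (molB n).integral_normed
lemma mol_supp (n : ℕ) {x : Pt 3} (hx : ((n:ℝ)+1)⁻¹ < ‖x‖) : mol n x = 0 := by
  by_contra h
  have : x ∈ tsupport ((molB n).normed volume) := subset_tsupport _ h
  rw [ContDiffBump.tsupport_normed_eq] at this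
  simp [molB] at this
  linarith

def molM (n : ℕ) : Measure (Pt 3) := volume.withDensity fun x => ((mol n x).toNNReal : ℝ≥0∞)

instance molM_prob (n : ℕ) : IsProbabilityMeasure (molM n) := by
  constructor
  rw [molM, withDensity_apply _ MeasurableSet.univ, Measure.restrict_univ]
  have := ofReal_integral_eq_lintegral_ofReal ((mol_cont n).integrable_of_hasCompactSupport (mol_compact n))
    (.of_forall (mol_nonneg n)) (μ := volume)
  rw [mol_int] at this
  simpa [ENNReal.ofReal] using this.symm

lemma molM_ac (n : ℕ) : molM n ≪ volume := withDensity_absolutelyContinuous _ _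

lemma molM_small (n : ℕ) : ∀ᵐ t ∂(molM n), ‖t‖ₑ ≤ ENNReal.ofReal ((n:ℝ)+1)⁻¹ := by
  rw [molM, ae_withDensity_iff ((mol_cont n).measurable.real_toNNReal.coe_nnreal_ennreal)]
  refine .of_forall fun x hx => ?_
  rw [← ofReal_norm]
  apply ENNReal.ofReal_le_ofReal
  by_contra h
  exact hx (by simp [mol_supp n (not_le.1 h)])

/-- Mollification -/
def molf (n : ℕ) (u : Pt 3 → ℂ) (x : Pt 3) : ℂ := ∫ t, u (x - t) ∂(molM n)

lemma molf_eq (n : ℕ) (u : Pt 3 → ℂ) (x : Pt 3) : molf n u x = ∫ t, mol n t • u (x - t) := by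
  rw [molf, molM, integral_withDensity_eq_integral_smul (mol_cont n).measurable.real_toNNReal]
  congr 1; ext t
  rw [NNReal.smul_def, Real.coe_toNNReal _ (mol_nonneg n t)]

lemma molf_conv (n : ℕ) (u : Pt 3 → ℂ) :
    molf n u = convolution (mol n) u (ContinuousLinearMap.lsmul ℝ ℝ) volume := by
  ext x; rw [molf_eq]; rfl

lemma molf_eq2 (n : ℕ) (u : Pt 3 → ℂ) (x : Pt 3) : molf n u x = ∫ t, mol n (x - t) • u t := by
  rw [molf_eq]
  rw [← integral_sub_left_eq_self _ _ x]
  simp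

lemma molf_congr (n : ℕ) {u v : Pt 3 → ℂ} (h : u =ᵐ[volume] v) : molf n u = molf n v := by
  ext x
  rw [molf_eq2, molf_eq2]
  apply integral_congr_ae
  filter_upwards [h] with t ht
  rw [ht]

lemma molf_smooth (n : ℕ) {u : Pt 3 → ℂ} (hu : LocallyIntegrable u) : ContDiff ℝ ∞ (molf n u) := by
  rw [molf_conv]
  exact (mol_compact n).contDiff_convolution_left _ (mol_smooth n) hu

lemma molf_tendsto {u : Pt 3 → ℂ} (hu : LocallyIntegrable u) :
    ∀ᵐ x, Tendsto (fun n => molf n u x) atTop (𝓝 (u x)) := by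
  have := ContDiffBump.ae_convolution_tendsto_right_of_locallyIntegrable (μ := (volume : Measure (Pt 3)))
    (φ := molB) (l := atTop) (K := 2) (g := u)
    (by simpa [molB] using tendsto_one_div_add_atTop_nhds_zero_nat (𝕜 := ℝ))
    (.of_forall fun n => by simp only [molB]; linarith) hu
  filter_upwards [this] with x hx
  simp only [molf_conv]
  exact hx

lemma TL.congr {u v : Pt 3 → ℂ} {K : ℝ≥0} (hu : TL u K) (h : u =ᵐ[volume] v) : TL v K := by
  intro y
  refine le_trans (le_of_eq ?_) (hu y)
  apply eLpNorm_congr_ae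
  have h2 := (measurePreserving_add_right volume y).quasiMeasurePreserving.ae_eq_comp h
  filter_upwards [h, h2] with x h1 h2
  simp only [Function.comp] at h2
  rw [h1, h2]

lemma molf_norm (n : ℕ) {u : Pt 3 → ℂ} (hu : AEStronglyMeasurable u volume) :
    eLpNorm (molf n u) 2 volume ≤ eLpNorm u 2 volume := by
  rw [molf_congr n hu.ae_eq_mk, eLpNorm_congr_ae hu.ae_eq_mk]
  have hs := hu.stronglyMeasurable_mk
  refine mink (molM n) (F := fun x t => hu.mk u (x - t)) (hs.comp_measurable (by fun_prop)) (.of_forall fun t => ?_)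
  have := eLpNorm_comp_measurePreserving (p := 2) hs.aestronglyMeasurable (measurePreserving_sub_right (volume : Measure (Pt 3)) t)
  exact this.le

lemma molf_memLp (n : ℕ) {u : Pt 3 → ℂ} (hu : MemLp u 2) : MemLp (molf n u) 2 := 
  ⟨(molf_smooth n (hu.locallyIntegrable (by norm_num))).continuous.aestronglyMeasurable,
    (molf_norm n hu.1).trans_lt hu.2⟩

lemma int_sub_molM (n : ℕ) {u : Pt 3 → ℂ} (hu : LocallyIntegrable u) (x : Pt 3) :
    Integrable (fun t => u (x - t)) (molM n) := by
  rw [molM, integrable_withDensity_iff_integrable_smul (mol_cont n).measurable.real_toNNReal]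
  have h : LocallyIntegrable (fun t => u (x - t)) := by
    intro y
    obtain ⟨s, hs, hs'⟩ := hu (x - y)
    refine ⟨(fun t => x - t) ⁻¹' s, ?_, ?_⟩
    · exact (continuous_const.sub continuous_id).continuousAt hs
    · exact ((Measure.measurePreserving_sub_left volume x).integrableOn_comp_preimage
        (MeasurableEquiv.subLeft x).measurableEmbedding).2 hs'
  have := h.integrable_smul_left_of_hasCompactSupport (mol_cont n) (mol_compact n)
  refine this.congr (.of_forall fun t => ?_)
  simp only [NNReal.smul_def, Real.coe_toNNReal _ (mol_nonneg n t)]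

lemma molf_TL (n : ℕ) {u : Pt 3 → ℂ} (hu : MemLp u 2) {K : ℝ≥0} (hT : TL u K) : TL (molf n u) K := by
  intro h
  have e : (fun x => molf n u (x + h) - molf n u x) = molf n (fun x => u (x + h) - u x) := by
    ext x
    simp only [molf]
    have hl := hu.locallyIntegrable (by norm_num)
    rw [integral_sub]
    · congr 2; ext t; congr 1; abel
    · have := int_sub_molM n hl (x + h)
      refine this.congr (.of_forall fun t => ?_)
      dsimp only; congr 1; abel
    · exact int_sub_molM n hl x
  rw [e]
  exact (molf_norm n ((mem_shift hu h).sub hu).1).trans (hT h)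

/-- quantitative approximation -/
lemma molf_close (n : ℕ) {u : Pt 3 → ℂ} (hu : MemLp u 2) {K : ℝ≥0} (hT : TL u K) :
    eLpNorm (fun x => molf n u x - u x) 2 volume ≤ K * ENNReal.ofReal ((n:ℝ)+1)⁻¹ := by
  have hae := hu.1.ae_eq_mk
  have hT' := hT.congr hae
  have hu' : MemLp (hu.1.mk u) 2 := (memLp_congr_ae hae).1 hu
  have hs := hu.1.stronglyMeasurable_mk
  rw [molf_congr n hae]
  have e1 : eLpNorm (fun x => molf n (hu.1.mk u) x - u x) 2 volume =
    eLpNorm (fun x => molf n (hu.1.mk u) x - hu.1.mk u x) 2 volume := by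
    apply eLpNorm_congr_ae
    filter_upwards [hae] with x hx
    rw [← hx]
  rw [e1]
  have e2 : (fun x => molf n (hu.1.mk u) x - hu.1.mk u x) = fun x => ∫ t, (hu.1.mk u (x - t) - hu.1.mk u x) ∂(molM n) := by
    ext x
    rw [integral_sub (int_sub_molM n (hu'.locallyIntegrable (by norm_num)) x) (integrable_const _)]
    simp [molf]
  rw [e2]
  refine mink _ (F := fun x t => hu.1.mk u (x - t) - hu.1.mk u x) ?_ ?_
  · exact (hs.comp_measurable (by fun_prop)).sub (hs.comp_measurable (by fun_prop))
  · filter_upwards [molM_small n] with t ht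
    refine le_trans ?_ ((hT' (-t)).trans (by rw [enorm_neg]; gcongr))
    simp [sub_eq_add_neg]

/-! Cutoffs -/
def bump0 : ContDiffBump (0 : Pt 3) := ⟨1, 2, by norm_num, by norm_num⟩
def chi (n : ℕ) (x : Pt 3) : ℝ := bump0 (((n:ℝ)+1)⁻¹ • x)

lemma chi_smooth (n : ℕ) : ContDiff ℝ ∞ (chi n) := by
  unfold chi
  exact bump0.contDiff.comp (contDiff_const_smul _)
lemma chi_nonneg (n x) : 0 ≤ chi n x := bump0.nonneg
lemma chi_le_one (n x) : chi n x ≤ 1 := bump0.le_one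
lemma chi_one {n : ℕ} {x : Pt 3} (h : ‖x‖ ≤ n + 1) : chi n x = 1 := by
  apply bump0.one_of_mem_closedBall
  simp [bump0, norm_smul]
  rw [abs_of_pos (by positivity), inv_mul_le_iff₀ (by positivity)]
  linarith
lemma chi_zero {n : ℕ} {x : Pt 3} (h : 2 * (n + 1) ≤ ‖x‖) : chi n x = 0 := by
  apply bump0.zero_of_le_dist
  simp [bump0, norm_smul]
  rw [abs_of_pos (by positivity), le_inv_mul_iff₀ (by positivity)]
  linarith
lemma chi_compact (n : ℕ) : HasCompactSupport (chi n) := by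
  apply HasCompactSupport.intro (isCompact_closedBall (0 : Pt 3) (2 * (n+1)))
  intro x hx
  apply chi_zero
  simp at hx
  linarith
lemma chi_tendsto (x : Pt 3) : Tendsto (fun n => chi n x) atTop (𝓝 1) := by
  apply tendsto_const_nhds.congr'
  filter_upwards [eventually_ge_atTop ⌈‖x‖⌉₊] with n hn
  rw [chi_one]
  have := Nat.ceil_le.1 hn
  linarith

lemma bump0_deriv : ∃ L : ℝ≥0, ∀ x, ‖fderiv ℝ (bump0 : Pt 3 → ℝ) x‖ ≤ L := by
  have hc : Continuous (fderiv ℝ (bump0 : Pt 3 → ℝ)) := 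
    (bump0.contDiff (n := 1)).continuous_fderiv (by norm_num)
  obtain ⟨C, hC⟩ := hc.bounded_above_of_compact_support (bump0.hasCompactSupport.fderiv ℝ)
  exact ⟨C.toNNReal, fun x => (hC x).trans (Real.le_coe_toNNReal C)⟩

def Lchi : ℝ≥0 := bump0_deriv.choose

lemma chi_deriv (n : ℕ) (x : Pt 3) : ‖fderiv ℝ (chi n) x‖ ≤ Lchi := by
  have h := bump0_deriv.choose_spec (((n:ℝ)+1)⁻¹ • x)
  have e : fderiv ℝ (chi n) x = ((n:ℝ)+1)⁻¹ • fderiv ℝ (bump0 : Pt 3 → ℝ) (((n:ℝ)+1)⁻¹ • x) := by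
    unfold chi
    exact fderiv_comp_smul _
  rw [e, norm_smul]
  have : ‖((n:ℝ)+1)⁻¹‖ ≤ 1 := by
    rw [Real.norm_of_nonneg (by positivity)]
    exact inv_le_one_of_one_le₀ (by linarith [Nat.cast_nonneg (α := ℝ) n])
  calc _ ≤ 1 * (Lchi:ℝ) := by gcongr; exact h
    _ = _ := one_mul _

end

section
open scoped ENNReal NNReal Topology FourierTransform ContDiff SchwartzMap Convolution
open Filter

lemma fderiv_eLp_le {v : Pt 3 → ℂ} {K : ℝ≥0} (hT : TL v K) (hd : Differentiable ℝ v) :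
    eLpNorm (fun x => ∑ j, ‖fderiv ℝ v x (ee j)‖) 2 volume ≤ 3 * K := by
  have hm : ∀ j, AEStronglyMeasurable (fun x => ‖fderiv ℝ v x (ee j)‖) volume := fun j =>
    (measurable_fderiv_apply_const ℝ v (ee j)).norm.aestronglyMeasurable
  have h := eLpNorm_sum_le (p := 2) (μ := (volume : Measure (Pt 3))) (s := Finset.univ) (f := fun j x => ‖fderiv ℝ v x (ee j)‖)
    (fun j _ => hm j) (by norm_num)
  have e : (∑ j : Fin 3, fun x => ‖fderiv ℝ v x (ee j)‖) = fun x => ∑ j, ‖fderiv ℝ v x (ee j)‖ := by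
    ext x; simp
  rw [e] at h
  refine h.trans ?_
  have : ∀ j ∈ Finset.univ, eLpNorm (fun x => ‖fderiv ℝ v x (ee j)‖) 2 volume ≤ (K : ℝ≥0∞) := by
    intro j _
    rw [eLpNorm_norm]
    refine (TL_fderiv hT hd (ee j)).trans (le_of_eq ?_)
    rw [← ofReal_norm, ee, EuclideanSpace.norm_single]; simp
  refine (Finset.sum_le_sum this).trans ?_
  simp

lemma L6_cut (n : ℕ) {v : Pt 3 → ℂ} {K : ℝ≥0} (hT : TL v K) (hd : ContDiff ℝ 1 v) (h2 : MemLp v 2) :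
    eLpNorm (fun x => chi n x • v x) 6 volume ≤
      SNormLESNormFDerivOfEqConst ℂ (volume : Measure (Pt 3)) 2 * (3 * K + Lchi * eLpNorm v 2 volume) := by
  have hs : ContDiff ℝ 1 (fun x => chi n x • v x) := ((chi_smooth n).of_le (by simp)).smul hd
  have hc : HasCompactSupport (fun x => chi n x • v x) := (chi_compact n).smul_right
  have := eLpNorm_le_eLpNorm_fderiv_of_eq (volume : Measure (Pt 3)) hs hc (p := 2) (p' := 6) (by norm_num)
    (by simp) (by simp; norm_num)
  refine (by exact_mod_cast this : _ ≤ _).trans ?_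
  gcongr
  have hdd := hd.differentiable (by norm_num)
  have hm : ∀ j, AEStronglyMeasurable (fun x => ‖fderiv ℝ v x (ee j)‖) volume := fun j =>
    (measurable_fderiv_apply_const ℝ v (ee j)).norm.aestronglyMeasurable
  calc eLpNorm (fderiv ℝ (fun x => chi n x • v x)) 2 volume 
      ≤ eLpNorm ((fun x => ∑ j, ‖fderiv ℝ v x (ee j)‖) + fun x => (Lchi:ℝ) * ‖v x‖) 2 volume := by
        apply eLpNorm_mono_real
        intro x
        rw [fderiv_fun_smul ((chi_smooth n).differentiable (by simp) x) (hdd x)]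
        refine (norm_add_le _ _).trans ?_
        simp only [Pi.add_apply]
        gcongr
        · rw [norm_smul, Real.norm_of_nonneg (chi_nonneg n x)]
          calc _ ≤ 1 * ‖fderiv ℝ v x‖ := by gcongr; exact chi_le_one n x
            _ ≤ _ := by rw [one_mul]; exact opnorm_le_sum _
        · refine (ContinuousLinearMap.norm_smulRight_apply _ _).le.trans ?_
          gcongr
          exact chi_deriv n x
    _ ≤ _ := by
        refine (eLpNorm_add_le ?_ ?_ (by norm_num)).trans ?_
        · exact Finset.aestronglyMeasurable_fun_sum _ fun j _ => hm j
        · exact (h2.1.norm.const_mul _)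
        gcongr
        · exact fderiv_eLp_le hT hdd
        · have := eLpNorm_const_smul (Lchi:ℝ) (fun x => ‖v x‖) 2 (volume : Measure (Pt 3))
          refine this.le.trans ?_
          rw [eLpNorm_norm]; gcongr
          simp

def C6 : ℝ≥0 := SNormLESNormFDerivOfEqConst ℂ (volume : Measure (Pt 3)) 2 

lemma L6 {u : Pt 3 → ℂ} {K : ℝ≥0} (hT : TL u K) (h2 : MemLp u 2) :
    eLpNorm u 6 volume ≤ C6 * (3 * K + Lchi * eLpNorm u 2 volume) := by
  have hl : LocallyIntegrable u := h2.locallyIntegrable (by norm_num)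
  apply fatou_eLp (f := fun n => molf n u) (fun n => (molf_memLp n h2).1) (molf_tendsto hl)
  intro n
  apply fatou_eLp (f := fun m x => chi m x • molf n u x)
  · intro m
    exact ((chi_smooth m).continuous.smul (molf_smooth n hl).continuous).aestronglyMeasurable
  · refine .of_forall fun x => ?_
    simpa using (chi_tendsto x).smul_const (molf n u x)
  · intro m
    refine (L6_cut m (molf_TL n h2 hT) ((molf_smooth n hl).of_le (by simp)) (molf_memLp n h2)).trans ?_
    unfold C6
    gcongr
    exact molf_norm n h2.1

/-- `H¹` via Lipschitz translations. -/
def H1 (u : Pt 3 → ℂ) : Prop := MemLp u 2 ∧ ∃ K, TL u K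

lemma H1.mem6 {u : Pt 3 → ℂ} (h : H1 u) : MemLp u 6 := by
  obtain ⟨h2, K, hK⟩ := h
  refine ⟨h2.1, (L6 hK h2).trans_lt ?_⟩
  exact ENNReal.mul_lt_top (by simp) (ENNReal.add_lt_top.2 ⟨by exact ENNReal.mul_lt_top (by simp) (by simp), ENNReal.mul_lt_top (by simp) h2.2⟩)

lemma H1.congr {u v : Pt 3 → ℂ} (h : H1 u) (e : u =ᵐ[volume] v) : H1 v := 
  ⟨(memLp_congr_ae e).1 h.1, h.2.choose, h.2.choose_spec.congr e⟩

lemma TL_dom {ι : Type*} (s : Finset ι) {v : ι → Pt 3 → ℂ} {w : Pt 3 → ℂ} (hv : ∀ i ∈ s, H1 (v i)) (C : ℝ≥0)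
    (hw : ∀ h : Pt 3, ∀ᵐ x, ‖w (x + h) - w x‖ ≤ C * ∑ i ∈ s, ‖v i (x + h) - v i x‖) : ∃ K, TL w K := by
  have : ∀ i, ∃ K, i ∈ s → TL (v i) K := fun i => by
    by_cases hi : i ∈ s
    · obtain ⟨K, hK⟩ := (hv i hi).2
      exact ⟨K, fun _ => hK⟩
    · exact ⟨0, fun h => absurd h hi⟩
  choose K hK using this
  refine ⟨C * ∑ i ∈ s, K i, fun h => ?_⟩
  have hm : ∀ i ∈ s, AEStronglyMeasurable (fun x => ‖v i (x + h) - v i x‖) volume := fun i hi =>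
    ((mem_shift (hv i hi).1 h).sub (hv i hi).1).1.norm
  calc _ ≤ eLpNorm ((C:ℝ) • ∑ i ∈ s, fun x => ‖v i (x + h) - v i x‖) 2 volume := by
        apply eLpNorm_mono_ae_real
        filter_upwards [hw h] with x hx
        simpa using hx
    _ ≤ C * ∑ i ∈ s, K i * ‖h‖ₑ := by
        rw [eLpNorm_const_smul]
        gcongr
        · simp
        refine (eLpNorm_sum_le (fun i hi => hm i hi) (by norm_num)).trans ?_
        gcongr with i hi
        rw [eLpNorm_norm]
        exact hK i hi h
    _ = _ := by rw [← Finset.sum_mul]; push_cast; ring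

lemma H1.add {u v : Pt 3 → ℂ} (hu : H1 u) (hv : H1 v) : H1 (fun x => u x + v x) := by
  refine ⟨hu.1.add hv.1, ?_⟩
  refine TL_dom Finset.univ (v := ![u, v]) ?_ 1 fun h => .of_forall fun x => ?_
  · intro i _; fin_cases i <;> simpa
  · simp [Fin.sum_univ_two]
    rw [show u (x+h) + v (x+h) - (u x + v x) = (u (x+h) - u x) + (v (x+h) - v x) by ring]
    exact norm_add_le _ _

lemma H1.zero : H1 (fun _ => 0) := ⟨MemLp.zero, 0, fun h => by simp⟩

lemma H1.sum {ι : Type*} (s : Finset ι) {v : ι → Pt 3 → ℂ} (hv : ∀ i ∈ s, H1 (v i)) :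
    H1 (fun x => ∑ i ∈ s, v i x) := by
  classical
  induction s using Finset.induction_on with
  | empty => simpa using H1.zero
  | insert a s ha ih =>
    simp only [Finset.sum_insert ha]
    exact (hv a (by simp)).add (ih fun i hi => hv i (by simp [hi]))

lemma H1.mul {u g : Pt 3 → ℂ} (hu : H1 u) (hg : Continuous g) {A B : ℝ≥0} (hA : ∀ x, ‖g x‖ ≤ A)
    (hB : ∀ x y, ‖g y - g x‖ ≤ B * ‖y - x‖) : H1 (fun x => g x * u x) := by
  obtain ⟨h2, K, hK⟩ := hu
  have h2' : MemLp (fun x => g x * u x) 2 := by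
    refine (h2.const_mul (A:ℂ)).of_le (hg.aestronglyMeasurable.mul h2.1) (.of_forall fun x => ?_)
    simp only [norm_mul]
    gcongr
    simpa using hA x
  refine ⟨h2', A * K + B * (eLpNorm u 2 volume).toNNReal, fun h => ?_⟩
  calc _ ≤ eLpNorm ((A:ℝ) • (fun x => ‖u (x + h) - u x‖) + ((B:ℝ) * ‖h‖) • fun x => ‖u x‖) 2 volume := by
        apply eLpNorm_mono_real
        intro x
        rw [show g (x+h) * u (x+h) - g x * u x = g (x+h) * (u (x+h) - u x) + (g (x+h) - g x) * u x by ring]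
        refine (norm_add_le _ _).trans ?_
        simp only [norm_mul, Pi.add_apply, Pi.smul_apply, smul_eq_mul]
        gcongr
        · exact hA _
        · simpa using hB x (x+h)
    _ ≤ _ := by
        refine (eLpNorm_add_le ?_ ?_ (by norm_num)).trans ?_
        · exact ((mem_shift h2 h).sub h2).1.norm.const_smul _
        · exact h2.1.norm.const_smul _
        rw [eLpNorm_const_smul, eLpNorm_const_smul, eLpNorm_norm, eLpNorm_norm]
        have e : (((eLpNorm u 2 volume).toNNReal : ℝ≥0) : ℝ≥0∞) = eLpNorm u 2 volume := ENNReal.coe_toNNReal h2.2.ne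
        push_cast
        rw [e, add_mul, enorm_mul, enorm_norm, mul_assoc, mul_assoc, mul_assoc,
          mul_comm ‖h‖ₑ (eLpNorm u 2 volume)]
        gcongr
        · simp
        · exact hK h
        · simp

lemma H1.cmul {u : Pt 3 → ℂ} (hu : H1 u) (c : ℂ) : H1 (fun x => c * u x) :=
  hu.mul (g := fun _ => c) continuous_const (A := ‖c‖₊) (B := 0) (fun x => by simp) (by simp)

lemma H1.smooth_mul {u g : Pt 3 → ℂ} (hu : H1 u) (hg : ContDiff ℝ 1 g) (hc : HasCompactSupport g) :
    H1 (fun x => g x * u x) := by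
  obtain ⟨A, hA⟩ := hg.continuous.bounded_above_of_compact_support hc
  obtain ⟨B, hB⟩ := hg.lipschitzWith_of_hasCompactSupport hc (by norm_num)
  refine hu.mul hg.continuous (A := A.toNNReal) (B := B) (fun x => (hA x).trans (Real.le_coe_toNNReal A)) ?_
  intro x y
  have := hB.dist_le_mul y x
  simpa [dist_eq_norm] using this

end

section
open scoped ENNReal NNReal Topology FourierTransform ContDiff SchwartzMap Convolution
open Filter

lemma weak_sub (U : ℕ → Lp ℂ 2 (volume : Measure (Pt 3))) (A : ℝ) (hA : ∀ n, ‖U n‖ ≤ A) :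
    ∃ φ : ℕ → ℕ, StrictMono φ ∧ ∃ v : Lp ℂ 2 (volume : Measure (Pt 3)),
      ∀ w, Tendsto (fun n => inner ℂ (U (φ n)) w) atTop (𝓝 (inner ℂ v w)) := by
  have : Fact ((2:ℝ≥0∞) ≠ ⊤) := ⟨by simp⟩
  have : TopologicalSpace.SeparableSpace (Lp ℂ 2 (volume : Measure (Pt 3))) := inferInstance
  have hc := WeakDual.isSeqCompact_closedBall ℂ (Lp ℂ 2 (volume : Measure (Pt 3))) 0 A
  let T : ℕ → WeakDual ℂ (Lp ℂ 2 (volume : Measure (Pt 3))) := fun n =>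
    StrongDual.toWeakDual (InnerProductSpace.toDual ℂ _ (U n))
  have hT : ∀ n, T n ∈ WeakDual.toStrongDual ⁻¹' Metric.closedBall 0 A := by
    intro n
    simp only [Set.mem_preimage, mem_closedBall_zero_iff]
    have : WeakDual.toStrongDual (T n) = InnerProductSpace.toDual ℂ _ (U n) := rfl
    rw [this, LinearIsometryEquiv.norm_map]
    exact hA n
  obtain ⟨ℓ, -, φ, hφ, hlim⟩ := hc hT
  refine ⟨φ, hφ, (InnerProductSpace.toDual ℂ _).symm (WeakDual.toStrongDual ℓ), fun w => ?_⟩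
  rw [InnerProductSpace.toDual_symm_apply]
  have := ((WeakDual.eval_continuous (𝕜 := ℂ) w).tendsto ℓ).comp hlim
  exact this

lemma mol_shift_memLp (k : ℕ) (x : Pt 3) : MemLp (fun t => (mol k (x - t) : ℂ)) 2 := by
  apply Continuous.memLp_of_hasCompactSupport
  · have := mol_cont k; fun_prop
  · have h1 : HasCompactSupport (fun t => mol k (x - t)) :=
      (mol_compact k).comp_homeomorph (Homeomorph.subLeft x)
    exact h1.comp_left (g := fun r : ℝ => (r:ℂ)) (by simp)

lemma molf_inner (k : ℕ) (x : Pt 3) (u : Lp ℂ 2 (volume : Measure (Pt 3))) :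
    molf k u x = inner ℂ ((mol_shift_memLp k x).toLp _) u := by
  rw [molf_eq2, L2.inner_def]
  apply integral_congr_ae
  filter_upwards [(mol_shift_memLp k x).coeFn_toLp] with t ht
  rw [ht]
  simp [mul_comm]

lemma mol_shift_norm (k : ℕ) (x : Pt 3) : ‖(mol_shift_memLp k x).toLp _‖ = ‖(mol_shift_memLp k 0).toLp _‖ := by
  rw [Lp.norm_toLp, Lp.norm_toLp]
  congr 1
  have := eLpNorm_comp_measurePreserving (p := 2) (mol_shift_memLp k x).1 (measurePreserving_add_right (volume : Measure (Pt 3)) x)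
  rw [← this]
  congr 1; ext t; simp

lemma molf_bound (k : ℕ) (x : Pt 3) (u : Lp ℂ 2 (volume : Measure (Pt 3))) :
    ‖molf k u x‖ ≤ ‖(mol_shift_memLp k 0).toLp _‖ * ‖u‖ := by
  rw [molf_inner, ← mol_shift_norm k x]
  exact norm_inner_le_norm _ _

lemma ind_tendsto (k : ℕ) (R : ℝ) {U : ℕ → Lp ℂ 2 (volume : Measure (Pt 3))} {v : Lp ℂ 2 (volume : Measure (Pt 3))}
    {A : ℝ} (hA : ∀ n, ‖U n‖ ≤ A)
    (hw : ∀ w, Tendsto (fun n => inner ℂ (U n) w) atTop (𝓝 (inner ℂ v w))) :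
    Tendsto (fun n => eLpNorm ((Metric.closedBall (0:Pt 3) R).indicator
      (fun x => molf k (U n) x - molf k v x)) 2 volume) atTop (𝓝 0) := by
  set g := (mol_shift_memLp k 0).toLp _ with hg
  have hcont : ∀ w : Lp ℂ 2 (volume : Measure (Pt 3)), Continuous (molf k w) := fun w =>
    (molf_smooth k ((Lp.memLp w).locallyIntegrable (by norm_num))).continuous
  have h0 : Tendsto (fun n => ∫⁻ x in Metric.closedBall (0:Pt 3) R, ‖molf k (U n) x - molf k v x‖ₑ ^ 2) atTop
      (𝓝 (∫⁻ x in Metric.closedBall (0:Pt 3) R, 0)) := by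
    apply tendsto_lintegral_of_dominated_convergence' (fun _ => ENNReal.ofReal (‖g‖ * A + ‖g‖ * ‖v‖) ^ 2)
    · intro n
      have := (hcont (U n)).sub (hcont v)
      exact (this.enorm.measurable.pow_const 2).aemeasurable
    · intro n
      refine .of_forall fun x => ?_
      refine pow_le_pow_left' ?_ 2
      rw [← ofReal_norm]
      apply ENNReal.ofReal_le_ofReal
      refine (norm_sub_le _ _).trans ?_
      refine add_le_add ((molf_bound k x _).trans ?_) (molf_bound k x _)
      gcongr
      exact hA n
    · rw [lintegral_const, Measure.restrict_apply_univ]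
      exact ENNReal.mul_ne_top (by simp) (measure_closedBall_lt_top).ne
    · refine .of_forall fun x => ?_
      have h1 : Tendsto (fun n => molf k (U n) x) atTop (𝓝 (molf k v x)) := by
        simp only [molf_inner]
        have := (Complex.continuous_conj.tendsto _).comp (hw ((mol_shift_memLp k x).toLp _))
        simp only [inner_conj_symm] at this
        refine this.congr fun n => ?_
        simp only [Function.comp, inner_conj_symm]
      have h2 : Tendsto (fun n => molf k (U n) x - molf k v x) atTop (𝓝 0) := by
        simpa using h1.sub_const (molf k v x)
      have := (ENNReal.continuous_pow 2).tendsto _ |>.comp ((continuous_enorm.tendsto _).comp h2)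
      simpa [Function.comp_def] using this
  rw [lintegral_zero] at h0
  have h3 := ((ENNReal.continuous_rpow_const (y := 2⁻¹)).tendsto 0).comp h0
  rw [ENNReal.zero_rpow_of_pos (by norm_num)] at h3
  refine h3.congr fun n => ?_
  rw [eLpNorm_indicator_eq_eLpNorm_restrict measurableSet_closedBall]
  simp only [Function.comp]
  rw [← eLpNorm_two_sq, ← ENNReal.rpow_natCast, ← ENNReal.rpow_mul]
  norm_num

lemma rellich (u : ℕ → Pt 3 → ℂ) (A K : ℝ≥0) (hm : ∀ n, MemLp (u n) 2) (hA : ∀ n, eLpNorm (u n) 2 volume ≤ A)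
    (hK : ∀ n, TL (u n) K) (hx : ∀ n, eLpNorm (fun x => ‖x‖ * ‖u n x‖) 2 volume ≤ A) :
    ∃ φ : ℕ → ℕ, StrictMono φ ∧ ∃ v : Pt 3 → ℂ, MemLp v 2 ∧
      Tendsto (fun n => eLpNorm (fun x => u (φ n) x - v x) 2 volume) atTop (𝓝 0) := by
  let U0 : ℕ → Lp ℂ 2 (volume : Measure (Pt 3)) := fun n => (hm n).toLp _
  have hU0 : ∀ n, ‖U0 n‖ ≤ A := by
    intro n
    rw [Lp.norm_toLp]
    exact ENNReal.toReal_le_coe_of_le_coe (hA n)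
  obtain ⟨φ, hφ, v, hv⟩ := weak_sub U0 A hU0
  let U := fun n => U0 (φ n)
  have hU : ∀ n, ‖U n‖ ≤ A := fun n => hU0 _
  have hUe : ∀ n, U n =ᵐ[volume] u (φ n) := fun n => (hm (φ n)).coeFn_toLp
  have hUm : ∀ n, MemLp (U n) 2 := fun n => Lp.memLp _
  have hUT : ∀ n, TL (U n) K := fun n => (hK (φ n)).congr (hUe n).symm
  have hUx : ∀ n, eLpNorm (fun x => ‖x‖ * ‖U n x‖) 2 volume ≤ A := fun n => by
    refine le_trans (le_of_eq ?_) (hx (φ n))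
    apply eLpNorm_congr_ae
    filter_upwards [hUe n] with x hx
    rw [hx]
  have hcont : ∀ k, ∀ w : Lp ℂ 2 (volume : Measure (Pt 3)), Continuous (molf k w) := fun k w =>
    (molf_smooth k ((Lp.memLp w).locallyIntegrable (by norm_num))).continuous
  -- key estimate
  have key : ∀ (k : ℕ) (n m : ℕ), eLpNorm (U n - U m : Pt 3 → ℂ) 2 volume ≤
      (2 * ENNReal.ofReal ((k:ℝ)+1)⁻¹ * A + 2 * (K * ENNReal.ofReal ((k:ℝ)+1)⁻¹)) + 
      (eLpNorm ((Metric.closedBall (0:Pt 3) (k+1)).indicator (fun x => molf k (U n) x - molf k v x)) 2 volume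
       + eLpNorm ((Metric.closedBall (0:Pt 3) (k+1)).indicator (fun x => molf k (U m) x - molf k v x)) 2 volume) := by
    intro k n m
    let a1 : ℕ → Pt 3 → ℝ := fun n => ((k:ℝ)+1)⁻¹ • fun x => ‖x‖ * ‖U n x‖
    let a2 : ℕ → Pt 3 → ℝ := fun n x => ‖molf k (U n) x - U n x‖
    let a3 : ℕ → Pt 3 → ℝ := fun n x => ‖(Metric.closedBall (0:Pt 3) (k+1)).indicator (fun x => molf k (U n) x - molf k v x) x‖
    have m1 : ∀ n, AEStronglyMeasurable (a1 n) volume := fun n =>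
      ((continuous_norm.aestronglyMeasurable.mul (hUm n).1.norm).const_smul _)
    have m2 : ∀ n, AEStronglyMeasurable (a2 n) volume := fun n =>
      (((hcont k (U n)).aestronglyMeasurable.sub (hUm n).1).norm)
    have m3 : ∀ n, AEStronglyMeasurable (a3 n) volume := fun n =>
      (((hcont k (U n)).sub (hcont k v)).aestronglyMeasurable.indicator measurableSet_closedBall).norm
    have hk : (0:ℝ) < (k:ℝ)+1 := by positivity
    have hle : ∀ n x, 0 ≤ a1 n x ∧ 0 ≤ a2 n x ∧ 0 ≤ a3 n x := fun n x =>
      ⟨by simp only [a1, Pi.smul_apply, smul_eq_mul]; positivity, norm_nonneg _, norm_nonneg _⟩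
    have hb : ∀ n, eLpNorm (a1 n + a2 n + a3 n) 2 volume ≤ ENNReal.ofReal ((k:ℝ)+1)⁻¹ * A + (K * ENNReal.ofReal ((k:ℝ)+1)⁻¹)
        + eLpNorm ((Metric.closedBall (0:Pt 3) (k+1)).indicator (fun x => molf k (U n) x - molf k v x)) 2 volume := by
      intro n
      refine (eLpNorm_add_le ((m1 n).add (m2 n)) (m3 n) (by norm_num)).trans ?_
      gcongr
      · refine (eLpNorm_add_le (m1 n) (m2 n) (by norm_num)).trans ?_
        gcongr
        · simp only [a1]
          rw [eLpNorm_const_smul]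
          gcongr
          · rw [Real.enorm_of_nonneg (by positivity)]
          · exact hUx n
        · simp only [a2]
          rw [eLpNorm_norm]
          exact molf_close k (hUm n) (hUT n)
      · simp only [a3]
        rw [eLpNorm_norm]
    calc _ ≤ eLpNorm ((a1 n + a2 n + a3 n) + (a1 m + a2 m + a3 m)) 2 volume := by
          apply eLpNorm_mono_real
          intro x
          obtain ⟨p1, p2, p3⟩ := hle n x
          obtain ⟨q1, q2, q3⟩ := hle m x
          simp only [Pi.add_apply, Pi.sub_apply]
          by_cases hx : x ∈ Metric.closedBall (0:Pt 3) (k+1)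
          · have e3 : ∀ n, a3 n x = ‖molf k (U n) x - molf k v x‖ := fun n => by
              simp only [a3, Set.indicator_of_mem hx]
            have : ‖U n x - U m x‖ ≤ a2 n x + a3 n x + a2 m x + a3 m x := by
              rw [e3, e3]
              have : U n x - U m x = -(molf k (U n) x - U n x) + (molf k (U n) x - molf k v x)
                + (molf k (U m) x - U m x) - (molf k (U m) x - molf k v x) := by ring
              rw [this]
              refine (norm_sub_le _ _).trans ?_
              gcongr
              refine (norm_add_le _ _).trans ?_
              gcongr
              refine (norm_add_le _ _).trans ?_
              rw [norm_neg]
            linarith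
          · have hx' : (k:ℝ) + 1 < ‖x‖ := by simpa using hx
            have : ∀ n, ‖U n x‖ ≤ a1 n x := fun n => by
              simp only [a1, Pi.smul_apply, smul_eq_mul]
              rw [le_inv_mul_iff₀ hk]
              gcongr
            have := norm_sub_le (U n x) (U m x)
            linarith [‹∀ n, ‖U n x‖ ≤ a1 n x› n, ‹∀ n, ‖U n x‖ ≤ a1 n x› m]
      _ ≤ _ := by
          refine (eLpNorm_add_le (((m1 n).add (m2 n)).add (m3 n)) (((m1 m).add (m2 m)).add (m3 m)) (by norm_num)).trans ?_
          refine (add_le_add (hb n) (hb m)).trans (le_of_eq ?_)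
          ring
  have hcauchy : CauchySeq U := by
    rw [Lp.cauchySeq_Lp_iff_cauchySeq_eLpNorm]
    rw [ENNReal.tendsto_nhds_zero]
    intro ε hε
    have t1 : Tendsto (fun k : ℕ => 2 * ENNReal.ofReal ((k:ℝ)+1)⁻¹ * A + 2 * (K * ENNReal.ofReal ((k:ℝ)+1)⁻¹)) atTop (𝓝 0) := by
      have t0 : Tendsto (fun k : ℕ => ENNReal.ofReal ((k:ℝ)+1)⁻¹) atTop (𝓝 0) := by
        have := (ENNReal.continuous_ofReal.tendsto 0).comp (tendsto_one_div_add_atTop_nhds_zero_nat (𝕜 := ℝ))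
        simpa [Function.comp_def] using this
      have t2 : Tendsto (fun k : ℕ => 2 * ENNReal.ofReal ((k:ℝ)+1)⁻¹ * A) atTop (𝓝 (2 * 0 * A)) :=
        ENNReal.Tendsto.mul_const (ENNReal.Tendsto.const_mul t0 (by simp)) (by simp)
      have t3 : Tendsto (fun k : ℕ => 2 * (K * ENNReal.ofReal ((k:ℝ)+1)⁻¹)) atTop (𝓝 (2 * (K * 0))) :=
        ENNReal.Tendsto.const_mul (ENNReal.Tendsto.const_mul t0 (by simp)) (by simp)
      simpa using t2.add t3
    have hε2 : 0 < ε / 2 := ENNReal.half_pos hε.ne'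
    obtain ⟨k, hk⟩ := ((ENNReal.tendsto_nhds_zero.1 t1) (ε / 2) hε2).exists
    have t4 := ind_tendsto k (k+1) hU hv
    have t5 : Tendsto (fun p : ℕ × ℕ => 
      (eLpNorm ((Metric.closedBall (0:Pt 3) (k+1)).indicator (fun x => molf k (U p.1) x - molf k v x)) 2 volume
       + eLpNorm ((Metric.closedBall (0:Pt 3) (k+1)).indicator (fun x => molf k (U p.2) x - molf k v x)) 2 volume)) atTop (𝓝 0) := by
      rw [← prod_atTop_atTop_eq]
      have := (t4.comp tendsto_fst).add (t4.comp (tendsto_snd (f := atTop (α := ℕ)) (g := atTop (α := ℕ))))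
      simpa using this
    filter_upwards [(ENNReal.tendsto_nhds_zero.1 t5) (ε / 2) hε2] with p hp
    refine (key k p.1 p.2).trans ?_
    calc _ ≤ ε / 2 + ε / 2 := add_le_add hk hp
      _ = ε := ENNReal.add_halves ε
  obtain ⟨w, hw⟩ := cauchySeq_tendsto_of_complete hcauchy
  refine ⟨φ, hφ, w, Lp.memLp w, ?_⟩
  have := (Lp.tendsto_Lp_iff_tendsto_eLpNorm' U w).1 hw
  refine this.congr fun n => ?_
  apply eLpNorm_congr_ae
  filter_upwards [hUe n] with x hx
  simp [hx]

end

section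
open scoped ENNReal NNReal Topology FourierTransform ContDiff SchwartzMap Convolution
open Filter

def pd (f : Pt 3 → ℂ) (j : Fin 3) (x : Pt 3) : ℂ := fderiv ℝ f x (ee j)
def Lap (f : Pt 3 → ℂ) (x : Pt 3) : ℂ := ∑ j, pd (pd f j) j x
def CC (f : Pt 3 → ℂ) : Prop := ContDiff ℝ ∞ f ∧ HasCompactSupport f

lemma pd_smooth {f : Pt 3 → ℂ} (h : ContDiff ℝ ∞ f) (j) : ContDiff ℝ ∞ (pd f j) := by
  have : ContDiff ℝ ∞ (fderiv ℝ f) := h.fderiv_right (by simp)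
  exact this.clm_apply contDiff_const

lemma CC.pd {f : Pt 3 → ℂ} (h : CC f) (j) : CC (pd f j) :=
  ⟨pd_smooth h.1 j, by
    have := h.2.fderiv (𝕜 := ℝ)
    exact this.comp_left (g := fun T : Pt 3 →L[ℝ] ℂ => T (ee j)) (by simp)⟩

lemma CC.add {f g : Pt 3 → ℂ} (hf : CC f) (hg : CC g) : CC (fun x => f x + g x) :=
  ⟨hf.1.add hg.1, hf.2.add hg.2⟩
lemma CC.zero : CC (fun _ => 0) := ⟨contDiff_const, HasCompactSupport.zero⟩
lemma CC.sum {ι : Type*} (s : Finset ι) {v : ι → Pt 3 → ℂ} (hv : ∀ i ∈ s, CC (v i)) :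
    CC (fun x => ∑ i ∈ s, v i x) := by
  classical
  induction s using Finset.induction_on with
  | empty => simpa using CC.zero
  | insert a s ha ih =>
    simp only [Finset.sum_insert ha]
    exact (hv a (by simp)).add (ih fun i hi => hv i (by simp [hi]))
lemma CC.Lap {f : Pt 3 → ℂ} (h : CC f) : CC (Lap f) := CC.sum _ fun j _ => (h.pd j).pd j
lemma CC.smul {f g : Pt 3 → ℂ} (hg : CC g) (hf : ContDiff ℝ ∞ f) : CC (fun x => f x * g x) :=
  ⟨hf.mul hg.1, hg.2.mul_left⟩
lemma CC.smul' {f g : Pt 3 → ℂ} (hg : CC g) (hf : ContDiff ℝ ∞ f) : CC (fun x => g x * f x) :=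
  ⟨hg.1.mul hf, hg.2.mul_right⟩
lemma CC.cmul {g : Pt 3 → ℂ} (hg : CC g) (c : ℂ) : CC (fun x => c * g x) := hg.smul contDiff_const

lemma CC.int_mul {X u : Pt 3 → ℂ} (hX : CC X) (hu : LocallyIntegrable u) : Integrable (fun x => X x * u x) :=
  hu.integrable_smul_left_of_hasCompactSupport hX.1.continuous hX.2

lemma CC.memLp_mul {X u : Pt 3 → ℂ} (hX : CC X) (hu : MemLp u 2) : MemLp (fun x => X x * u x) 2 := by
  obtain ⟨A, hA⟩ := hX.1.continuous.bounded_above_of_compact_support hX.2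
  refine (hu.const_mul (A:ℂ)).of_le (hX.1.continuous.aestronglyMeasurable.mul hu.1) (.of_forall fun x => ?_)
  simp only [norm_mul]
  gcongr
  exact (hA x).trans (by simpa using le_abs_self A)

lemma CC.H1_mul {X u : Pt 3 → ℂ} (hX : CC X) (hu : H1 u) : H1 (fun x => X x * u x) :=
  hu.smooth_mul (hX.1.of_le (by simp)) hX.2

lemma pd_mul {f g : Pt 3 → ℂ} {x : Pt 3} (hf : DifferentiableAt ℝ f x) (hg : DifferentiableAt ℝ g x) (j) :
    pd (fun x => f x * g x) j x = f x * pd g j x + pd f j x * g x := by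
  unfold pd
  rw [fderiv_fun_mul hf hg]
  simp [mul_comm]

lemma pd_const_mul {g : Pt 3 → ℂ} {x : Pt 3} (hg : DifferentiableAt ℝ g x) (c : ℂ) (j) :
    pd (fun x => c * g x) j x = c * pd g j x := by
  rw [pd_mul (by fun_prop) hg]
  simp [pd]

lemma pd_add {f g : Pt 3 → ℂ} {x : Pt 3} (hf : DifferentiableAt ℝ f x) (hg : DifferentiableAt ℝ g x) (j) :
    pd (fun x => f x + g x) j x = pd f j x + pd g j x := by
  unfold pd
  rw [fderiv_fun_add hf hg]; simp

def EE (ξ x : Pt 3) : ℂ := Complex.exp (-(2 * Real.pi * I) * ((inner ℝ x ξ : ℝ) : ℂ))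

lemma EE_smooth (ξ : Pt 3) : ContDiff ℝ ∞ (EE ξ) := by
  unfold EE
  apply ContDiff.cexp
  apply ContDiff.mul contDiff_const
  exact Complex.ofRealCLM.contDiff.comp (contDiff_id.inner ℝ contDiff_const)

lemma EE_pd (ξ : Pt 3) (j x) : pd (EE ξ) j x = -(2 * Real.pi * I * ξ j) * EE ξ x := by
  have h1 : HasFDerivAt (fun x : Pt 3 => inner ℝ x ξ) (innerSL ℝ ξ) x := by
    have := (innerSL ℝ ξ).hasFDerivAt (x := x)
    refine this.congr_of_eventuallyEq (.of_forall fun y => ?_)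
    simp [real_inner_comm]
  have h2 := Complex.ofRealCLM.hasFDerivAt.comp x h1
  have h3 := (h2.const_mul (-(2 * Real.pi * I))).cexp
  have h4 := h3.fderiv
  unfold pd
  rw [show EE ξ = fun x => Complex.exp (-(2 * Real.pi * I) * ((inner ℝ x ξ : ℝ) : ℂ)) from rfl]
  erw [h4]
  simp [EuclideanSpace.inner_single_right]
  ring

lemma fourier_EE (u : Pt 3 → ℂ) (ξ : Pt 3) : 𝓕 u ξ = ∫ x, EE ξ x * u x := by
  rw [Real.fourier_eq']
  congr 1; ext x
  simp only [EE, smul_eq_mul]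
  congr 2; push_cast; ring

lemma EE_pdpd (ξ : Pt 3) (j x) : pd (pd (EE ξ) j) j x = -(4 * Real.pi ^ 2 * (ξ j) ^ 2) * EE ξ x := by
  have : pd (EE ξ) j = fun x => -(2 * Real.pi * I * ξ j) * EE ξ x := by ext x; exact EE_pd ξ j x
  rw [this, pd_const_mul ((EE_smooth ξ).differentiable (by simp) x), EE_pd]
  ring_nf; simp

lemma pdpd_mul {f g : Pt 3 → ℂ} (hf : ContDiff ℝ ∞ f) (hg : ContDiff ℝ ∞ g) (j x) :
    pd (pd (fun x => f x * g x) j) j x = f x * pd (pd g j) j x + 2 * pd f j x * pd g j x + pd (pd f j) j x * g x := by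
  have hdf := hf.differentiable (by simp)
  have hdg := hg.differentiable (by simp)
  have hdf' := (pd_smooth hf j).differentiable (by simp)
  have hdg' := (pd_smooth hg j).differentiable (by simp)
  have : pd (fun x => f x * g x) j = fun x => f x * pd g j x + pd f j x * g x := by
    ext x; exact pd_mul (hdf x) (hdg x) j
  rw [this, pd_add (f := fun x => f x * pd g j x) (g := fun x => pd f j x * g x) (by fun_prop) (by fun_prop), pd_mul (hdf x) (hdg' x), pd_mul (hdf' x) (hdg x)]
  ring

lemma FE {u f : Pt 3 → ℂ} {F : Fin 3 → Pt 3 → ℂ} (hu : LocallyIntegrable u)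
    (hF : ∀ j, LocallyIntegrable (F j)) (hf : LocallyIntegrable f)
    (hw : ∀ ζ, CC ζ → ∫ x, u x * Lap ζ x = (∑ j, ∫ x, F j x * pd ζ j x) + ∫ x, f x * ζ x)
    {X : Pt 3 → ℂ} (hX : CC X) (ξ : Pt 3) :
    -(4 * Real.pi ^ 2 * ‖ξ‖ ^ 2) * 𝓕 (fun x => X x * u x) ξ =
      ∑ j, (-(2 * Real.pi * I * ξ j)) * 𝓕 (fun x => X x * F j x - 2 * (pd X j x * u x)) ξ
      + 𝓕 (fun x => ∑ j, pd X j x * F j x + X x * f x - Lap X x * u x) ξ := by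
  have hE := EE_smooth ξ
  have hXd := hX.1.differentiable (by simp)
  have hEd := hE.differentiable (by simp)
  have iA : Integrable (fun x => EE ξ x * (X x * u x)) := by
    simpa [mul_assoc] using (hX.smul hE).int_mul hu
  have iB : ∀ j, Integrable (fun x => EE ξ x * (X x * F j x)) := fun j => by
    simpa [mul_assoc] using (hX.smul hE).int_mul (hF j)
  have iC : ∀ j, Integrable (fun x => EE ξ x * (pd X j x * u x)) := fun j => by
    simpa [mul_assoc] using ((hX.pd j).smul hE).int_mul hu
  have iD : ∀ j, Integrable (fun x => EE ξ x * (pd X j x * F j x)) := fun j => by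
    simpa [mul_assoc] using ((hX.pd j).smul hE).int_mul (hF j)
  have iG : Integrable (fun x => EE ξ x * (X x * f x)) := by
    simpa [mul_assoc] using (hX.smul hE).int_mul hf
  have iL : Integrable (fun x => EE ξ x * (Lap X x * u x)) := by
    simpa [mul_assoc] using (hX.Lap.smul hE).int_mul hu
  have e1 : ∀ j, 𝓕 (fun x => X x * F j x - 2 * (pd X j x * u x)) ξ
      = (∫ x, EE ξ x * (X x * F j x)) - 2 * ∫ x, EE ξ x * (pd X j x * u x) := by
    intro j
    rw [fourier_EE, ← integral_const_mul, ← integral_sub (iB j) ((iC j).const_mul 2)]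
    congr 1; ext x; ring
  have e2 : 𝓕 (fun x => ∑ j, pd X j x * F j x + X x * f x - Lap X x * u x) ξ
      = ∑ j, (∫ x, EE ξ x * (pd X j x * F j x)) + (∫ x, EE ξ x * (X x * f x)) - ∫ x, EE ξ x * (Lap X x * u x) := by
    rw [fourier_EE, ← integral_finsetSum _ (fun j _ => iD j), ← integral_add (integrable_finsetSum _ fun j _ => iD j) iG,
      ← integral_sub (f := fun x => ∑ j, EE ξ x * (pd X j x * F j x) + EE ξ x * (X x * f x)) ((integrable_finsetSum _ fun j _ => iD j).add iG) iL]
    congr 1; ext x; rw [← Finset.mul_sum]; ring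
  have h := hw _ (hX.smul' hE)
  have e3 : ∫ x, u x * Lap (fun x => X x * EE ξ x) x = 
      -(4 * Real.pi ^ 2 * ‖ξ‖ ^ 2) * (∫ x, EE ξ x * (X x * u x)) +
      ∑ j, (-(2 * Real.pi * I * ξ j)) * (2 * ∫ x, EE ξ x * (pd X j x * u x)) + ∫ x, EE ξ x * (Lap X x * u x) := by
    simp only [← integral_const_mul]
    rw [← integral_finsetSum _ (fun j _ => ((iC j).const_mul 2).const_mul _), 
      ← integral_add (iA.const_mul _) (integrable_finsetSum _ fun j _ => ((iC j).const_mul 2).const_mul _),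
      ← integral_add (f := fun x => -(4 * Real.pi ^ 2 * ‖ξ‖ ^ 2) * (EE ξ x * (X x * u x)) + ∑ j, (-(2 * Real.pi * I * ξ j)) * (2 * (EE ξ x * (pd X j x * u x)))) ((iA.const_mul _).add (integrable_finsetSum _ fun j _ => ((iC j).const_mul 2).const_mul _)) iL]
    congr 1; ext x
    have hn : (‖ξ‖:ℂ) ^ 2 = ∑ j, (ξ j : ℂ) ^ 2 := by
      rw [← Complex.ofReal_pow, EuclideanSpace.real_norm_sq_eq]; push_cast; rfl
    simp only [Lap, pdpd_mul hX.1 hE, EE_pd, EE_pdpd, hn, Fin.sum_univ_three]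
    ring
  have e4 : ∀ j, ∫ x, F j x * pd (fun x => X x * EE ξ x) j x =
      (-(2 * Real.pi * I * ξ j)) * (∫ x, EE ξ x * (X x * F j x)) + ∫ x, EE ξ x * (pd X j x * F j x) := by
    intro j
    rw [← integral_const_mul, ← integral_add ((iB j).const_mul _) (iD j)]
    congr 1; ext x
    rw [pd_mul (hXd x) (hEd x), EE_pd]; ring
  have e5 : ∫ x, f x * (X x * EE ξ x) = ∫ x, EE ξ x * (X x * f x) := by
    congr 1; ext x; ring
  simp only [e3, e4, e5] at h
  simp only [e1, e2]
  rw [fourier_EE]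
  simp only [Fin.sum_univ_three] at h ⊢
  linear_combination h

end

section
open scoped ENNReal NNReal Topology FourierTransform ContDiff SchwartzMap Convolution
open Filter

lemma wt_mem : MemLp (fun ξ : Pt 3 => (1 + ‖ξ‖ ^ 2)⁻¹) 2 := by
  have hc : Continuous (fun ξ : Pt 3 => (1 + ‖ξ‖ ^ 2)⁻¹) :=
    Continuous.inv₀ (by fun_prop) (fun x => by positivity)
  rw [memLp_two_iff_integrable_sq hc.aestronglyMeasurable]
  have h := (integrable_one_add_norm (E := Pt 3) (μ := volume) (r := 4) (by simp; norm_num)).const_mul 4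
  refine h.mono' (hc.pow 2).aestronglyMeasurable (.of_forall fun ξ => ?_)
  rw [Real.norm_of_nonneg (by positivity), Real.rpow_neg (by positivity)]
  rw [show (4:ℝ) = ((4:ℕ):ℝ) by norm_num, Real.rpow_natCast]
  push_cast
  rw [inv_pow, inv_le_iff_one_le_mul₀ (by positivity)]
  have h0 := norm_nonneg ξ
  have h1 : (1 + ‖ξ‖) ^ 2 ≤ 2 * (1 + ‖ξ‖ ^ 2) := by nlinarith [sq_nonneg (1 - ‖ξ‖)]
  have h2 : (1 + ‖ξ‖) ^ 4 ≤ 4 * (1 + ‖ξ‖ ^ 2) ^ 2 := by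
    calc (1 + ‖ξ‖) ^ 4 = ((1 + ‖ξ‖) ^ 2) ^ 2 := by ring
      _ ≤ (2 * (1 + ‖ξ‖ ^ 2)) ^ 2 := by gcongr
      _ = _ := by ring
  have h3 : 0 < (1 + ‖ξ‖) ^ 4 := by positivity
  calc (1:ℝ) = (1 + ‖ξ‖) ^ 4 * ((1 + ‖ξ‖) ^ 4)⁻¹ := by field_simp
    _ ≤ (4 * (1 + ‖ξ‖ ^ 2) ^ 2) * ((1 + ‖ξ‖) ^ 4)⁻¹ := by gcongr
    _ = _ := by ring

lemma int_of_wt {g : Pt 3 → ℝ} (h0 : MemLp g 2) (h2 : MemLp (fun ξ => ‖ξ‖ ^ 2 * g ξ) 2) : Integrable g := by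
  have h := (h0.add h2).integrable_mul wt_mem
  refine h.congr (.of_forall fun ξ => ?_)
  simp only [Pi.add_apply, Pi.mul_apply]
  have : 0 < 1 + ‖ξ‖ ^ 2 := by positivity
  field_simp

lemma hat_memLp {U : Pt 3 → ℂ} (h1 : Integrable U) (h2 : MemLp U 2) : MemLp (𝓕 U) 2 := 
  ⟨(fourier_cont h1).aestronglyMeasurable, by rw [plancherel_le h1 h2]; exact h2.2⟩

lemma hat_int {U : Pt 3 → ℂ} (h1 : Integrable U) (h2 : MemLp U 2)
    (h : MemLp (fun ξ => ‖ξ‖ ^ 2 * ‖𝓕 U ξ‖) 2) : Integrable (𝓕 U) := by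
  rw [← integrable_norm_iff (fourier_cont h1).aestronglyMeasurable]
  exact int_of_wt (hat_memLp h1 h2).norm h

lemma hat_bdd {U : Pt 3 → ℂ} (h1 : Integrable U) (h2 : MemLp U 2)
    (h : MemLp (fun ξ => ‖ξ‖ ^ 2 * ‖𝓕 U ξ‖) 2) : ∃ B : ℝ≥0, ∀ᵐ x, ‖U x‖ ≤ B := by
  have hi := hat_int h1 h2 h
  refine ⟨(∫ ξ, ‖𝓕 U ξ‖).toNNReal, ?_⟩
  filter_upwards [fourier_inv_ae h1 hi] with x hx
  rw [hx, Real.coe_toNNReal _ (integral_nonneg fun _ => norm_nonneg _), Real.fourierInv_eq']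
  refine (norm_integral_le_integral_norm _).trans (le_of_eq ?_)
  congr 1; ext ξ
  rw [norm_smul, Complex.norm_exp_ofReal_mul_I, one_mul]

lemma hat_C1 {U : Pt 3 → ℂ} (h1 : Integrable U) (h2 : MemLp U 2)
    (h : MemLp (fun ξ => ‖ξ‖ ^ 2 * ‖𝓕 U ξ‖) 2) (h3 : MemLp (fun ξ => ‖ξ‖ ^ 3 * ‖𝓕 U ξ‖) 2) :
    ∃ v : Pt 3 → ℂ, ContDiff ℝ 1 v ∧ U =ᵐ[volume] v := by
  have hi := hat_int h1 h2 h
  have hc := fourier_cont h1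
  have hA := hat_memLp h1 h2
  have hB : MemLp (fun ξ => ‖ξ‖ * ‖𝓕 U ξ‖) 2 := by
    refine (hA.norm.add h).of_le (Continuous.aestronglyMeasurable (by fun_prop)) (.of_forall fun ξ => ?_)
    rw [Real.norm_of_nonneg (by positivity), Real.norm_of_nonneg (by simp only [Pi.add_apply]; positivity)]
    simp only [Pi.add_apply]
    nlinarith [sq_nonneg (‖ξ‖ - 1), norm_nonneg ξ, norm_nonneg (𝓕 U ξ), mul_nonneg (sq_nonneg (‖ξ‖ - 1)) (norm_nonneg (𝓕 U ξ)),
      mul_nonneg (sq_nonneg (‖ξ‖)) (norm_nonneg (𝓕 U ξ))]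
  have hi1 : Integrable (fun ξ => ‖ξ‖ * ‖𝓕 U ξ‖) := int_of_wt hB (by
    refine (memLp_congr_ae (.of_forall fun ξ => ?_)).1 h3
    ring)
  refine ⟨_, ?_, fourier_inv_ae h1 hi⟩
  rw [Real.fourierInv_eq_fourier_comp_neg]
  refine Real.contDiff_fourier (N := 1) fun n hn => ?_
  have hn : n ≤ 1 := by exact_mod_cast hn
  interval_cases n
  · simpa using hi.comp_neg.norm
  · simpa using hi1.comp_neg

/-- pointwise bound from the equation -/
lemma eq_bound {A : ℂ} {G : Fin 3 → ℂ} {g : ℂ} {ξ : Pt 3}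
    (h : -(4 * Real.pi ^ 2 * ‖ξ‖ ^ 2) * A = ∑ j, (-(2 * Real.pi * I * ξ j)) * G j + g) :
    ‖ξ‖ ^ 2 * ‖A‖ ≤ ∑ j, ‖ξ‖ * ‖G j‖ + ‖g‖ := by
  have hp := Real.pi_gt_three
  have h1 : 4 * Real.pi ^ 2 * (‖ξ‖ ^ 2 * ‖A‖) ≤ 2 * Real.pi * ∑ j, ‖ξ‖ * ‖G j‖ + ‖g‖ := by
    have e := congrArg norm h
    have e1 : ‖-(4 * (Real.pi:ℂ) ^ 2 * (‖ξ‖:ℂ) ^ 2) * A‖ = 4 * Real.pi ^ 2 * (‖ξ‖ ^ 2 * ‖A‖) := by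
      simp [abs_of_pos Real.pi_pos]; ring
    rw [← e1, e]
    refine (norm_add_le _ _).trans ?_
    gcongr
    refine (norm_sum_le _ _).trans ?_
    rw [Finset.mul_sum]
    gcongr with j
    have := PiLp.norm_apply_le ξ j
    simp only [norm_mul, norm_neg, Complex.norm_real, Complex.norm_I, Complex.norm_ofNat, Real.norm_eq_abs, mul_one, abs_of_pos Real.pi_pos] at *
    rw [← mul_assoc]
    gcongr
  have a1 : 0 ≤ ∑ j, ‖ξ‖ * ‖G j‖ := by positivity
  have a2 : 0 ≤ ‖ξ‖ ^ 2 * ‖A‖ := by positivity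
  have a3 := norm_nonneg g
  have : 4 * Real.pi ^ 2 * (‖ξ‖ ^ 2 * ‖A‖) ≤ 4 * Real.pi ^ 2 * (∑ j, ‖ξ‖ * ‖G j‖ + ‖g‖) := by
    nlinarith [mul_nonneg a1 (by nlinarith : 0 ≤ 4 * Real.pi ^ 2 - 2 * Real.pi), mul_nonneg a3 (by nlinarith : 0 ≤ 4 * Real.pi ^ 2 - 1)]
  exact le_of_mul_le_mul_left this (by positivity)

section system
variable {u : Fin 3 → Pt 3 → ℂ} {a : Fin 3 → Fin 3 → Fin 3 → Pt 3 → ℂ} {b : Fin 3 → Fin 3 → Pt 3 → ℂ}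
  {n : Fin 3 → (Fin 3 → ℂ) → ℂ} {C : ℝ≥0}

lemma n_bound (hn0 : ∀ l, n l 0 = 0)
    (hn : ∀ l p q, ‖n l p - n l q‖ ≤ C * (∑ k, ‖p k‖ + ∑ k, ‖q k‖) ^ 2 * ∑ k, ‖p k - q k‖) (l) (p : Fin 3 → ℂ) :
    ‖n l p‖ ≤ C * (∑ k, ‖p k‖) ^ 3 := by
  have := hn l p 0
  rw [hn0] at this
  simp only [sub_zero, Pi.zero_apply, norm_zero, Finset.sum_const_zero, add_zero] at this
  calc _ ≤ _ := this
    _ = _ := by ring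

lemma sum_mem6 (hu : ∀ k, H1 (u k)) : MemLp (fun x => ∑ k, ‖u k x‖) 6 := memLp_finsetSum _ fun k _ => (hu k).mem6.norm

lemma cube_mem2 {g : Pt 3 → ℝ} (h : MemLp g 6) : MemLp (fun x => g x ^ 3) 2 := by
  have := h.norm_rpow_div (3:ℝ≥0∞)
  have e : (6:ℝ≥0∞) / 3 = 2 := by
    refine ((ENNReal.eq_div_iff (by norm_num) (by norm_num)).2 ?_).symm; norm_num
  rw [e] at this
  refine this.of_le ((h.1.pow 3)) (.of_forall fun x => ?_)
  simp

lemma n_meas (hnc : ∀ l, Continuous (n l)) (hu : ∀ k, AEStronglyMeasurable (u k) volume) (l) :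
    AEStronglyMeasurable (fun x => n l (fun k => u k x)) volume :=
  (hnc l).comp_aestronglyMeasurable (aemeasurable_pi_iff.2 fun k => (hu k).aemeasurable).aestronglyMeasurable

lemma n_mem2 (hnc : ∀ l, Continuous (n l)) (hn0 : ∀ l, n l 0 = 0)
    (hn : ∀ l p q, ‖n l p - n l q‖ ≤ C * (∑ k, ‖p k‖ + ∑ k, ‖q k‖) ^ 2 * ∑ k, ‖p k - q k‖)
    (hu : ∀ k, H1 (u k)) (l) : MemLp (fun x => n l (fun k => u k x)) 2 := by
  refine ((cube_mem2 (sum_mem6 hu)).const_mul (C:ℝ)).of_le (n_meas hnc (fun k => (hu k).1.1) l) (.of_forall fun x => ?_)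
  refine (n_bound hn0 hn l _).trans ?_
  rw [Real.norm_of_nonneg (by positivity)]

theorem reg (hu : ∀ k, H1 (u k)) (ha : ∀ l j k, ContDiff ℝ ∞ (a l j k)) (hb : ∀ l k, ContDiff ℝ ∞ (b l k))
    (hnc : ∀ l, Continuous (n l)) (hn0 : ∀ l, n l 0 = 0)
    (hn : ∀ l p q, ‖n l p - n l q‖ ≤ C * (∑ k, ‖p k‖ + ∑ k, ‖q k‖) ^ 2 * ∑ k, ‖p k - q k‖)
    (hw : ∀ l ζ, CC ζ → ∫ x, u l x * Lap ζ x = (∑ j, ∫ x, (∑ k, a l j k x * u k x) * pd ζ j x)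
      + ∫ x, ((∑ k, b l k x * u k x) + n l (fun k => u k x)) * ζ x) :
    ∀ l, ∃ v : Pt 3 → ℂ, ContDiff ℝ 1 v ∧ u l =ᵐ[volume] v := by
  have lu : ∀ k, LocallyIntegrable (u k) := fun k => (hu k).1.locallyIntegrable (by norm_num)
  have lmul : ∀ {g : Pt 3 → ℂ} k, ContDiff ℝ ∞ g → LocallyIntegrable (fun x => g x * u k x) := by
    intro g k hg
    rw [← locallyIntegrableOn_univ] at *
    have := (lu k)
    rw [← locallyIntegrableOn_univ] at this
    exact this.continuousOn_mul hg.continuous.continuousOn (isOpen_univ.isLocallyClosed)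
  have lF : ∀ l j, LocallyIntegrable (fun x => ∑ k, a l j k x * u k x) := fun l j =>
    locallyIntegrable_finsetSum _ fun k _ => lmul k (ha l j k)
  have lB : ∀ l, LocallyIntegrable (fun x => ∑ k, b l k x * u k x) := fun l =>
    locallyIntegrable_finsetSum _ fun k _ => lmul k (hb l k)
  have hN2 : ∀ l, MemLp (fun x => n l (fun k => u k x)) 2 := n_mem2 hnc hn0 hn hu
  have lf : ∀ l, LocallyIntegrable (fun x => (∑ k, b l k x * u k x) + n l (fun k => u k x)) := fun l =>
    (lB l).add ((hN2 l).locallyIntegrable (by norm_num))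
  let G : (Pt 3 → ℂ) → Fin 3 → Fin 3 → Pt 3 → ℂ := fun X l j x =>
    X x * (∑ k, a l j k x * u k x) - 2 * (pd X j x * u l x)
  let g : (Pt 3 → ℂ) → Fin 3 → Pt 3 → ℂ := fun X l x =>
    ∑ j, pd X j x * (∑ k, a l j k x * u k x) + X x * ((∑ k, b l k x * u k x) + n l (fun k => u k x)) - Lap X x * u l x
  have heq : ∀ X, CC X → ∀ l ξ, -(4 * Real.pi ^ 2 * ‖ξ‖ ^ 2) * 𝓕 (fun x => X x * u l x) ξ =
      ∑ j, (-(2 * Real.pi * I * ξ j)) * 𝓕 (G X l j) ξ + 𝓕 (g X l) ξ := fun X hX l ξ =>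
    FE (lu l) (lF l) (lf l) (hw l) hX ξ
  have iG : ∀ X, CC X → ∀ l j, Integrable (G X l j) := fun X hX l j =>
    (hX.int_mul (lF l j)).sub (((hX.pd j).int_mul (lu l)).const_mul 2)
  have ig : ∀ X, CC X → ∀ l, Integrable (g X l) := fun X hX l =>
    ((integrable_finsetSum _ fun j _ => (hX.pd j).int_mul (lF l j)).add (hX.int_mul (lf l))).sub (hX.Lap.int_mul (lu l))
  have hUi : ∀ X, CC X → ∀ l, Integrable (fun x => X x * u l x) := fun X hX l => hX.int_mul (lu l)
  have hU1 : ∀ X, CC X → ∀ l, H1 (fun x => X x * u l x) := fun X hX l => hX.H1_mul (hu l)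
  -- G is H1
  have Geq : ∀ X l j, G X l j = fun x => (∑ k, (X x * a l j k x) * u k x) + (-2 * (pd X j x * u l x)) := by
    intro X l j; ext x; simp only [G, Finset.mul_sum]; 
    rw [sub_eq_add_neg]; congr 1
    · congr 1; ext k; ring
    · ring
  have hG1 : ∀ X, CC X → ∀ l j, H1 (G X l j) := by
    intro X hX l j
    rw [Geq]
    exact (H1.sum _ fun k _ => (hX.smul' (ha l j k)).H1_mul (hu k)).add (((hX.pd j).H1_mul (hu l)).cmul (-2))
  have geq : ∀ X l, g X l = fun x => ((∑ j, ∑ k, (pd X j x * a l j k x) * u k x) + ((∑ k, (X x * b l k x) * u k x) +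
      ((-1) * (Lap X x * u l x)))) + X x * n l (fun k => u k x) := by
    intro X l; ext x; simp only [g, Fin.sum_univ_three]; ring
  have hg0 : ∀ X, CC X → ∀ l, H1 (fun x => ((∑ j, ∑ k, (pd X j x * a l j k x) * u k x) + ((∑ k, (X x * b l k x) * u k x) +
      ((-1) * (Lap X x * u l x))))) := by
    intro X hX l
    refine H1.add (H1.sum _ fun j _ => H1.sum _ fun k _ => ((hX.pd j).smul' (ha l j k)).H1_mul (hu k)) ?_
    exact (H1.sum _ fun k _ => (hX.smul' (hb l k)).H1_mul (hu k)).add ((hX.Lap.H1_mul (hu l)).cmul _)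
  have hg2 : ∀ X, CC X → ∀ l, MemLp (g X l) 2 := by
    intro X hX l
    rw [geq]
    exact (hg0 X hX l).1.add (hX.memLp_mul (hN2 l))
  -- round 1
  have r1 : ∀ X, CC X → ∀ l, MemLp (fun ξ => ‖ξ‖ ^ 2 * ‖𝓕 (fun x => X x * u l x) ξ‖) 2 := by
    intro X hX l
    have m1 : ∀ j, MemLp (fun ξ => ‖ξ‖ * ‖𝓕 (G X l j) ξ‖) 2 := fun j => by
      obtain ⟨K, hK⟩ := (hG1 X hX l j).2
      exact TL_fourier hK (iG X hX l j) (hG1 X hX l j).1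
    have m2 := (memLp_finsetSum Finset.univ fun j _ => m1 j).add (hat_memLp (ig X hX l) (hg2 X hX l)).norm
    have hc := fourier_cont (hUi X hX l)
    refine m2.of_le (Continuous.aestronglyMeasurable (by fun_prop)) (.of_forall fun ξ => ?_)
    simp only [Pi.add_apply]
    rw [Real.norm_of_nonneg (by positivity), Real.norm_of_nonneg (by positivity)]
    exact eq_bound (heq X hX l ξ)
  -- local boundedness
  have bdd : ∀ X, CC X → ∀ l, ∃ B : ℝ≥0, ∀ᵐ x, ‖X x * u l x‖ ≤ B := fun X hX l =>
    hat_bdd (hUi X hX l) (hU1 X hX l).1 (r1 X hX l)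
  have hchi : ∀ m, CC (fun x => (chi m x : ℂ)) := fun m =>
    ⟨Complex.ofRealCLM.contDiff.comp (chi_smooth m), (chi_compact m).comp_left (g := fun r : ℝ => (r:ℂ)) (by simp)⟩
  have hNX : ∀ X, CC X → ∀ l, H1 (fun x => X x * n l (fun k => u k x)) := by
    intro X hX l
    obtain ⟨R, hR⟩ := hX.2.isCompact.isBounded.subset_closedBall (0 : Pt 3)
    let m := ⌈R⌉₊
    have hm : ∀ x, X x ≠ 0 → chi m x = 1 := by
      intro x hx
      apply chi_one
      have h1 := hR (subset_tsupport _ hx)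
      simp at h1
      have := Nat.le_ceil R
      linarith
    let w : Fin 3 → Pt 3 → ℂ := fun k x => (chi m x : ℂ) * u k x
    have hw1 : ∀ k, H1 (w k) := fun k => hU1 _ (hchi m) k
    choose B hB using fun k => bdd _ (hchi m) k
    have hNw : H1 (fun x => n l (fun k => w k x)) := by
      refine ⟨n_mem2 hnc hn0 hn hw1 l, ?_⟩
      refine TL_dom Finset.univ (fun k _ => hw1 k) (C * (∑ k, B k + ∑ k, B k) ^ 2) fun h => ?_
      have hBall : ∀ᵐ x, ∀ k, ‖w k x‖ ≤ B k := ae_all_iff.2 hB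
      have hBs : ∀ᵐ x, ∀ k, ‖w k (x + h)‖ ≤ B k := 
        (measurePreserving_add_right volume h).quasiMeasurePreserving.ae hBall
      filter_upwards [hBall, hBs] with x h1 h2
      refine (hn l _ _).trans ?_
      push_cast
      gcongr with k _ k _
      · exact h2 k
      · exact h1 k
    have := hX.H1_mul hNw
    refine this.congr (.of_forall fun x => ?_)
    dsimp only
    by_cases hx : X x = 0
    · simp [hx]
    · simp [w, hm x hx]
  -- round 2
  have r2 : ∀ X, CC X → ∀ l, MemLp (fun ξ => ‖ξ‖ ^ 3 * ‖𝓕 (fun x => X x * u l x) ξ‖) 2 := by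
    intro X hX l
    have m1 : ∀ j, MemLp (fun ξ => ‖ξ‖ ^ 2 * ‖𝓕 (G X l j) ξ‖) 2 := fun j => by
      have eF : ∀ ξ, 𝓕 (G X l j) ξ = (∑ k, 𝓕 (fun x => (X x * a l j k x) * u k x) ξ) + (-2) * 𝓕 (fun x => pd X j x * u l x) ξ := by
        intro ξ
        simp only [fourier_EE, Geq]
        have q1 : ∀ k, Integrable (fun x => EE ξ x * ((X x * a l j k x) * u k x)) := fun k => by
          simpa [mul_assoc] using (((hX.smul' (ha l j k)).smul (EE_smooth ξ)).int_mul (lu k))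
        have q2 : Integrable (fun x => EE ξ x * (pd X j x * u l x)) := by
          simpa [mul_assoc] using (((hX.pd j).smul (EE_smooth ξ)).int_mul (lu l))
        rw [← integral_const_mul, ← integral_finsetSum _ (fun k _ => q1 k), 
          ← integral_add (integrable_finsetSum _ fun k _ => q1 k) (q2.const_mul _)]
        congr 1; ext x; rw [← Finset.mul_sum]; ring
      have m2 := (memLp_finsetSum Finset.univ fun k _ => r1 _ (hX.smul' (ha l j k)) k).add 
        ((r1 _ (hX.pd j) l).const_mul 2)
      have hc := fourier_cont (iG X hX l j)
      refine m2.of_le (Continuous.aestronglyMeasurable (by fun_prop)) (.of_forall fun ξ => ?_)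
      simp only [Pi.add_apply]
      rw [Real.norm_of_nonneg (by positivity), Real.norm_of_nonneg (by positivity), eF, ← Finset.mul_sum]
      calc _ ≤ ‖ξ‖ ^ 2 * (∑ k, ‖𝓕 (fun x => (X x * a l j k x) * u k x) ξ‖ + 2 * ‖𝓕 (fun x => pd X j x * u l x) ξ‖) := by
            gcongr
            refine (norm_add_le _ _).trans ?_
            gcongr
            · exact norm_sum_le _ _
            · simp
        _ = _ := by ring
    have hg1 : H1 (g X l) := by
      rw [geq]
      exact (hg0 X hX l).add (hNX X hX l)
    obtain ⟨K, hK⟩ := hg1.2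
    have m3 := TL_fourier hK (ig X hX l) hg1.1
    have m2 := (memLp_finsetSum Finset.univ fun j _ => m1 j).add m3
    have hc := fourier_cont (hUi X hX l)
    refine m2.of_le (Continuous.aestronglyMeasurable (by fun_prop)) (.of_forall fun ξ => ?_)
    simp only [Pi.add_apply]
    rw [Real.norm_of_nonneg (by positivity), Real.norm_of_nonneg (by positivity)]
    have := mul_le_mul_of_nonneg_left (eq_bound (heq X hX l ξ)) (norm_nonneg ξ)
    calc _ = ‖ξ‖ * (‖ξ‖ ^ 2 * ‖𝓕 (fun x => X x * u l x) ξ‖) := by ring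
      _ ≤ _ := this
      _ = _ := by simp only [Fin.sum_univ_three]; ring
  -- gluing
  intro l
  have hloc : ∀ m : ℕ, ∃ v : Pt 3 → ℂ, ContDiff ℝ 1 v ∧ (fun x => (chi m x : ℂ) * u l x) =ᵐ[volume] v := fun m =>
    hat_C1 (hUi _ (hchi m) l) (hU1 _ (hchi m) l).1 (r1 _ (hchi m) l) (r2 _ (hchi m) l)
  choose v hv1 hv2 using hloc
  have hball : ∀ m : ℕ, u l =ᵐ[volume.restrict (Metric.ball (0 : Pt 3) (m+1))] v m := by
    intro m
    rw [Filter.EventuallyEq, ae_restrict_iff' measurableSet_ball]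
    filter_upwards [hv2 m] with x hx hxm
    rw [← hx, chi_one (by simpa using (Metric.mem_ball.1 hxm).le)]
    simp
  have hagree : ∀ m m' : ℕ, m ≤ m' → ∀ x ∈ Metric.ball (0 : Pt 3) (m+1), v m x = v m' x := by
    intro m m' hmm
    have h1 := hball m
    have h2 : u l =ᵐ[volume.restrict (Metric.ball (0 : Pt 3) (m+1))] v m' :=
      ae_restrict_of_ae_restrict_of_subset (Metric.ball_subset_ball (by have : (m:ℝ) ≤ m' := by exact_mod_cast hmm
                                                                        linarith)) (hball m')
    exact Measure.eqOn_open_of_ae_eq (h1.symm.trans h2) Metric.isOpen_ball (hv1 m).continuous.continuousOn (hv1 m').continuous.continuousOn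
  let V : Pt 3 → ℂ := fun x => v ⌈‖x‖⌉₊ x
  have hV : ∀ m : ℕ, ∀ x ∈ Metric.ball (0 : Pt 3) (m+1), V x = v m x := by
    intro m x hx
    have hx1 : x ∈ Metric.ball (0 : Pt 3) (⌈‖x‖⌉₊+1) := by
      simp
      have := Nat.le_ceil ‖x‖
      linarith
    rcases le_total m ⌈‖x‖⌉₊ with h | h
    · exact (hagree _ _ h x hx).symm
    · exact hagree _ _ h x hx1
  refine ⟨V, ?_, ?_⟩
  · rw [contDiff_iff_contDiffAt]
    intro x
    have hx1 : x ∈ Metric.ball (0 : Pt 3) (⌈‖x‖⌉₊+1) := by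
      simp
      have := Nat.le_ceil ‖x‖
      linarith
    refine ((hv1 ⌈‖x‖⌉₊).contDiffAt).congr_of_eventuallyEq ?_
    filter_upwards [Metric.isOpen_ball.mem_nhds hx1] with y hy
    exact hV _ y hy
  · have : ∀ᵐ x, ∀ m : ℕ, x ∈ Metric.ball (0 : Pt 3) (m+1) → u l x = v m x := by
      rw [ae_all_iff]
      intro m
      have := hball m
      rwa [Filter.EventuallyEq, ae_restrict_iff' measurableSet_ball] at this
    filter_upwards [this] with x hx
    apply hx
    simp
    have := Nat.le_ceil ‖x‖
    linarith

end system

end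

section
open scoped ENNReal NNReal Topology FourierTransform ContDiff SchwartzMap Convolution
open Filter

abbrev Tri := Fin 3 → Pt 3 → ℂ

def rotv (x : Pt 3) : Fin 3 → ℂ := ![-(x 1 : ℂ), (x 0 : ℂ), 0]
def Smat : Fin 3 → Fin 3 → Fin 3 → ℂ :=
  ![![![0, 0, 0], ![I, 1, 0], ![0, 0, 0]], ![![I, -1, 0], ![0, 0, 0], ![I, 1, 0]], ![![0, 0, 0], ![I, -1, 0], ![0, 0, 0]]]
def Ac (Ω γ : ℝ) (k l j : Fin 3) (x : Pt 3) : ℂ := (if k = l then (Ω:ℂ) * I * rotv x j else 0) - γ * Smat k l j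

def pot (g : Fin 3 → ℝ) (C : ℝ) (x : Pt 3) : ℝ := ∑ i, g i * (x i) ^ 2 + C

/-- sesquilinear density on jets -/
def bc (Ω γ v : ℝ) (x : Pt 3) (p : Fin 3 → ℂ) (D : Fin 3 → Fin 3 → ℂ) (p' : Fin 3 → ℂ) (D' : Fin 3 → Fin 3 → ℂ) : ℂ :=
  (1/2) * (∑ k, ∑ j, (starRingEnd ℂ) (D k j) * D' k j) + v * (∑ k, (starRingEnd ℂ) (p k) * p' k)
   + ∑ k, ∑ l, ∑ j, (starRingEnd ℂ) (p k) * Ac Ω γ k l j x * D' l j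

def be (Ω γ : ℝ) (v : Pt 3 → ℝ) (Φ Ψ : Tri) (x : Pt 3) : ℝ :=
  (bc Ω γ (v x) x (fun k => Φ k x) (fun k j => pd (Φ k) j x) (fun k => Ψ k x) (fun k j => pd (Ψ k) j x)).re

structure Good (Φ : Tri) : Prop where
  diff : ∀ k, Differentiable ℝ (Φ k)
  m2 : ∀ k, MemLp (Φ k) 2
  m4 : ∀ k, MemLp (Φ k) 4
  d2 : ∀ k j, MemLp (pd (Φ k) j) 2
  x2 : ∀ k i, MemLp (fun x => (x i : ℂ) * Φ k x) 2

lemma int_conj {f g : Pt 3 → ℂ} (hf : MemLp f 2) (hg : MemLp g 2) : Integrable (fun x => (starRingEnd ℂ) (f x) * g x) :=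
  hf.star.integrable_mul hg

lemma pd_eq (f : Pt 3 → ℂ) (j : Fin 3) (x) : pdC 3 f j x = pd f j x := by
  simp [pdC, pd, ee]

lemma pd_smul {g : Pt 3 → ℂ} {x : Pt 3} (hg : DifferentiableAt ℝ g x) (t : ℝ) (j) :
    pd (fun x => (t:ℂ) * g x) j x = t * pd g j x := pd_const_mul hg _ j

lemma Good.add {Φ Ψ : Tri} (h : Good Φ) (h' : Good Ψ) : Good (fun k x => Φ k x + Ψ k x) where
  diff k := (h.diff k).add (h'.diff k)
  m2 k := (h.m2 k).add (h'.m2 k)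
  m4 k := (h.m4 k).add (h'.m4 k)
  d2 k j := by
    refine (memLp_congr_ae (.of_forall fun x => ?_)).1 ((h.d2 k j).add (h'.d2 k j))
    exact (pd_add (h.diff k x) (h'.diff k x) j).symm
  x2 k i := by
    refine (memLp_congr_ae (.of_forall fun x => ?_)).1 ((h.x2 k i).add (h'.x2 k i))
    simp [mul_add]

lemma Good.cmul {Φ : Tri} (h : Good Φ) (c : ℂ) : Good (fun k x => c * Φ k x) where
  diff k := (h.diff k).const_mul c
  m2 k := (h.m2 k).const_mul c
  m4 k := (h.m4 k).const_mul c
  d2 k j := by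
    refine (memLp_congr_ae (.of_forall fun x => ?_)).1 ((h.d2 k j).const_mul c)
    exact (pd_const_mul (h.diff k x) c j).symm
  x2 k i := by
    refine (memLp_congr_ae (.of_forall fun x => ?_)).1 ((h.x2 k i).const_mul c)
    dsimp only; ring

lemma CC.memLp {f : Pt 3 → ℂ} (h : CC f) (p : ℝ≥0∞) : MemLp f p := h.1.continuous.memLp_of_hasCompactSupport h.2

lemma coord_smooth (i : Fin 3) : ContDiff ℝ ∞ (fun x : Pt 3 => (x i : ℂ)) :=
  Complex.ofRealCLM.contDiff.comp (EuclideanSpace.proj (𝕜 := ℝ) i).contDiff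

lemma good_CC {η : Tri} (h : ∀ k, CC (η k)) : Good η where
  diff k := (h k).1.differentiable (by simp)
  m2 k := (h k).memLp _
  m4 k := (h k).memLp _
  d2 k j := ((h k).pd j).memLp _
  x2 k i := ((h k).smul (coord_smooth i)).memLp _

lemma Good.rot {Φ : Tri} (h : Good Φ) (k j) : MemLp (fun x => rotv x j * Φ k x) 2 := by
  fin_cases j
  · refine (memLp_congr_ae (.of_forall fun x => ?_)).1 ((h.x2 k 1).const_mul (-1))
    simp [rotv]
  · refine (memLp_congr_ae (.of_forall fun x => ?_)).1 (h.x2 k 0)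
    simp [rotv]
  · simp [rotv]

lemma Good.A2 {Φ : Tri} (h : Good Φ) (Ω γ : ℝ) (k l j) : MemLp (fun x => (starRingEnd ℂ) (Ac Ω γ k l j x) * Φ k x) 2 := by
  have h1 : MemLp (fun x => (starRingEnd ℂ) (Smat k l j) * Φ k x) 2 := (h.m2 k).const_mul _
  have h2 : MemLp (fun x => (starRingEnd ℂ) ((if k = l then (Ω:ℂ) * I * rotv x j else 0)) * Φ k x) 2 := by
    split_ifs
    · refine (memLp_congr_ae (.of_forall fun x => ?_)).1 ((h.rot k j).const_mul ((starRingEnd ℂ) ((Ω:ℂ) * I)))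
      have : (starRingEnd ℂ) (rotv x j) = rotv x j := by fin_cases j <;> simp [rotv]
      rw [map_mul, map_mul, map_mul, this]; ring
    · simp
  refine (memLp_congr_ae (.of_forall fun x => ?_)).1 (h2.sub (h1.const_mul (γ:ℂ)))
  simp only [Ac, Pi.sub_apply, map_sub, map_mul, conj_ofReal]; ring

lemma bc_int {Φ Ψ : Tri} (h : Good Φ) (h' : Good Ψ) (Ω γ : ℝ) (g : Fin 3 → ℝ) (C : ℝ) :
    Integrable (fun x => bc Ω γ (pot g C x) x (fun k => Φ k x) (fun k j => pd (Φ k) j x) (fun k => Ψ k x) (fun k j => pd (Ψ k) j x)) := by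
  unfold bc
  refine Integrable.add (Integrable.add ?_ ?_) ?_
  · exact (integrable_finsetSum _ fun k _ => integrable_finsetSum _ fun j _ => int_conj (h.d2 k j) (h'.d2 k j)).const_mul _
  · have : Integrable (fun x => ∑ k, ((∑ i, (g i : ℂ) * ((starRingEnd ℂ) ((x i : ℂ) * Φ k x) * ((x i : ℂ) * Ψ k x))) + C * ((starRingEnd ℂ) (Φ k x) * Ψ k x))) :=
      integrable_finsetSum _ fun k _ => (integrable_finsetSum _ fun i _ => (int_conj (h.x2 k i) (h'.x2 k i)).const_mul _).add
        ((int_conj (h.m2 k) (h'.m2 k)).const_mul _)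
    refine this.congr (.of_forall fun x => ?_)
    simp only [pot, Fin.sum_univ_three, map_mul, conj_ofReal]
    push_cast; ring
  · refine integrable_finsetSum _ fun k _ => integrable_finsetSum _ fun l _ => integrable_finsetSum _ fun j _ => ?_
    refine (int_conj (h.A2 Ω γ k l j) (h'.d2 l j)).congr (.of_forall fun x => ?_)
    simp only [map_mul, conj_conj]; ring

lemma be_int {Φ Ψ : Tri} (h : Good Φ) (h' : Good Ψ) (Ω γ : ℝ) (g : Fin 3 → ℝ) (C : ℝ) :
    Integrable (be Ω γ (pot g C) Φ Ψ) := (bc_int h h' Ω γ g C).re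

lemma be_expand {Φ Ψ : Tri} (h : Good Φ) (h' : Good Ψ) (Ω γ : ℝ) (v : Pt 3 → ℝ) (t : ℝ) (x : Pt 3) :
    be Ω γ v (fun k x => Φ k x + (t:ℂ) * Ψ k x) (fun k x => Φ k x + (t:ℂ) * Ψ k x) x =
      be Ω γ v Φ Φ x + t * (be Ω γ v Φ Ψ x + be Ω γ v Ψ Φ x) + t ^ 2 * be Ω γ v Ψ Ψ x := by
  have e : ∀ k j, pd (fun x => Φ k x + (t:ℂ) * Ψ k x) j x = pd (Φ k) j x + t * pd (Ψ k) j x := by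
    intro k j
    rw [pd_add (h.diff k x) ((h'.diff k x).const_mul _), pd_smul (h'.diff k x)]
  have key : bc Ω γ (v x) x (fun k => Φ k x + (t:ℂ) * Ψ k x) (fun k j => pd (Φ k) j x + t * pd (Ψ k) j x) 
      (fun k => Φ k x + (t:ℂ) * Ψ k x) (fun k j => pd (Φ k) j x + t * pd (Ψ k) j x) =
    bc Ω γ (v x) x (fun k => Φ k x) (fun k j => pd (Φ k) j x) (fun k => Φ k x) (fun k j => pd (Φ k) j x) +
    (t:ℂ) * (bc Ω γ (v x) x (fun k => Φ k x) (fun k j => pd (Φ k) j x) (fun k => Ψ k x) (fun k j => pd (Ψ k) j x) +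
    bc Ω γ (v x) x (fun k => Ψ k x) (fun k j => pd (Ψ k) j x) (fun k => Φ k x) (fun k j => pd (Φ k) j x)) + 
    ((t ^ 2 : ℝ) : ℂ) * bc Ω γ (v x) x (fun k => Ψ k x) (fun k j => pd (Ψ k) j x) (fun k => Ψ k x) (fun k j => pd (Ψ k) j x) := by
    simp only [bc, map_add, map_mul, conj_ofReal, Finset.mul_sum, ← Finset.sum_add_distrib]
    simp only [Fin.sum_univ_three]
    push_cast
    ring
  unfold be
  simp only [e, key, add_re, re_ofReal_mul]

lemma be_smul {Φ : Tri} (h : Good Φ) (Ω γ : ℝ) (v : Pt 3 → ℝ) (t : ℝ) (x : Pt 3) :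
    be Ω γ v (fun k x => (t:ℂ) * Φ k x) (fun k x => (t:ℂ) * Φ k x) x = t ^ 2 * be Ω γ v Φ Φ x := by
  have e : ∀ k j, pd (fun x => (t:ℂ) * Φ k x) j x = t * pd (Φ k) j x := fun k j => pd_smul (h.diff k x) t j
  unfold be
  rw [← re_ofReal_mul]
  congr 1
  simp only [e, bc, map_mul, conj_ofReal, Finset.mul_sum, mul_add]
  push_cast
  congr 1; congr 1
  · exact Finset.sum_congr rfl fun k _ => Finset.sum_congr rfl fun j _ => by ring
  · exact Finset.sum_congr rfl fun k _ => by ring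
  · exact Finset.sum_congr rfl fun k _ => Finset.sum_congr rfl fun j _ => Finset.sum_congr rfl fun l _ => by ring

end

section
open scoped ENNReal NNReal Topology FourierTransform ContDiff SchwartzMap Convolution
open Filter

def Fs (p : Fin 3 → ℂ) : ℝ :=
  2 * ((((starRingEnd ℂ) (p 0) + (starRingEnd ℂ) (p 2)) * p 1).re) ^ 2
    + 2 * ((p 1 * ((starRingEnd ℂ) (p 2) - (starRingEnd ℂ) (p 0))).im) ^ 2
    + (‖p 0‖ ^ 2 - ‖p 2‖ ^ 2) ^ 2

def rh (p : Fin 3 → ℂ) : ℝ := ∑ k, ‖p k‖ ^ 2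
def wd (c0 c1 : ℝ) (p : Fin 3 → ℂ) : ℝ := c0 / 2 * (rh p) ^ 2 + c1 / 2 * Fs p
def mass (Φ : Tri) : ℝ := ∫ x, rh (fun k => Φ k x)

lemma rh_nonneg (p) : 0 ≤ rh p := Finset.sum_nonneg fun _ _ => sq_nonneg _
lemma le_rh (p : Fin 3 → ℂ) (k) : ‖p k‖ ^ 2 ≤ rh p :=
  Finset.single_le_sum (f := fun k => ‖p k‖ ^ 2) (fun _ _ => sq_nonneg _) (Finset.mem_univ k)

lemma Fs_nonneg (p) : 0 ≤ Fs p := by unfold Fs; positivity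

lemma nsq (z : ℂ) : ‖z‖ ^ 2 = z.re ^ 2 + z.im ^ 2 := by
  rw [← Complex.normSq_eq_norm_sq, Complex.normSq_apply]; ring

lemma Fs_le (p) : Fs p ≤ rh p ^ 2 := by
  have : rh p ^ 2 - Fs p = ‖p 1 ^ 2 - 2 * p 0 * p 2‖ ^ 2 := by
    simp only [rh, Fs, Fin.sum_univ_three, nsq]
    simp only [pow_two, sub_re, sub_im, mul_re, mul_im, add_re, add_im, conj_re, conj_im, re_ofNat, im_ofNat]
    ring
  have := sq_nonneg ‖p 1 ^ 2 - 2 * p 0 * p 2‖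
  linarith

lemma wd_nonneg {c0 c1 : ℝ} (hc : (0 ≤ c0 ∧ 0 ≤ c1) ∨ (c1 ≤ 0 ∧ 0 ≤ c0 + c1)) (p) : 0 ≤ wd c0 c1 p := by
  have h1 := Fs_nonneg p
  have h2 := Fs_le p
  unfold wd
  rcases hc with ⟨h, h'⟩ | ⟨h, h'⟩
  · positivity
  · nlinarith [mul_nonneg h' (sq_nonneg (rh p)), mul_nonneg (neg_nonneg.2 h) (sub_nonneg.2 h2)]

lemma wd_smul (c0 c1 t : ℝ) (p : Fin 3 → ℂ) : wd c0 c1 (fun k => (t:ℂ) * p k) = t ^ 4 * wd c0 c1 p := by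
  simp only [wd, rh, Fs, Fin.sum_univ_three, nsq]
  simp only [sub_re, sub_im, mul_re, mul_im, add_re, add_im, conj_re, conj_im, ofReal_re, ofReal_im]
  ring
lemma rh_smul (t : ℝ) (p : Fin 3 → ℂ) : rh (fun k => (t:ℂ) * p k) = t ^ 2 * rh p := by
  simp only [rh, Fin.sum_univ_three, nsq]
  simp only [mul_re, mul_im, ofReal_re, ofReal_im]
  ring

lemma rho_eq (Φ : Tri) (x) : rho 3 (Φ 0) (Φ 1) (Φ 2) x = rh (fun k => Φ k x) := by
  simp [rho, rh, Fin.sum_univ_three]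
lemma Fsq_eq (Φ : Tri) (x) : Fsq 3 (Φ 0) (Φ 1) (Φ 2) x = Fs (fun k => Φ k x) := rfl

lemma be_eq (Ω γ : ℝ) (v : Pt 3 → ℝ) (Φ : Tri) (x : Pt 3) :
    be Ω γ v Φ Φ x = 1/2 * (gradsq 3 (Φ 0) x + gradsq 3 (Φ 1) x + gradsq 3 (Φ 2) x)
      + v x * rho 3 (Φ 0) (Φ 1) (Φ 2) x - Ω * (rotDen 3 (Φ 0) x + rotDen 3 (Φ 1) x + rotDen 3 (Φ 2) x)
      - γ * socDen 3 (Φ 0) (Φ 1) (Φ 2) x := by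
  have e0 : ∀ f : Pt 3 → ℂ, pdC 3 f 0 x = pd f 0 x := fun f => pd_eq f 0 x
  have e1 : ∀ f : Pt 3 → ℂ, pdC 3 f 1 x = pd f 1 x := fun f => pd_eq f 1 x
  have e2 : ∀ f : Pt 3 → ℂ, pdC 3 f 2 x = pd f 2 x := fun f => pd_eq f 2 x
  have n0 : nthC 3 x 0 = x 0 := by simp [nthC]
  have n1 : nthC 3 x 1 = x 1 := by simp [nthC]
  simp only [be, bc, gradsq, rho, rotDen, socDen, Lzop, L0op, L1op, e0, e1, e2, pd_eq, n0, n1, Fin.sum_univ_three, nsq]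
  generalize Φ 0 x = p0
  generalize Φ 1 x = p1
  generalize Φ 2 x = p2
  generalize pd (Φ 0) 0 x = d00
  generalize pd (Φ 0) 1 x = d01
  generalize pd (Φ 0) 2 x = d02
  generalize pd (Φ 1) 0 x = d10
  generalize pd (Φ 1) 1 x = d11
  generalize pd (Φ 1) 2 x = d12
  generalize pd (Φ 2) 0 x = d20
  generalize pd (Φ 2) 1 x = d21
  generalize pd (Φ 2) 2 x = d22
  simp [Ac, rotv, Smat]
  ring

lemma rh_int {Φ : Tri} (h : ∀ k, MemLp (Φ k) 2) : Integrable (fun x => rh (fun k => Φ k x)) :=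
  integrable_finsetSum _ fun k _ => (memLp_two_iff_integrable_sq_norm (h k).1).1 (h k)

lemma sq_mem2 {f : Pt 3 → ℂ} (h : MemLp f 4) : MemLp (fun x => ‖f x‖ ^ 2) 2 := by
  have h0 : AEStronglyMeasurable (fun x => ‖f x‖ ^ 2) volume := h.1.norm.pow 2
  rw [memLp_two_iff_integrable_sq h0]
  have := (integrable_norm_rpow_iff h.1 (by norm_num) (by norm_num)).2 h
  refine this.congr (.of_forall fun x => ?_)
  simp only [ENNReal.toReal_ofNat]
  rw [← pow_mul]; norm_cast

lemma mem4_of {f : Pt 3 → ℂ} (h0 : AEStronglyMeasurable f volume) (h : Integrable (fun x => ‖f x‖ ^ 4)) : MemLp f 4 := by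
  refine (integrable_norm_rpow_iff h0 (by norm_num) (by norm_num)).1 (h.congr (.of_forall fun x => ?_))
  simp only [ENNReal.toReal_ofNat]; norm_cast

lemma rh2_int {Φ : Tri} (h : ∀ k, MemLp (Φ k) 4) : Integrable (fun x => rh (fun k => Φ k x) ^ 2) := by
  have : MemLp (fun x => rh (fun k => Φ k x)) 2 := memLp_finsetSum _ fun k _ => sq_mem2 (h k)
  exact (memLp_two_iff_integrable_sq this.1).1 this

lemma Fs_cont : Continuous Fs := by
  unfold Fs
  have : ∀ k, Continuous (fun p : Fin 3 → ℂ => p k) := fun k => continuous_apply k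
  fun_prop

lemma rh_cont : Continuous rh := by unfold rh; fun_prop
lemma wd_cont (c0 c1) : Continuous (wd c0 c1) := by
  unfold wd; have := Fs_cont; have := rh_cont; fun_prop

lemma Fs_int {Φ : Tri} (h : ∀ k, MemLp (Φ k) 4) : Integrable (fun x => Fs (fun k => Φ k x)) := by
  refine (rh2_int h).mono' (Fs_cont.comp_aestronglyMeasurable (aemeasurable_pi_lambda _ fun k => (h k).1.aemeasurable).aestronglyMeasurable) (.of_forall fun x => ?_)
  rw [Real.norm_of_nonneg (Fs_nonneg _)]
  exact Fs_le _

lemma wd_int {Φ : Tri} (h : ∀ k, MemLp (Φ k) 4) (c0 c1 : ℝ) : Integrable (fun x => wd c0 c1 (fun k => Φ k x)) :=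
  ((rh2_int h).const_mul _).add ((Fs_int h).const_mul _)

def gam (a b c : ℝ) : Fin 3 → ℝ := ![a^2/2, b^2/2, c^2/2]

lemma pot_eq {γx γy γz : ℝ} {V : Pt 3 → ℝ} (hV : ∀ x, V x = 1/2*(γx^2*(x 0)^2+γy^2*(x 1)^2+γz^2*(x 2)^2)) :
    V = pot (gam γx γy γz) 0 := by
  ext x; rw [hV]; simp [pot, gam, Fin.sum_univ_three]; ring

lemma InM_good {a b c : ℝ} (ha : 0 < a) (hb : 0 < b) (hc : 0 < c) {Φ : Tri}
   (h : InM 3 (pot (gam a b c) 0) (Φ 0) (Φ 1) (Φ 2)) : Good Φ ∧ mass Φ = 1 := by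
  obtain ⟨d0, d1, d2, h1, h2, h3, h4, h5, h6, h7, h8⟩ := h
  have hd : ∀ k, Differentiable ℝ (Φ k) := by intro k; fin_cases k <;> assumption
  have hm : ∀ k, AEStronglyMeasurable (Φ k) volume := fun k => (hd k).continuous.aestronglyMeasurable
  simp only [rho_eq] at *
  refine ⟨⟨hd, fun k => ?_, fun k => ?_, fun k j => ?_, fun k i => ?_⟩, h8⟩
  · rw [memLp_two_iff_integrable_sq_norm (hm k)]
    refine h1.mono' ((hm k).norm.pow 2) (.of_forall fun x => ?_)
    rw [Real.norm_of_nonneg (sq_nonneg _)]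
    exact le_rh (fun k => Φ k x) k
  · refine mem4_of (hm k) (h4.mono' ((hm k).norm.pow 4) (.of_forall fun x => ?_))
    rw [Real.norm_of_nonneg (by positivity), show ‖Φ k x‖ ^ 4 = (‖Φ k x‖ ^ 2) ^ 2 by ring]
    exact pow_le_pow_left₀ (sq_nonneg _) (le_rh (fun k => Φ k x) k) 2
  · have hmp : AEStronglyMeasurable (pd (Φ k) j) volume := (measurable_fderiv_apply_const ℝ (Φ k) (ee j)).aestronglyMeasurable
    rw [memLp_two_iff_integrable_sq_norm hmp]
    refine h2.mono' (hmp.norm.pow 2) (.of_forall fun x => ?_)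
    rw [Real.norm_of_nonneg (sq_nonneg _)]
    have : ∀ k, ‖pd (Φ k) j x‖ ^ 2 ≤ gradsq 3 (Φ k) x := fun k => by
      unfold gradsq; simp only [pd_eq]
      exact Finset.single_le_sum (f := fun j => ‖pd (Φ k) j x‖ ^ 2) (fun _ _ => sq_nonneg _) (Finset.mem_univ j)
    have h0 : ∀ k, 0 ≤ gradsq 3 (Φ k) x := fun k => (sq_nonneg _).trans (this k)
    have := this k
    have := h0 0; have := h0 1; have := h0 2
    fin_cases k <;> simp only [Fin.zero_eta, Fin.mk_one, Fin.reduceFinMk] at * <;> linarith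
  · have hmp : AEStronglyMeasurable (fun x : Pt 3 => (x i : ℂ) * Φ k x) volume :=
      ((coord_smooth i).continuous.mul (hd k).continuous).aestronglyMeasurable
    rw [memLp_two_iff_integrable_sq_norm hmp]
    have hg : ∀ i, 0 < gam a b c i := by intro i; fin_cases i <;> simp [gam] <;> positivity
    refine (h3.const_mul (gam a b c i)⁻¹).mono' (hmp.norm.pow 2) (.of_forall fun x => ?_)
    rw [Real.norm_of_nonneg (sq_nonneg _), norm_mul, mul_pow, Complex.norm_real, Real.norm_eq_abs, sq_abs]
    have e : gam a b c i * (x i) ^ 2 ≤ pot (gam a b c) 0 x := by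
      unfold pot; rw [add_zero]
      exact Finset.single_le_sum (f := fun i => gam a b c i * (x i) ^ 2) (fun i _ => mul_nonneg (hg i).le (sq_nonneg _)) (Finset.mem_univ i)
    have e' : (x i) ^ 2 ≤ (gam a b c i)⁻¹ * pot (gam a b c) 0 x := by
      rw [inv_mul_eq_div, le_div_iff₀ (hg i)]; linarith
    rw [← mul_assoc]
    exact mul_le_mul e' (le_rh (fun k => Φ k x) k) (sq_nonneg _) ((sq_nonneg _).trans e')

lemma good_InM (g : Fin 3 → ℝ) {Φ : Tri} (h : Good Φ) (hm : mass Φ = 1) :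
    InM 3 (pot g 0) (Φ 0) (Φ 1) (Φ 2) := by
  have z : ∀ x, pot 0 0 x = 0 := by intro x; simp [pot]
  have A := be_int h h 0 0 0 0
  have B := be_int h h 0 0 g 0
  have C := be_int h h (-1) 0 0 0
  have D := be_int h h 0 (-1) 0 0
  refine ⟨h.diff 0, h.diff 1, h.diff 2, ?_, ?_, ?_, ?_, ?_, ?_, ?_, ?_⟩
  · simpa only [rho_eq] using rh_int h.m2
  · refine (A.const_mul 2).congr (.of_forall fun x => ?_)
    dsimp only; rw [be_eq, z]; ring
  · refine (B.sub A).congr (.of_forall fun x => ?_)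
    simp only [Pi.sub_apply]; rw [be_eq, be_eq, z]; ring
  · simpa only [rho_eq] using rh2_int h.m4
  · exact Fs_int h.m4
  · refine (C.sub A).congr (.of_forall fun x => ?_)
    simp only [Pi.sub_apply]; rw [be_eq, be_eq, z]; ring
  · refine (D.sub A).congr (.of_forall fun x => ?_)
    simp only [Pi.sub_apply]; rw [be_eq, be_eq, z]; ring
  · simp only [rho_eq]; exact hm

def QQ (Ω γ : ℝ) (g : Fin 3 → ℝ) (C : ℝ) (Φ : Tri) : ℝ := ∫ x, be Ω γ (pot g C) Φ Φ x
def WW (c0 c1 : ℝ) (Φ : Tri) : ℝ := ∫ x, wd c0 c1 (fun k => Φ k x)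

lemma Etot_eq (c0 c1 Ω γ : ℝ) (g : Fin 3 → ℝ) {Φ : Tri} (h : Good Φ) (hm : mass Φ = 1) :
    Etot 3 (pot g 0) c0 c1 Ω γ (Φ 0) (Φ 1) (Φ 2) = QQ Ω γ g 0 Φ + WW c0 c1 Φ := by
  obtain ⟨d0, d1, d2, h1, h2, h3, h4, h5, h6, h7, h8⟩ := good_InM g h hm
  unfold Etot Ekin Epot Espin Erot Esoc QQ WW
  simp only [be_eq]
  rw [integral_sub, integral_sub, integral_add (f := fun x => 1/2 * (gradsq 3 (Φ 0) x + gradsq 3 (Φ 1) x + gradsq 3 (Φ 2) x)), integral_const_mul, integral_const_mul, integral_const_mul]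
  · simp only [wd, rho_eq, Fsq_eq]; ring
  · exact h2.const_mul _
  · exact h3
  · exact (h2.const_mul _).add h3
  · exact h6.const_mul _
  · exact ((h2.const_mul _).add h3).sub (h6.const_mul _)
  · exact h7.const_mul _

lemma QQ_const (Ω γ : ℝ) (g : Fin 3 → ℝ) (C : ℝ) {Φ : Tri} (h : Good Φ) : QQ Ω γ g C Φ = QQ Ω γ g 0 Φ + C * mass Φ := by
  unfold QQ mass
  rw [← integral_const_mul, ← integral_add (be_int h h Ω γ g 0) ((rh_int h.m2).const_mul _)]
  congr 1; ext x
  simp only [be_eq, rho_eq, pot]; ring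

lemma QQ_smul (Ω γ : ℝ) (g : Fin 3 → ℝ) (C : ℝ) {Φ : Tri} (h : Good Φ) (t : ℝ) :
    QQ Ω γ g C (fun k x => (t:ℂ) * Φ k x) = t ^ 2 * QQ Ω γ g C Φ := by
  unfold QQ; rw [← integral_const_mul]; congr 1; ext x; exact be_smul h _ _ _ _ _
lemma WW_smul (c0 c1 : ℝ) (Φ : Tri) (t : ℝ) :
    WW c0 c1 (fun k x => (t:ℂ) * Φ k x) = t ^ 4 * WW c0 c1 Φ := by
  unfold WW; rw [← integral_const_mul]; congr 1; ext x; exact wd_smul _ _ _ _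
lemma mass_smul (Φ : Tri) (t : ℝ) :
    mass (fun k x => (t:ℂ) * Φ k x) = t ^ 2 * mass Φ := by
  unfold mass; rw [← integral_const_mul]; congr 1; ext x; exact rh_smul _ _
lemma mass_nonneg (Φ : Tri) : 0 ≤ mass Φ := integral_nonneg fun _ => rh_nonneg _
lemma WW_nonneg {c0 c1 : ℝ} (hc : (0 ≤ c0 ∧ 0 ≤ c1) ∨ (c1 ≤ 0 ∧ 0 ≤ c0 + c1)) (Φ : Tri) : 0 ≤ WW c0 c1 Φ :=
  integral_nonneg fun _ => wd_nonneg hc _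

/-- scaled lower bound -/
lemma scaled {c0 c1 Ω γ m : ℝ} {g : Fin 3 → ℝ} (hc : (0 ≤ c0 ∧ 0 ≤ c1) ∨ (c1 ≤ 0 ∧ 0 ≤ c0 + c1))
    (hm : ∀ Φ, Good Φ → mass Φ = 1 → m ≤ QQ Ω γ g 0 Φ + WW c0 c1 Φ) {Ψ : Tri} (h : Good Ψ) :
    0 ≤ mass Ψ * QQ Ω γ g 0 Ψ + WW c0 c1 Ψ - m * mass Ψ ^ 2 := by
  rcases (mass_nonneg Ψ).eq_or_lt with h0 | h0
  · rw [← h0]; have := WW_nonneg hc Ψ; simpa using this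
  set N := mass Ψ
  set t := (Real.sqrt N)⁻¹
  have ht : t ^ 2 = N⁻¹ := by simp only [t]; rw [inv_pow, Real.sq_sqrt h0.le]
  have := hm _ (h.cmul (t:ℂ)) (by rw [mass_smul, ht]; exact inv_mul_cancel₀ h0.ne')
  rw [QQ_smul _ _ _ _ h, WW_smul, show t ^ 4 = (t^2)^2 by ring, ht] at this
  have h2 := mul_le_mul_of_nonneg_left this (sq_nonneg N)
  have : N ^ 2 * (N⁻¹ * QQ Ω γ g 0 Ψ + N⁻¹ ^ 2 * WW c0 c1 Ψ) = N * QQ Ω γ g 0 Ψ + WW c0 c1 Ψ := by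
    field_simp
  linarith

end

section
open scoped ENNReal NNReal Topology FourierTransform ContDiff SchwartzMap Convolution
open Filter

def rr (x : Pt 3) : Fin 3 → ℝ := ![x 1, x 0, 0]

lemma Ac_norm (Ω γ : ℝ) (k l j : Fin 3) (x : Pt 3) : ‖Ac Ω γ k l j x‖ ≤ (if k = l then |Ω| * |rr x j| else 0) + |γ| := by
  have h1 : ‖Smat k l j‖ ≤ 1 := by
    fin_cases k <;> fin_cases l <;> fin_cases j <;> simp [Smat]
  have h2 : ‖rotv x j‖ = |rr x j| := by
    fin_cases j <;> simp [rotv, rr]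
  unfold Ac
  refine (norm_sub_le _ _).trans (add_le_add ?_ ?_)
  · split_ifs
    · rw [norm_mul, norm_mul, h2]; simp
    · simp
  · rw [norm_mul, Complex.norm_real, Real.norm_eq_abs]
    exact mul_le_of_le_one_right (abs_nonneg _) h1

lemma term_bd (Ω γ θ ε : ℝ) (hθ : 0 < θ) (hε : 0 < ε) (k l j : Fin 3) (x : Pt 3) (p d : ℂ) :
    -((if k = l then θ/2*‖d‖^2 + Ω^2/(2*θ)*(rr x j)^2*‖p‖^2 else 0) + (ε*‖d‖^2 + γ^2/(4*ε)*‖p‖^2)) ≤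
      ((starRingEnd ℂ) p * Ac Ω γ k l j x * d).re := by
  have h1 : -((starRingEnd ℂ) p * Ac Ω γ k l j x * d).re ≤ ‖p‖ * ((if k = l then |Ω| * |rr x j| else 0) + |γ|) * ‖d‖ := by
    refine (neg_le_abs _).trans ((Complex.abs_re_le_norm _).trans ?_)
    rw [norm_mul, norm_mul, RCLike.norm_conj]
    gcongr
    exact Ac_norm _ _ _ _ _ _
  have h2 : ‖p‖ * |γ| * ‖d‖ ≤ ε*‖d‖^2 + γ^2/(4*ε)*‖p‖^2 := by
    have : ε*‖d‖^2 + γ^2/(4*ε)*‖p‖^2 - ‖p‖ * |γ| * ‖d‖ = (2*ε*‖d‖ - |γ| * ‖p‖)^2/(4*ε) := by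
      field_simp; rw [← sq_abs γ]; ring
    have : 0 ≤ (2*ε*‖d‖ - |γ| * ‖p‖)^2/(4*ε) := by positivity
    linarith
  have h3 : ‖p‖ * (|Ω| * |rr x j|) * ‖d‖ ≤ θ/2*‖d‖^2 + Ω^2/(2*θ)*(rr x j)^2*‖p‖^2 := by
    have : θ/2*‖d‖^2 + Ω^2/(2*θ)*(rr x j)^2*‖p‖^2 - ‖p‖ * (|Ω| * |rr x j|) * ‖d‖ = (θ*‖d‖ - |Ω| * |rr x j| * ‖p‖)^2/(2*θ) := by
      field_simp; rw [← sq_abs Ω, ← sq_abs (rr x j)]; ring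
    have : 0 ≤ (θ*‖d‖ - |Ω| * |rr x j| * ‖p‖)^2/(2*θ) := by positivity
    linarith
  split_ifs at h1 ⊢ <;> linarith

lemma coer_pt {Ω γ θ ε c C : ℝ} {g : Fin 3 → ℝ} (hθ : 0 < θ) (hε : 0 < ε)
    (h1 : c ≤ 1/2 - θ/2 - 3*ε) (hg0 : c ≤ g 0 - Ω^2/(2*θ)) (hg1 : c ≤ g 1 - Ω^2/(2*θ)) (hg2 : c ≤ g 2)
    (hC : c + 9*(γ^2/(4*ε)) ≤ C) (x : Pt 3) (p : Fin 3 → ℂ) (D : Fin 3 → Fin 3 → ℂ) :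
    c * (∑ k, ∑ j, ‖D k j‖^2 + (∑ i, (x i)^2) * rh p + rh p) ≤ (bc Ω γ (pot g C x) x p D p D).re := by
  have key : ∑ k, ∑ l, ∑ j, -((if k = l then θ/2*‖D l j‖^2 + Ω^2/(2*θ)*(rr x j)^2*‖p k‖^2 else 0) + (ε*‖D l j‖^2 + γ^2/(4*ε)*‖p k‖^2))
    ≤ ∑ k, ∑ l, ∑ j, ((starRingEnd ℂ) (p k) * Ac Ω γ k l j x * D l j).re := 
    Finset.sum_le_sum fun k _ => Finset.sum_le_sum fun l _ => Finset.sum_le_sum fun j _ => term_bd Ω γ θ ε hθ hε k l j x (p k) (D l j)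
  have e1 : ∀ z : ℂ, (starRingEnd ℂ) z * z = ((‖z‖^2 : ℝ) : ℂ) := fun z => by rw [mul_comm, Complex.mul_conj, Complex.normSq_eq_norm_sq]
  have e2 : (bc Ω γ (pot g C x) x p D p D).re = 1/2 * (∑ k, ∑ j, ‖D k j‖^2) + pot g C x * rh p
      + ∑ k, ∑ l, ∑ j, ((starRingEnd ℂ) (p k) * Ac Ω γ k l j x * D l j).re := by
    unfold bc rh
    simp only [e1]
    rw [show (1/2 : ℂ) = ((1/2 : ℝ) : ℂ) by push_cast; rfl]
    simp only [← ofReal_sum, ← ofReal_mul, add_re, ofReal_re, re_sum]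
  rw [e2]
  set S := ∑ k, ∑ j, ‖D k j‖^2 with hS
  have hS0 : 0 ≤ S := Finset.sum_nonneg fun _ _ => Finset.sum_nonneg fun _ _ => sq_nonneg _
  have e3 : ∑ k, ∑ l, ∑ j, -((if k = l then θ/2*‖D l j‖^2 + Ω^2/(2*θ)*(rr x j)^2*‖p k‖^2 else 0) + (ε*‖D l j‖^2 + γ^2/(4*ε)*‖p k‖^2))
     = -((θ/2+3*ε) * S + (Ω^2/(2*θ)*((x 0)^2+(x 1)^2) + 9*(γ^2/(4*ε))) * rh p) := by
    simp only [hS, rh, Fin.sum_univ_three]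
    simp [rr]
    ring
  rw [e3] at key
  have hr := rh_nonneg p
  have f1 := mul_nonneg (sub_nonneg.2 h1) hS0
  have f2 := mul_nonneg (mul_nonneg (sub_nonneg.2 hg0) (sq_nonneg (x 0))) hr
  have f3 := mul_nonneg (mul_nonneg (sub_nonneg.2 hg1) (sq_nonneg (x 1))) hr
  have f4 := mul_nonneg (mul_nonneg (sub_nonneg.2 hg2) (sq_nonneg (x 2))) hr
  have f5 := mul_nonneg (sub_nonneg.2 hC) hr
  have e4 : pot g C x = g 0 * (x 0)^2 + g 1 * (x 1)^2 + g 2 * (x 2)^2 + C := by simp only [pot, Fin.sum_univ_three]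
  rw [e4, Fin.sum_univ_three]
  clear_value S
  generalize (∑ k, ∑ l, ∑ j, ((starRingEnd ℂ) (p k) * Ac Ω γ k l j x * D l j).re) = T at *
  generalize Ω^2/(2*θ) = w at *
  generalize γ^2/(4*ε) = w' at *
  linarith

lemma coer {Ω γ a b e : ℝ} (ha : 0 < a) (hb : 0 < b) (he : 0 < e) (hΩ : |Ω| < min a b) :
    ∃ C c : ℝ, 0 < c ∧ ∀ (x : Pt 3) (p : Fin 3 → ℂ) (D : Fin 3 → Fin 3 → ℂ), 
      c * (∑ k, ∑ j, ‖D k j‖^2 + (∑ i, (x i)^2) * rh p + rh p) ≤ (bc Ω γ (pot (gam a b e) C x) x p D p D).re := by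
  set μ := min a b
  have hμ : 0 < μ := lt_min ha hb
  set r := |Ω| / μ
  have hr : r < 1 := (div_lt_one hμ).2 hΩ
  have hr0 : 0 ≤ r := by positivity
  have hO : Ω^2 = r^2 * μ^2 := by rw [← mul_pow, div_mul_cancel₀ _ hμ.ne', sq_abs]
  set θ := (1+r)/2 with hθ
  have hθ0 : 0 < θ := by positivity
  have hθ1 : θ < 1 := by rw [hθ]; linarith
  set ε := (1-θ)/12
  have hε : 0 < ε := by simp only [ε]; linarith
  have hlt : Ω^2/(2*θ) < μ^2/2 := by
    rw [div_lt_div_iff₀ (by positivity) (by positivity), hO]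
    have : r^2 < θ := by nlinarith
    have : 0 < (θ - r^2) * μ^2 := mul_pos (by linarith) (by positivity)
    nlinarith
  have hma : μ^2 ≤ a^2 := pow_le_pow_left₀ hμ.le (min_le_left _ _) 2
  have hmb : μ^2 ≤ b^2 := pow_le_pow_left₀ hμ.le (min_le_right _ _) 2
  set c := min ((1-θ)/4) (min (μ^2/2 - Ω^2/(2*θ)) (e^2/2))
  have c1 : c ≤ (1-θ)/4 := min_le_left _ _
  have c2 : c ≤ μ^2/2 - Ω^2/(2*θ) := (min_le_right _ _).trans (min_le_left _ _)
  have c3 : c ≤ e^2/2 := (min_le_right _ _).trans (min_le_right _ _)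
  refine ⟨c + 9*(γ^2/(4*ε)), c, lt_min (by linarith) (lt_min (by linarith) (by positivity)), fun x p D => ?_⟩
  refine coer_pt hθ0 hε ?_ ?_ ?_ ?_ le_rfl x p D
  · simp only [ε]; linarith
  · simp only [gam, Matrix.cons_val_zero]; linarith
  · simp [gam]; linarith
  · simp [gam]; linarith

lemma exists_unit : ∃ Φ : Tri, Good Φ ∧ mass Φ = 1 := by
  have hcc : CC (fun x => (chi 0 x : ℂ)) := ⟨Complex.ofRealCLM.contDiff.comp (chi_smooth 0), (chi_compact 0).comp_left (g := fun r : ℝ => (r:ℂ)) (by simp)⟩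
  set η : Tri := fun _ x => (chi 0 x : ℂ)
  have hg : Good η := good_CC fun _ => hcc
  have hp : 0 < mass η := by
    unfold mass
    refine Continuous.integral_pos_of_hasCompactSupport_nonneg_nonzero (f := fun x => rh (fun k => η k x)) (x := 0) ?_ ?_ (fun x => rh_nonneg _) ?_
    · exact rh_cont.comp (continuous_pi fun k => hcc.1.continuous)
    · refine (chi_compact 0).comp_left (g := fun r : ℝ => rh fun _ => (r:ℂ)) (by simp [rh])
    · have : chi 0 (0 : Pt 3) = 1 := chi_one (by simp)
      simp [rh, η, this]
  refine ⟨_, hg.cmul (((Real.sqrt (mass η))⁻¹ : ℝ) : ℂ), ?_⟩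
  rw [mass_smul, inv_pow, Real.sq_sqrt hp.le, inv_mul_cancel₀ hp.ne']

lemma eLp_of_int {F : Type*} [NormedAddCommGroup F] {f : Pt 3 → F} {G : Pt 3 → ℝ} {B : ℝ} (hG : Integrable G) (hB : ∫ x, G x ≤ B)
    (h : ∀ x, ‖f x‖^2 ≤ G x) : eLpNorm f 2 volume ≤ (Real.sqrt B).toNNReal := by
  rw [eLpNorm_two_le_iff]
  have h0 : 0 ≤ B := (integral_nonneg fun x => (sq_nonneg _).trans (h x)).trans hB
  have e : (((Real.sqrt B).toNNReal : ℝ≥0∞)) ^ 2 = ENNReal.ofReal B := by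
    rw [show (((Real.sqrt B).toNNReal : ℝ≥0∞)) = ENNReal.ofReal (Real.sqrt B) from rfl, ← ENNReal.ofReal_pow (Real.sqrt_nonneg _), Real.sq_sqrt h0]
  rw [e]
  calc ∫⁻ x, ‖f x‖ₑ ^ 2 ≤ ∫⁻ x, ENNReal.ofReal (G x) := by
        refine lintegral_mono fun x => ?_
        rw [← ofReal_norm, ← ENNReal.ofReal_pow (norm_nonneg _)]
        exact ENNReal.ofReal_le_ofReal (h x)
    _ = ENNReal.ofReal (∫ x, G x) := (ofReal_integral_eq_lintegral_ofReal hG (.of_forall fun x => (sq_nonneg _).trans (h x))).symm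
    _ ≤ _ := ENNReal.ofReal_le_ofReal hB

def JJ (Φ : Tri) (x : Pt 3) : ℝ := ∑ k, ∑ j, ‖pd (Φ k) j x‖^2 + (∑ i, (x i)^2) * rh (fun k => Φ k x) + rh (fun k => Φ k x)

lemma JJ_int {Φ : Tri} (h : Good Φ) : Integrable (JJ Φ) := by
  have := ((be_int h h 0 0 0 0).const_mul 2).add (((be_int h h 0 0 1 1).sub (be_int h h 0 0 0 0)))
  refine this.congr (.of_forall fun x => ?_)
  simp only [Pi.add_apply, Pi.sub_apply, be_eq, JJ, pot, rho_eq, gradsq, pd_eq, Fin.sum_univ_three, Pi.zero_apply, Pi.one_apply]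
  ring

lemma unif {Φ : Tri} (h : Good Φ) {B : ℝ} (hB : ∫ x, JJ Φ x ≤ B) (k) :
    eLpNorm (Φ k) 2 volume ≤ (3 * (Real.sqrt B).toNNReal : ℝ≥0) ∧ TL (Φ k) (3 * (Real.sqrt B).toNNReal) ∧
    eLpNorm (fun x => ‖x‖ * ‖Φ k x‖) 2 volume ≤ (3 * (Real.sqrt B).toNNReal : ℝ≥0) ∧
    ∀ j, eLpNorm (pd (Φ k) j) 2 volume ≤ (3 * (Real.sqrt B).toNNReal : ℝ≥0) := by
  have pos1 : ∀ x, 0 ≤ ∑ k, ∑ j, ‖pd (Φ k) j x‖^2 := fun x => Finset.sum_nonneg fun _ _ => Finset.sum_nonneg fun _ _ => sq_nonneg _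
  have pos2 : ∀ x : Pt 3, 0 ≤ ∑ i, (x i)^2 := fun x => Finset.sum_nonneg fun _ _ => sq_nonneg _
  have pos3 : ∀ x, 0 ≤ rh (fun k => Φ k x) := fun x => rh_nonneg _
  have le3 : ((Real.sqrt B).toNNReal : ℝ≥0∞) ≤ (3 * (Real.sqrt B).toNNReal : ℝ≥0) := by
    exact_mod_cast le_mul_of_one_le_left zero_le (by norm_num)
  have hj : ∀ j, eLpNorm (pd (Φ k) j) 2 volume ≤ (Real.sqrt B).toNNReal := by
    intro j
    refine eLp_of_int (JJ_int h) hB fun x => ?_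
    have : ‖pd (Φ k) j x‖^2 ≤ ∑ k, ∑ j, ‖pd (Φ k) j x‖^2 :=
      (Finset.single_le_sum (f := fun j => ‖pd (Φ k) j x‖^2) (fun _ _ => sq_nonneg _) (Finset.mem_univ j)).trans
      (Finset.single_le_sum (f := fun k => ∑ j, ‖pd (Φ k) j x‖^2) (fun _ _ => Finset.sum_nonneg fun _ _ => sq_nonneg _) (Finset.mem_univ k))
    have := mul_nonneg (pos2 x) (pos3 x)
    have := pos3 x
    unfold JJ; linarith
  refine ⟨(eLp_of_int (JJ_int h) hB fun x => ?_).trans le3, ?_, (eLp_of_int (JJ_int h) hB fun x => ?_).trans le3, fun j => (hj j).trans le3⟩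
  · have := le_rh (fun k => Φ k x) k
    have := mul_nonneg (pos2 x) (pos3 x)
    have := pos1 x
    unfold JJ; linarith
  · refine TL_of_diff (h.diff k) ?_
    calc eLpNorm (fderiv ℝ (Φ k)) 2 volume ≤ eLpNorm (fun x => ∑ j, ‖pd (Φ k) j x‖) 2 volume := by
          refine eLpNorm_mono fun x => ?_
          rw [Real.norm_of_nonneg (Finset.sum_nonneg fun _ _ => norm_nonneg _)]
          exact opnorm_le_sum _
      _ ≤ ∑ j, eLpNorm (fun x => ‖pd (Φ k) j x‖) 2 volume := by
          have := eLpNorm_sum_le (f := fun j x => ‖pd (Φ k) j x‖) (s := Finset.univ) (μ := volume) (p := 2) (fun j _ => (h.d2 k j).1.norm) (by norm_num)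
          refine le_trans (le_of_eq ?_) this
          congr 1
      _ ≤ ∑ j : Fin 3, ((Real.sqrt B).toNNReal : ℝ≥0∞) := Finset.sum_le_sum fun j _ => by rw [eLpNorm_norm]; exact hj j
      _ = _ := by simp
  · have e : ‖x‖^2 = ∑ i, (x i)^2 := by rw [EuclideanSpace.norm_sq_eq]; simp
    rw [norm_mul, norm_norm, norm_norm, mul_pow, e]
    have := mul_le_mul_of_nonneg_left (le_rh (fun k => Φ k x) k) (pos2 x)
    have := pos1 x
    have := pos3 x
    unfold JJ; linarith

lemma min_seq {Ω γ a b e c0 c1 : ℝ} (ha : 0 < a) (hb : 0 < b) (he : 0 < e) (hΩ : |Ω| < min a b)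
    (hc : (0 ≤ c0 ∧ 0 ≤ c1) ∨ (c1 ≤ 0 ∧ 0 ≤ c0 + c1)) :
    ∃ (m : ℝ) (Φ : ℕ → Tri) (A : ℝ≥0), (∀ Ψ, Good Ψ → mass Ψ = 1 → m ≤ QQ Ω γ (gam a b e) 0 Ψ + WW c0 c1 Ψ) ∧
      (∀ n, Good (Φ n)) ∧ (∀ n, mass (Φ n) = 1) ∧ 
      Tendsto (fun n => QQ Ω γ (gam a b e) 0 (Φ n) + WW c0 c1 (Φ n)) atTop (𝓝 m) ∧
      (∀ n, |QQ Ω γ (gam a b e) 0 (Φ n)| ≤ A) ∧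
      ∀ n k, eLpNorm (Φ n k) 2 volume ≤ A ∧ TL (Φ n k) A ∧ eLpNorm (fun x => ‖x‖ * ‖Φ n k x‖) 2 volume ≤ A ∧
        ∀ j, eLpNorm (pd (Φ n k) j) 2 volume ≤ A := by
  obtain ⟨C, c, hc0, hco⟩ := coer (γ := γ) ha hb he hΩ
  have hQ : ∀ Ψ, Good Ψ → c * ∫ x, JJ Ψ x ≤ QQ Ω γ (gam a b e) C Ψ := by
    intro Ψ h
    unfold QQ
    rw [← integral_const_mul]
    exact integral_mono ((JJ_int h).const_mul _) (be_int h h Ω γ _ C) fun x => hco x _ _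
  have hJ : ∀ Ψ, 0 ≤ ∫ x, JJ Ψ x := fun Ψ => integral_nonneg fun x => by
    have := rh_nonneg (fun k => Ψ k x)
    unfold JJ; positivity
  have hlow : ∀ Ψ, Good Ψ → mass Ψ = 1 → c * ∫ x, JJ Ψ x ≤ QQ Ω γ (gam a b e) 0 Ψ + C := by
    intro Ψ h hm
    have := hQ Ψ h
    rwa [QQ_const _ _ _ _ h, hm, mul_one] at this
  set S : Set ℝ := {r | ∃ Ψ, Good Ψ ∧ mass Ψ = 1 ∧ QQ Ω γ (gam a b e) 0 Ψ + WW c0 c1 Ψ = r}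
  have hne : S.Nonempty := by
    obtain ⟨Φ, h1, h2⟩ := exists_unit
    exact ⟨_, Φ, h1, h2, rfl⟩
  have hbd : BddBelow S := by
    refine ⟨-C, ?_⟩
    rintro r ⟨Ψ, h1, h2, rfl⟩
    have := hlow Ψ h1 h2
    have := WW_nonneg hc Ψ
    have := mul_nonneg hc0.le (hJ Ψ)
    linarith
  obtain ⟨u, hu1, hu2, hu3⟩ := exists_seq_tendsto_sInf hne hbd
  choose Φ h1 h2 h3 using hu3
  have up : ∀ n, QQ Ω γ (gam a b e) 0 (Φ n) ≤ u 0 := fun n => by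
    have := hu1 (Nat.zero_le n)
    have := WW_nonneg hc (Φ n)
    have := h3 n
    linarith
  set B := (u 0 + C) / c
  have hB : ∀ n, ∫ x, JJ (Φ n) x ≤ B := fun n => by
    rw [le_div_iff₀ hc0]
    have := hlow _ (h1 n) (h2 n)
    have := up n
    linarith
  set A : ℝ≥0 := 3 * (Real.sqrt B).toNNReal + (|u 0| + |C|).toNNReal
  have hA : ((3 * (Real.sqrt B).toNNReal : ℝ≥0) : ℝ≥0∞) ≤ A := by
    exact_mod_cast le_self_add
  refine ⟨sInf S, Φ, A, fun Ψ h h' => csInf_le hbd ⟨Ψ, h, h', rfl⟩, h1, h2, by simpa only [h3] using hu2, fun n => ?_, fun n k => ?_⟩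
  · have e1 := hlow _ (h1 n) (h2 n)
    have e2 := mul_nonneg hc0.le (hJ (Φ n))
    have e3 := up n
    have e4 : |u 0| + |C| ≤ (A : ℝ) := by
      simp only [A]; push_cast
      have : ((|u 0| + |C|).toNNReal : ℝ) = |u 0| + |C| := Real.coe_toNNReal _ (by positivity)
      rw [this]
      have : (0:ℝ) ≤ (Real.sqrt B).toNNReal := NNReal.coe_nonneg _
      linarith
    rw [abs_le]
    have := le_abs_self (u 0); have := le_abs_self C; have := abs_nonneg C; have := abs_nonneg (u 0)
    constructor <;> linarith
  · obtain ⟨i1, i2, i3, i4⟩ := unif (h1 n) (hB n) k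
    exact ⟨i1.trans hA, fun h => (i2 h).trans (by gcongr), i3.trans hA, fun j => (i4 j).trans hA⟩

end

section
open scoped ENNReal NNReal Topology FourierTransform ContDiff SchwartzMap Convolution
open Filter

lemma hol {f g : Pt 3 → ℂ} (hf : AEStronglyMeasurable f volume) (hg : AEStronglyMeasurable g volume) :
    ‖∫ x, f x * g x‖ₑ ≤ eLpNorm f 2 volume * eLpNorm g 2 volume := by
  refine (enorm_integral_le_lintegral_enorm _).trans ?_
  have := eLpNorm_smul_le_mul_eLpNorm (p := 2) (q := 2) (r := 1) hg hf
  rwa [eLpNorm_one_eq_lintegral_enorm] at this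

lemma pd_conj {f : Pt 3 → ℂ} {x : Pt 3} (hf : DifferentiableAt ℝ f x) (j) :
    pd (fun x => (starRingEnd ℂ) (f x)) j x = (starRingEnd ℂ) (pd f j x) := by
  unfold pd
  have := (Complex.conjCLE.hasFDerivAt (x := f x)).comp x hf.hasFDerivAt
  have e := this.fderiv
  have : (fun x => (starRingEnd ℂ) (f x)) = (Complex.conjCLE ∘ f) := by ext; simp
  rw [this, e]; simp

lemma ibp {f ψ : Pt 3 → ℂ} (hd : Differentiable ℝ f) (h2 : MemLp f 2) (j) (hp : MemLp (pd f j) 2) (hψ : CC ψ) :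
    ∫ x, pd f j x * ψ x = -∫ x, f x * pd ψ j x := by
  have := integral_mul_fderiv_eq_neg_fderiv_mul_of_integrable (μ := (volume : Measure (Pt 3))) (f := f) (g := ψ) (v := ee j)
    (hp.integrable_mul (hψ.memLp 2)) (h2.integrable_mul ((hψ.pd j).memLp 2)) (h2.integrable_mul (hψ.memLp 2))
    (fun x _ => hd x) (fun x _ => hψ.1.differentiable (by simp) x)
  unfold pd
  rw [this, neg_neg]

lemma ibp_conj {Φ : Tri} (h : Good Φ) (k j) {ψ : Pt 3 → ℂ} (hψ : CC ψ) :
    ∫ x, ((starRingEnd ℂ) (pd (Φ k) j x) * ψ x + (starRingEnd ℂ) (Φ k x) * pd ψ j x) = 0 := by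
  have hc : Differentiable ℝ (fun x => (starRingEnd ℂ) (Φ k x)) := Complex.conjCLE.differentiable.comp (h.diff k)
  have e : pd (fun x => (starRingEnd ℂ) (Φ k x)) j = fun x => (starRingEnd ℂ) (pd (Φ k) j x) := by
    ext x; exact pd_conj (h.diff k x) j
  have := ibp (j := j) hc (h.m2 k).star (by rw [e]; exact (h.d2 k j).star) hψ
  rw [e] at this
  rw [integral_add (int_conj (h.d2 k j) (hψ.memLp 2)) (int_conj (h.m2 k) ((hψ.pd j).memLp 2)), this, neg_add_cancel]

lemma Ac_smooth (Ω γ : ℝ) (k l j) : ContDiff ℝ ∞ (Ac Ω γ k l j) := by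
  have h : ContDiff ℝ ∞ (fun x => rotv x j) := by
    fin_cases j
    · exact (coord_smooth 1).neg
    · exact coord_smooth 0
    · exact contDiff_const
  unfold Ac
  split_ifs
  · exact (contDiff_const.mul h).sub contDiff_const
  · exact contDiff_const.sub contDiff_const

lemma Ac_conj (Ω γ : ℝ) (k l j) (x) : (starRingEnd ℂ) (Ac Ω γ k l j x) = - Ac Ω γ l k j x := by
  fin_cases k <;> fin_cases l <;> fin_cases j <;> simp [Ac, rotv, Smat]

lemma Ac_pd (Ω γ : ℝ) (k l j) (x) : pd (Ac Ω γ k l j) j x = 0 := by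
  unfold pd
  rw [← ((Ac_smooth Ω γ k l j).differentiable (by simp) x).lineDeriv_eq_fderiv]
  unfold lineDeriv
  have : (fun t : ℝ => Ac Ω γ k l j (x + t • ee j)) = fun t => Ac Ω γ k l j x := by
    ext t
    fin_cases j <;> simp [Ac, rotv, ee]
  rw [this]; simp

lemma pot_smooth (g : Fin 3 → ℝ) (C : ℝ) : ContDiff ℝ ∞ (fun x => (pot g C x : ℂ)) := by
  have : (fun x => (pot g C x : ℂ)) = fun x : Pt 3 => ∑ i, (g i : ℂ) * (x i : ℂ)^2 + C := by
    ext x; simp [pot]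
  rw [this]
  exact (ContDiff.sum fun i _ => contDiff_const.mul ((coord_smooth i).pow 2)).add contDiff_const

def TT (Ω γ : ℝ) (g : Fin 3 → ℝ) (C : ℝ) (η : Tri) (k : Fin 3) (x : Pt 3) : ℂ :=
  -Lap (η k) x + 2 * (pot g C x : ℂ) * η k x + 2 * ∑ l, ∑ j, Ac Ω γ k l j x * pd (η l) j x

lemma TT_CC (Ω γ : ℝ) (g : Fin 3 → ℝ) (C : ℝ) {η : Tri} (h : ∀ k, CC (η k)) (k) : CC (TT Ω γ g C η k) := by
  have h1 : CC (fun x => -Lap (η k) x) := by simpa using (h k).Lap.cmul (-1)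
  have h2 : CC (fun x => 2 * (pot g C x : ℂ) * η k x) := (h k).smul (contDiff_const.mul (pot_smooth g C))
  have h3 : CC (fun x => 2 * ∑ l, ∑ j, Ac Ω γ k l j x * pd (η l) j x) :=
    (CC.sum _ fun l _ => CC.sum _ fun j _ => ((h l).pd j).smul (Ac_smooth Ω γ k l j)).cmul 2
  exact (h1.add h2).add h3

lemma B_eq {Φ η : Tri} (h : Good Φ) (hη : ∀ k, CC (η k)) (Ω γ : ℝ) (g : Fin 3 → ℝ) (C : ℝ) :
    ∫ x, (be Ω γ (pot g C) Φ η x + be Ω γ (pot g C) η Φ x) = (∑ k, ∫ x, (starRingEnd ℂ) (Φ k x) * TT Ω γ g C η k x).re := by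
  have hψ : ∀ k l j, CC (fun x => -Ac Ω γ l k j x * η k x) := fun k l j => (hη k).smul (Ac_smooth Ω γ l k j).neg
  have pdψ : ∀ k l j x, pd (fun x => -Ac Ω γ l k j x * η k x) j x = -Ac Ω γ l k j x * pd (η k) j x := by
    intro k l j x
    rw [pd_mul ((Ac_smooth Ω γ l k j).neg.differentiable (by simp) x) ((hη k).1.differentiable (by simp) x)]
    have : pd (fun x => -Ac Ω γ l k j x) j x = 0 := by
      have := pd_const_mul ((Ac_smooth Ω γ l k j).differentiable (by simp) x) (-1) j
      rw [Ac_pd] at this; simpa using this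
    rw [this]; ring
  have i1 : ∀ k j, Integrable (fun x => (starRingEnd ℂ) (pd (Φ k) j x) * pd (η k) j x + (starRingEnd ℂ) (Φ k x) * pd (pd (η k) j) j x) :=
    fun k j => (int_conj (h.d2 k j) (((hη k).pd j).memLp 2)).add (int_conj (h.m2 k) ((((hη k).pd j).pd j).memLp 2))
  have i2 : ∀ k l j, Integrable (fun x => (starRingEnd ℂ) (pd (Φ l) j x) * (-Ac Ω γ l k j x * η k x) + (starRingEnd ℂ) (Φ l x) * pd (fun x => -Ac Ω γ l k j x * η k x) j x) :=
    fun k l j => (int_conj (h.d2 l j) ((hψ k l j).memLp 2)).add (int_conj (h.m2 l) (((hψ k l j).pd j).memLp 2))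
  have i3 : ∀ k, Integrable (fun x => (starRingEnd ℂ) (Φ k x) * TT Ω γ g C η k x) := fun k => int_conj (h.m2 k) ((TT_CC Ω γ g C hη k).memLp 2)
  have z1 : ∫ x, ∑ k, ∑ j, ((starRingEnd ℂ) (pd (Φ k) j x) * pd (η k) j x + (starRingEnd ℂ) (Φ k x) * pd (pd (η k) j) j x) = 0 := by
    rw [integral_finsetSum _ fun k _ => integrable_finsetSum _ fun j _ => i1 k j]
    refine Finset.sum_eq_zero fun k _ => ?_
    rw [integral_finsetSum _ fun j _ => i1 k j]
    exact Finset.sum_eq_zero fun j _ => ibp_conj h k j ((hη k).pd j)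
  have z2 : ∫ x, ∑ k, ∑ l, ∑ j, ((starRingEnd ℂ) (pd (Φ l) j x) * (-Ac Ω γ l k j x * η k x) + (starRingEnd ℂ) (Φ l x) * pd (fun x => -Ac Ω γ l k j x * η k x) j x) = 0 := by
    rw [integral_finsetSum _ fun k _ => integrable_finsetSum _ fun l _ => integrable_finsetSum _ fun j _ => i2 k l j]
    refine Finset.sum_eq_zero fun k _ => ?_
    rw [integral_finsetSum _ fun l _ => integrable_finsetSum _ fun j _ => i2 k l j]
    refine Finset.sum_eq_zero fun l _ => ?_
    rw [integral_finsetSum _ fun j _ => i2 k l j]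
    exact Finset.sum_eq_zero fun j _ => ibp_conj h l j (hψ k l j)
  rw [← integral_finsetSum _ fun k _ => i3 k]
  have tot : (∫ x, ∑ k, (starRingEnd ℂ) (Φ k x) * TT Ω γ g C η k x) =
     ∫ x, ((∑ k, (starRingEnd ℂ) (Φ k x) * TT Ω γ g C η k x) + (∑ k, ∑ j, ((starRingEnd ℂ) (pd (Φ k) j x) * pd (η k) j x + (starRingEnd ℂ) (Φ k x) * pd (pd (η k) j) j x))
      + ∑ k, ∑ l, ∑ j, ((starRingEnd ℂ) (pd (Φ l) j x) * (-Ac Ω γ l k j x * η k x) + (starRingEnd ℂ) (Φ l x) * pd (fun x => -Ac Ω γ l k j x * η k x) j x)) := by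
    rw [integral_add, integral_add, z1, z2, add_zero, add_zero]
    · exact integrable_finsetSum _ fun k _ => i3 k
    · exact integrable_finsetSum _ fun k _ => integrable_finsetSum _ fun j _ => i1 k j
    · exact (integrable_finsetSum _ fun k _ => i3 k).add (integrable_finsetSum _ fun k _ => integrable_finsetSum _ fun j _ => i1 k j)
    · exact integrable_finsetSum _ fun k _ => integrable_finsetSum _ fun l _ => integrable_finsetSum _ fun j _ => i2 k l j
  rw [tot]
  have itot : Integrable (fun x => ((∑ k, (starRingEnd ℂ) (Φ k x) * TT Ω γ g C η k x) + (∑ k, ∑ j, ((starRingEnd ℂ) (pd (Φ k) j x) * pd (η k) j x + (starRingEnd ℂ) (Φ k x) * pd (pd (η k) j) j x))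
      + ∑ k, ∑ l, ∑ j, ((starRingEnd ℂ) (pd (Φ l) j x) * (-Ac Ω γ l k j x * η k x) + (starRingEnd ℂ) (Φ l x) * pd (fun x => -Ac Ω γ l k j x * η k x) j x))) :=
    ((integrable_finsetSum _ fun k _ => i3 k).add (integrable_finsetSum _ fun k _ => integrable_finsetSum _ fun j _ => i1 k j)).add
    (integrable_finsetSum _ fun k _ => integrable_finsetSum _ fun l _ => integrable_finsetSum _ fun j _ => i2 k l j)
  have : ∀ f : Pt 3 → ℂ, Integrable f → (∫ x, f x).re = ∫ x, (f x).re := fun f hf => (integral_re hf).symm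
  rw [this _ itot]
  congr 1; ext x
  have flip : be Ω γ (pot g C) η Φ x = ((starRingEnd ℂ) (bc Ω γ (pot g C x) x (fun k => η k x) (fun k j => pd (η k) j x) (fun k => Φ k x) (fun k j => pd (Φ k) j x))).re := by
    rw [conj_re]; rfl
  rw [flip, be, ← add_re]
  congr 1
  simp only [pdψ, bc, TT, Lap, map_add, map_mul, map_sum, conj_conj, Ac_conj, conj_ofReal, map_div₀, map_one, map_ofNat]
  simp only [Fin.sum_univ_three]
  ring

lemma weak {F : ℕ → Pt 3 → ℂ} {f : Pt 3 → ℂ} {A : ℝ≥0} (hF : ∀ n, MemLp (F n) 2) (hA : ∀ n, eLpNorm (F n) 2 volume ≤ A)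
    (hf : MemLp f 2) (h : ∀ ψ, CC ψ → Tendsto (fun n => ∫ x, F n x * ψ x) atTop (𝓝 (∫ x, f x * ψ x))) {g : Pt 3 → ℂ} (hg : MemLp g 2) :
    Tendsto (fun n => ∫ x, F n x * g x) atTop (𝓝 (∫ x, f x * g x)) := by
  rw [Metric.tendsto_atTop]
  intro ε hε
  set B : ℝ := A + (eLpNorm f 2 volume).toReal + 1
  have hB : 0 < B := by positivity
  obtain ⟨ψ, p1, p2, p3⟩ := hg.exist_eLpNorm_sub_le (by norm_num) (by norm_num) (ε := ε / (3 * B)) (by positivity)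
  have hψ : CC ψ := ⟨p2, p1⟩
  have est : ∀ w : Pt 3 → ℂ, MemLp w 2 → (eLpNorm w 2 volume).toReal ≤ B → ‖(∫ x, w x * g x) - ∫ x, w x * ψ x‖ ≤ ε / 3 := by
    intro w hw hwB
    rw [← integral_sub (f := fun x => w x * g x) (g := fun x => w x * ψ x) (hw.integrable_mul hg) (hw.integrable_mul (hψ.memLp 2))]
    have : ∀ x, w x * g x - w x * ψ x = w x * (g - ψ) x := fun x => by simp [mul_sub]
    simp only [this]
    have h1 := hol hw.1 (hg.sub (hψ.memLp 2)).1
    have h2 : ‖∫ x, w x * (g - ψ) x‖ₑ ≤ ENNReal.ofReal B * ENNReal.ofReal (ε / (3 * B)) := by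
      refine h1.trans (mul_le_mul' ?_ p3)
      exact (ENNReal.le_ofReal_iff_toReal_le hw.2.ne hB.le).2 hwB
    rw [← ENNReal.ofReal_mul hB.le, ← ofReal_norm, ENNReal.ofReal_le_ofReal_iff (by positivity)] at h2
    refine h2.trans (le_of_eq ?_)
    field_simp
  obtain ⟨N, hN⟩ := Metric.tendsto_atTop.1 (h ψ hψ) (ε / 3) (by positivity)
  refine ⟨N, fun n hn => ?_⟩
  have e1 := est (F n) (hF n) (by
    have : (eLpNorm (F n) 2 volume).toReal ≤ A := by
      simpa using ENNReal.toReal_mono (by simp) (hA n)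
    have := ENNReal.toReal_nonneg (a := eLpNorm f 2 volume)
    simp only [B]; linarith)
  have e2 := est f hf (by simp only [B]; have : (0:ℝ) ≤ A := A.2; linarith)
  have e3 := hN n hn
  rw [dist_eq_norm] at e3 ⊢
  have : (∫ x, F n x * g x) - ∫ x, f x * g x = ((∫ x, F n x * g x) - ∫ x, F n x * ψ x) + ((∫ x, F n x * ψ x) - ∫ x, f x * ψ x) - ((∫ x, f x * g x) - ∫ x, f x * ψ x) := by ring
  rw [this]
  calc _ ≤ _ := (norm_sub_le _ _).trans (add_le_add_left (norm_add_le _ _) _)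
    _ < ε := by linarith

end

section
open scoped ENNReal NNReal Topology FourierTransform ContDiff SchwartzMap Convolution
open Filter

abbrev V3 := Fin 3 → ℂ
def s1 (p : V3) : ℝ := ∑ k, ‖p k‖
lemma s1_nonneg (p) : 0 ≤ s1 p := Finset.sum_nonneg fun _ _ => norm_nonneg _
def d1 (p q : V3) : ℝ := ∑ k, ‖p k - q k‖
lemma d1_nonneg (p q) : 0 ≤ d1 p q := Finset.sum_nonneg fun _ _ => norm_nonneg _

def LipP (d : ℕ) (f : V3 → ℂ) : Prop := ∃ C : ℝ≥0, (∀ p, ‖f p‖ ≤ C * s1 p ^ (d+1)) ∧ ∀ p q, ‖f p - f q‖ ≤ C * (s1 p + s1 q)^d * d1 p q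

lemma LipP.add {d} {f g : V3 → ℂ} (hf : LipP d f) (hg : LipP d g) : LipP d (fun p => f p + g p) := by
  obtain ⟨C, h1, h2⟩ := hf
  obtain ⟨C', h1', h2'⟩ := hg
  refine ⟨C + C', fun p => ?_, fun p q => ?_⟩
  · push_cast
    have := norm_add_le (f p) (g p); have := h1 p; have := h1' p; linarith
  · push_cast
    have e : f p + g p - (f q + g q) = (f p - f q) + (g p - g q) := by ring
    rw [e]
    have := norm_add_le (f p - f q) (g p - g q); have := h2 p q; have := h2' p q; linarith

lemma LipP.cmul {d} {f : V3 → ℂ} (hf : LipP d f) (c : ℂ) : LipP d (fun p => c * f p) := by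
  obtain ⟨C, h1, h2⟩ := hf
  refine ⟨‖c‖₊ * C, fun p => ?_, fun p q => ?_⟩
  · rw [norm_mul]; push_cast; rw [mul_assoc]; exact mul_le_mul_of_nonneg_left (h1 p) (norm_nonneg _)
  · rw [← mul_sub, norm_mul]; push_cast
    have := mul_le_mul_of_nonneg_left (h2 p q) (norm_nonneg c)
    linarith

lemma LipP.mul {d e} {f g : V3 → ℂ} (hf : LipP d f) (hg : LipP e g) : LipP (d+e+1) (fun p => f p * g p) := by
  obtain ⟨C, h1, h2⟩ := hf
  obtain ⟨C', h1', h2'⟩ := hg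
  refine ⟨2 * (C * C'), fun p => ?_, fun p q => ?_⟩
  · rw [norm_mul]; push_cast
    have h := mul_le_mul (h1 p) (h1' p) (norm_nonneg _) ((norm_nonneg _).trans (h1 p))
    have : (C:ℝ) * s1 p ^ (d+1) * (C' * s1 p ^ (e+1)) = C * C' * s1 p ^ (d+e+1+1) := by ring
    have : (0:ℝ) ≤ C * C' * s1 p ^ (d+e+1+1) := by have := s1_nonneg p; positivity
    linarith
  · have ep : f p * g p - f q * g q = f p * (g p - g q) + (f p - f q) * g q := by ring
    rw [ep]
    refine (norm_add_le _ _).trans ?_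
    rw [norm_mul, norm_mul]
    have sp := s1_nonneg p; have sq := s1_nonneg q; have dd := d1_nonneg p q
    have l1 : ‖f p‖ ≤ C * (s1 p + s1 q)^(d+1) := (h1 p).trans (by gcongr; linarith)
    have l2 : ‖g q‖ ≤ C' * (s1 p + s1 q)^(e+1) := (h1' q).trans (by gcongr; linarith)
    have m1 := mul_le_mul l1 (h2' p q) (norm_nonneg _) (by positivity)
    have m2 := mul_le_mul (h2 p q) l2 (norm_nonneg _) (by positivity)
    push_cast
    have : (C:ℝ) * (s1 p + s1 q)^(d+1) * (C' * (s1 p + s1 q)^e * d1 p q) + C * (s1 p + s1 q)^d * d1 p q * (C' * (s1 p + s1 q)^(e+1))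
      = 2 * (C * C') * (s1 p + s1 q)^(d+e+1) * d1 p q := by ring
    linarith

lemma LipP.proj (k : Fin 3) : LipP 0 (fun p => p k) := by
  refine ⟨1, fun p => ?_, fun p q => ?_⟩
  · simpa [s1] using Finset.single_le_sum (f := fun k => ‖p k‖) (fun _ _ => norm_nonneg _) (Finset.mem_univ k)
  · simpa [d1] using Finset.single_le_sum (f := fun k => ‖p k - q k‖) (fun _ _ => norm_nonneg _) (Finset.mem_univ k)

lemma LipP.conj {d} {f : V3 → ℂ} (hf : LipP d f) : LipP d (fun p => (starRingEnd ℂ) (f p)) := by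
  obtain ⟨C, h1, h2⟩ := hf
  refine ⟨C, fun p => ?_, fun p q => ?_⟩
  · rw [RCLike.norm_conj]; exact h1 p
  · rw [← map_sub, RCLike.norm_conj]; exact h2 p q

/-- squared spin density parts in conjugated variable -/
def qR (u : V3) : ℂ := ∑ k, (starRingEnd ℂ) (u k) * u k
def qA (u : V3) : ℂ := (1/2) * ((u 0 + u 2) * (starRingEnd ℂ) (u 1) + (starRingEnd ℂ) (u 0 + u 2) * u 1)
def qB (u : V3) : ℂ := (-I/2) * ((starRingEnd ℂ) (u 1) * (u 2 - u 0) + (-1) * (u 1 * (starRingEnd ℂ) (u 2 - u 0)))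
def qZ (u : V3) : ℂ := (starRingEnd ℂ) (u 0) * u 0 + (-1) * ((starRingEnd ℂ) (u 2) * u 2)

def nn (c0 c1 : ℝ) : Fin 3 → V3 → ℂ :=
  ![fun u => (2*c0) * (qR u * u 0) + (2*c1) * (qA u * u 1 + (-I) * (qB u * u 1) + qZ u * u 0),
    fun u => (2*c0) * (qR u * u 1) + (2*c1) * (qA u * (u 0 + u 2) + (-I) * (qB u * (u 2 - u 0))),
    fun u => (2*c0) * (qR u * u 2) + (2*c1) * (qA u * u 1 + I * (qB u * u 1) + (-1) * (qZ u * u 2))]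

lemma LipP.sub {d} {f g : V3 → ℂ} (hf : LipP d f) (hg : LipP d g) : LipP d (fun p => f p - g p) := by
  simpa [sub_eq_add_neg] using hf.add (hg.cmul (-1))

lemma qR_lip : LipP 1 qR := by
  have : qR = fun u => (starRingEnd ℂ) (u 0) * u 0 + (starRingEnd ℂ) (u 1) * u 1 + (starRingEnd ℂ) (u 2) * u 2 := by
    ext u; simp [qR, Fin.sum_univ_three]
  rw [this]
  exact (((LipP.proj 0).conj.mul (.proj 0)).add ((LipP.proj 1).conj.mul (.proj 1))).add ((LipP.proj 2).conj.mul (.proj 2))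
lemma qA_lip : LipP 1 qA := 
  (((((LipP.proj 0).add (.proj 2)).mul (LipP.proj 1).conj)).add (((LipP.proj 0).add (.proj 2)).conj.mul (LipP.proj 1))).cmul _
lemma qB_lip : LipP 1 qB := 
  ((((LipP.proj 1).conj.mul ((LipP.proj 2).sub (.proj 0)))).add (((LipP.proj 1).mul (((LipP.proj 2).sub (.proj 0)).conj)).cmul _)).cmul _
lemma qZ_lip : LipP 1 qZ := ((LipP.proj 0).conj.mul (.proj 0)).add (((LipP.proj 2).conj.mul (.proj 2)).cmul _)

lemma nn_lip (c0 c1 : ℝ) (l) : LipP 2 (nn c0 c1 l) := by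
  fin_cases l
  · exact ((qR_lip.mul (.proj 0)).cmul _).add ((((qA_lip.mul (.proj 1)).add ((qB_lip.mul (.proj 1)).cmul _)).add (qZ_lip.mul (.proj 0))).cmul _)
  · exact ((qR_lip.mul (.proj 1)).cmul _).add (((qA_lip.mul ((LipP.proj 0).add (.proj 2))).add ((qB_lip.mul ((LipP.proj 2).sub (.proj 0))).cmul _)).cmul _)
  · exact ((qR_lip.mul (.proj 2)).cmul _).add ((((qA_lip.mul (.proj 1)).add ((qB_lip.mul (.proj 1)).cmul _)).add ((qZ_lip.mul (.proj 2)).cmul _)).cmul _)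

lemma nn_lip' (c0 c1 : ℝ) : ∃ C : ℝ≥0, ∀ l p q, ‖nn c0 c1 l p - nn c0 c1 l q‖ ≤ C * (∑ k, ‖p k‖ + ∑ k, ‖q k‖)^2 * ∑ k, ‖p k - q k‖ := by
  choose C h1 h2 using nn_lip c0 c1
  refine ⟨∑ l, C l, fun l p q => (h2 l p q).trans ?_⟩
  have : C l ≤ ∑ l, C l := Finset.single_le_sum (f := C) (fun _ _ => zero_le) (Finset.mem_univ l)
  have sp := s1_nonneg p; have sq := s1_nonneg q; have dd := d1_nonneg p q
  have : (C l : ℝ) * (s1 p + s1 q)^2 * d1 p q ≤ (∑ l, C l : ℝ≥0) * (s1 p + s1 q)^2 * d1 p q := by gcongr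
  exact this

lemma nn_cont (c0 c1 : ℝ) (l) : Continuous (nn c0 c1 l) := by
  have h : ∀ k, Continuous (fun p : V3 => p k) := fun k => continuous_apply k
  have hc : Continuous (starRingEnd ℂ) := Complex.continuous_conj
  have h0 : Continuous qR := by unfold qR; fun_prop
  have h1 : Continuous qA := by unfold qA; fun_prop
  have h2 : Continuous qB := by unfold qB; fun_prop
  have h3 : Continuous qZ := by unfold qZ; fun_prop
  fin_cases l <;> simp only [nn, Fin.zero_eta, Fin.mk_one, Fin.reduceFinMk, Matrix.cons_val] <;> fun_prop

lemma nn_zero (c0 c1 : ℝ) (l) : nn c0 c1 l 0 = 0 := by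
  fin_cases l <;> simp [nn]

lemma quad_rem {q q1 r P E t : ℝ} (hP : 0 ≤ P) (hE : 0 ≤ E) (h1 : |q| ≤ P) (h2 : q1^2 ≤ 4*P*E) (h3 : |r| ≤ E) (ht : |t| ≤ 1) :
    |(q + t*q1 + t^2*r)^2 - q^2 - 2*t*q*q1| ≤ t^2 * (10*(P+E)*E) := by
  have e : (q + t*q1 + t^2*r)^2 - q^2 - 2*t*q*q1 = t^2 * (q1^2 + 2*(q*r) + 2*(t*(q1*r)) + t^2*r^2) := by ring
  rw [e, abs_mul, abs_of_nonneg (sq_nonneg t)]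
  refine mul_le_mul_of_nonneg_left ?_ (sq_nonneg t)
  have a1 : |q*r| ≤ P*E := by rw [abs_mul]; exact mul_le_mul h1 h3 (abs_nonneg _) hP
  have a2 : r^2 ≤ E^2 := by rw [← sq_abs]; exact pow_le_pow_left₀ (abs_nonneg _) h3 2
  have a3 : t^2 ≤ 1 := by rw [← sq_abs]; exact pow_le_one₀ (abs_nonneg _) ht
  have a4 : |t*(q1*r)| ≤ (q1^2 + r^2)/2 := by
    rw [abs_mul]
    have : |q1*r| ≤ (q1^2+r^2)/2 := by rw [abs_le]; constructor <;> nlinarith [sq_nonneg (q1-r), sq_nonneg (q1+r)]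
    calc _ ≤ 1 * ((q1^2+r^2)/2) := mul_le_mul ht this (abs_nonneg _) (by norm_num)
      _ = _ := one_mul _
  have a5 : t^2*r^2 ≤ E^2 := (mul_le_of_le_one_left (sq_nonneg _) a3).trans a2
  have a6 : 0 ≤ t^2*r^2 := by positivity
  have a7 := sq_nonneg q1
  rw [abs_le] at a1 a4
  have := mul_nonneg hP hE
  have := sq_nonneg r
  rw [abs_le]
  constructor <;> nlinarith

def Aq (p : V3) : ℝ := (((starRingEnd ℂ) (p 0) + (starRingEnd ℂ) (p 2)) * p 1).re
def Bq (p : V3) : ℝ := (p 1 * ((starRingEnd ℂ) (p 2) - (starRingEnd ℂ) (p 0))).im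
def Zq (p : V3) : ℝ := ‖p 0‖^2 - ‖p 2‖^2

def R1 (p h : V3) : ℝ := 2 * (∑ k, (starRingEnd ℂ) (p k) * h k).re
def A1 (p h : V3) : ℝ := (((starRingEnd ℂ) (p 0) + (starRingEnd ℂ) (p 2)) * h 1 + ((starRingEnd ℂ) (h 0) + (starRingEnd ℂ) (h 2)) * p 1).re
def B1 (p h : V3) : ℝ := (h 1 * ((starRingEnd ℂ) (p 2) - (starRingEnd ℂ) (p 0)) + p 1 * ((starRingEnd ℂ) (h 2) - (starRingEnd ℂ) (h 0))).im
def Z1 (p h : V3) : ℝ := 2 * ((starRingEnd ℂ) (p 0) * h 0 - (starRingEnd ℂ) (p 2) * h 2).re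

lemma polar (p h : V3) (t : ℝ) : 
    rh (fun k => p k + (t:ℂ) * h k) = rh p + t * R1 p h + t^2 * rh h ∧
    Aq (fun k => p k + (t:ℂ) * h k) = Aq p + t * A1 p h + t^2 * Aq h ∧
    Bq (fun k => p k + (t:ℂ) * h k) = Bq p + t * B1 p h + t^2 * Bq h ∧
    Zq (fun k => p k + (t:ℂ) * h k) = Zq p + t * Z1 p h + t^2 * Zq h := by
  refine ⟨?_, ?_, ?_, ?_⟩
  all_goals
    simp only [rh, Aq, Bq, Zq, R1, A1, B1, Z1, Fin.sum_univ_three, nsq]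
    simp only [sub_re, sub_im, mul_re, mul_im, add_re, add_im, conj_re, conj_im, ofReal_re, ofReal_im]
    ring

lemma A_le (p) : |Aq p| ≤ rh p := by
  have h1 := Fs_le p; have h2 : Fs p = 2 * Aq p^2 + 2*Bq p^2 + Zq p^2 := rfl
  refine abs_le_of_sq_le_sq ?_ (rh_nonneg p)
  nlinarith [sq_nonneg (Aq p), sq_nonneg (Bq p), sq_nonneg (Zq p)]
lemma B_le (p) : |Bq p| ≤ rh p := by
  have h1 := Fs_le p; have h2 : Fs p = 2 * Aq p^2 + 2*Bq p^2 + Zq p^2 := rfl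
  refine abs_le_of_sq_le_sq ?_ (rh_nonneg p)
  nlinarith [sq_nonneg (Aq p), sq_nonneg (Bq p), sq_nonneg (Zq p)]
lemma Z_le (p) : |Zq p| ≤ rh p := by
  have h1 := Fs_le p; have h2 : Fs p = 2 * Aq p^2 + 2*Bq p^2 + Zq p^2 := rfl
  refine abs_le_of_sq_le_sq ?_ (rh_nonneg p)
  nlinarith [sq_nonneg (Aq p), sq_nonneg (Bq p), sq_nonneg (Zq p)]

/-- polarization bound for quadratic forms bounded by P -/
lemma disc {q b r P E Rr : ℝ} (hq : ∀ t : ℝ, |q + t * b + t^2 * r| ≤ P + t * Rr + t^2 * E) :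
    b^2 ≤ 4*P*E := by
  have h : ∀ t : ℝ, 0 ≤ E * (t * t) + b * t + P := by
    intro t
    have h1 := (abs_le.1 (hq t)).1
    have h2 := (abs_le.1 (hq (-t))).2
    nlinarith
  have := discrim_le_zero h
  unfold discrim at this
  linarith

lemma wd_rem (c0 c1 : ℝ) (p h : V3) (t : ℝ) (ht : |t| ≤ 1) :
    |wd c0 c1 (fun k => p k + (t:ℂ) * h k) - wd c0 c1 p - t * (∑ k, nn c0 c1 k (fun k => (starRingEnd ℂ) (p k)) * h k).re|
      ≤ t^2 * ((5*|c0| + 25*|c1|) * ((rh p + rh h) * rh h)) := by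
  have P0 := rh_nonneg p; have E0 := rh_nonneg h
  have w1 : (∑ k, nn c0 c1 k (fun k => (starRingEnd ℂ) (p k)) * h k).re =
      c0 * (rh p * R1 p h) + c1 * (2 * (Aq p * A1 p h) + 2 * (Bq p * B1 p h) + Zq p * Z1 p h) := by
    have eR : qR (fun k => (starRingEnd ℂ) (p k)) = (rh p : ℝ) := by
      apply Complex.ext
      · simp only [rh, Fin.sum_univ_three, nsq, ofReal_re]; simp [qR, Fin.sum_univ_three]; ring
      · simp [qR, Fin.sum_univ_three]; ring
    have eA : qA (fun k => (starRingEnd ℂ) (p k)) = (Aq p : ℝ) := by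
      apply Complex.ext <;> simp [qA, Aq] <;> ring
    have eB : qB (fun k => (starRingEnd ℂ) (p k)) = (Bq p : ℝ) := by
      apply Complex.ext <;> simp [qB, Bq] <;> ring
    have eZ : qZ (fun k => (starRingEnd ℂ) (p k)) = (Zq p : ℝ) := by
      apply Complex.ext
      · simp only [Zq, nsq, ofReal_re]; simp [qZ]; ring
      · simp [qZ]; ring
    simp only [Fin.sum_univ_three, nn, Matrix.cons_val, eR, eA, eB, eZ, R1, A1, B1, Z1]
    generalize rh p = a
    generalize Aq p = b
    generalize Bq p = c
    generalize Zq p = d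
    simp
    ring
  obtain ⟨r1, r2, r3, r4⟩ := polar p h t
  have q1 : R1 p h ^2 ≤ 4 * rh p * rh h := disc (q := rh p) (r := rh h) (Rr := R1 p h) fun t => by
    rw [← (polar p h t).1, abs_of_nonneg (rh_nonneg _)]
  have q2 : A1 p h ^2 ≤ 4 * rh p * rh h := disc (q := Aq p) (r := Aq h) (Rr := R1 p h) fun t => by
    rw [← (polar p h t).1, ← (polar p h t).2.1]; exact A_le _
  have q3 : B1 p h ^2 ≤ 4 * rh p * rh h := disc (q := Bq p) (r := Bq h) (Rr := R1 p h) fun t => by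
    rw [← (polar p h t).1, ← (polar p h t).2.2.1]; exact B_le _
  have q4 : Z1 p h ^2 ≤ 4 * rh p * rh h := disc (q := Zq p) (r := Zq h) (Rr := R1 p h) fun t => by
    rw [← (polar p h t).1, ← (polar p h t).2.2.2]; exact Z_le _
  have k1 := quad_rem P0 E0 (abs_of_nonneg P0).le q1 (abs_of_nonneg E0).le ht
  have k2 := quad_rem P0 E0 (A_le p) q2 (A_le h) ht
  have k3 := quad_rem P0 E0 (B_le p) q3 (B_le h) ht
  have k4 := quad_rem P0 E0 (Z_le p) q4 (Z_le h) ht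
  have wdd : ∀ p, wd c0 c1 p = c0/2 * rh p^2 + c1/2*(2 * Aq p^2 + 2 * Bq p^2 + Zq p^2) := fun p => rfl
  rw [wdd, wdd, w1, r1, r2, r3, r4]
  set X1 := (rh p + t * R1 p h + t^2 * rh h)^2 - rh p^2 - 2*t*rh p*R1 p h
  set X2 := (Aq p + t * A1 p h + t^2 * Aq h)^2 - Aq p^2 - 2*t*Aq p*A1 p h
  set X3 := (Bq p + t * B1 p h + t^2 * Bq h)^2 - Bq p^2 - 2*t*Bq p*B1 p h
  set X4 := (Zq p + t * Z1 p h + t^2 * Zq h)^2 - Zq p^2 - 2*t*Zq p*Z1 p h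
  set Y := t^2 * (10*(rh p + rh h) * rh h)
  have e : c0/2 * (rh p + t * R1 p h + t^2 * rh h)^2 + c1/2*(2 * (Aq p + t * A1 p h + t^2 * Aq h)^2 + 2 * (Bq p + t * B1 p h + t^2 * Bq h)^2 + (Zq p + t * Z1 p h + t^2 * Zq h)^2)
     - (c0/2 * rh p^2 + c1/2*(2 * Aq p^2 + 2 * Bq p^2 + Zq p^2)) - t * (c0 * (rh p * R1 p h) + c1 * (2 * (Aq p * A1 p h) + 2 * (Bq p * B1 p h) + Zq p * Z1 p h))
     = c0/2*X1 + c1/2*(2*X2+2*X3+X4) := by simp only [X1, X2, X3, X4]; ring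
  rw [e]
  have f1 : |c0/2*X1| ≤ |c0|/2*Y := by
    rw [abs_mul, abs_div, abs_of_pos (two_pos : (0:ℝ) < 2)]; gcongr
  have f2 : |2*X2+2*X3+X4| ≤ 5*Y := by
    rw [abs_le] at *
    constructor <;> linarith [k2.1, k2.2, k3.1, k3.2, k4.1, k4.2]
  have f3 : |c1/2*(2*X2+2*X3+X4)| ≤ |c1|/2*(5*Y) := by
    rw [abs_mul, abs_div, abs_of_pos (two_pos : (0:ℝ) < 2)]; gcongr
  refine (abs_add_le _ _).trans ((add_le_add f1 f3).trans (le_of_eq ?_))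
  simp only [Y]; ring

end

section
open scoped ENNReal NNReal Topology FourierTransform ContDiff SchwartzMap Convolution
open Filter

def Cvg (u : ℕ → Pt 3 → ℂ) (v : Pt 3 → ℂ) : Prop :=
  Tendsto (fun n => eLpNorm (fun x => u n x - v x) 2 volume) atTop (𝓝 0) ∧ ∀ᵐ x, Tendsto (fun n => u n x) atTop (𝓝 (v x))

lemma Cvg.comp {u : ℕ → Pt 3 → ℂ} {v : Pt 3 → ℂ} (h : Cvg u v) {φ : ℕ → ℕ} (hφ : StrictMono φ) : Cvg (fun n => u (φ n)) v :=
  ⟨h.1.comp hφ.tendsto_atTop, h.2.mono fun _ hx => hx.comp hφ.tendsto_atTop⟩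

lemma sub1 (u : ℕ → Pt 3 → ℂ) (A : ℝ≥0) (hm : ∀ n, MemLp (u n) 2) (hA : ∀ n, eLpNorm (u n) 2 volume ≤ A)
    (hK : ∀ n, TL (u n) A) (hx : ∀ n, eLpNorm (fun x => ‖x‖ * ‖u n x‖) 2 volume ≤ A) :
    ∃ φ : ℕ → ℕ, StrictMono φ ∧ ∃ v : Pt 3 → ℂ, MemLp v 2 ∧ Cvg (fun n => u (φ n)) v := by
  obtain ⟨φ, hφ, v, hv, ht⟩ := rellich u A A hm hA hK hx
  have h1 : TendstoInMeasure volume (fun n => u (φ n)) atTop v :=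
    tendstoInMeasure_of_tendsto_eLpNorm (p := 2) (by norm_num) (fun n => (hm _).1) hv.1 ht
  obtain ⟨ψ, hψ, h2⟩ := h1.exists_seq_tendsto_ae
  exact ⟨φ ∘ ψ, hφ.comp hψ, v, hv, ht.comp hψ.tendsto_atTop, h2⟩

lemma TL_lim {u : ℕ → Pt 3 → ℂ} {v : Pt 3 → ℂ} {A : ℝ≥0} (hm : ∀ n, MemLp (u n) 2) (hK : ∀ n, TL (u n) A)
    (h : ∀ᵐ x, Tendsto (fun n => u n x) atTop (𝓝 (v x))) : TL v A := by
  intro y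
  have mp := (measurePreserving_add_right (volume : Measure (Pt 3)) y)
  refine fatou_eLp (f := fun n x => u n (x + y) - u n x) (fun n => ?_) ?_ (fun n => hK n y)
  · exact ((hm n).1.comp_measurePreserving mp).sub (hm n).1
  · have h2 := mp.quasiMeasurePreserving.ae h
    filter_upwards [h, h2] with x a b
    exact b.sub a

lemma L4bd (A : ℝ≥0) : ∃ B : ℝ≥0, ∀ f : Pt 3 → ℂ, MemLp f 2 → eLpNorm f 2 volume ≤ A → TL f A →
    MemLp f 4 ∧ eLpNorm (fun x => ‖f x‖^2) 2 volume ≤ B := by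
  set D : ℝ≥0 := A^2 + (C6 * (3 * A + Lchi * A))^6
  refine ⟨D + 1, fun f h2 hA hT => ?_⟩
  have h6 : eLpNorm f 6 volume ≤ (C6 * (3 * A + Lchi * A) : ℝ≥0) := by
    refine (L6 hT h2).trans ?_
    push_cast; gcongr
  have i2 : ∫⁻ x, ‖f x‖ₑ^2 ≤ (A:ℝ≥0∞)^2 := (eLpNorm_two_le_iff _ _ _).1 hA
  have i6 : ∫⁻ x, ‖f x‖ₑ^6 ≤ ((C6 * (3 * A + Lchi * A) : ℝ≥0):ℝ≥0∞)^6 := by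
    have := eLpNorm_nnreal_pow_eq_lintegral (f := f) (μ := volume) (p := 6) (by norm_num)
    have e : ∫⁻ x, ‖f x‖ₑ^6 = eLpNorm f 6 volume ^ 6 := by
      have := this.symm
      simp only [NNReal.coe_ofNat] at this
      exact_mod_cast this
    rw [e]; gcongr
  have i4 : ∫⁻ x, ‖f x‖ₑ^4 ≤ D := by
    calc ∫⁻ x, ‖f x‖ₑ^4 ≤ ∫⁻ x, (‖f x‖ₑ^2 + ‖f x‖ₑ^6) := by
          refine lintegral_mono fun x => ?_
          rcases le_total ‖f x‖ₑ 1 with h | h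
          · exact le_add_right (pow_le_pow_right_of_le_one' h (by norm_num))
          · exact le_add_left (pow_le_pow_right₀ h (by norm_num))
      _ = (∫⁻ x, ‖f x‖ₑ^2) + ∫⁻ x, ‖f x‖ₑ^6 := lintegral_add_left' (h2.1.enorm.pow_const _) _
      _ ≤ _ := by
        simp only [D]; push_cast at i6 ⊢; exact add_le_add i2 i6
  constructor
  · refine ⟨h2.1, ?_⟩
    have := eLpNorm_nnreal_pow_eq_lintegral (f := f) (μ := volume) (p := 4) (by norm_num)
    have e : eLpNorm f 4 volume ^ 4 = ∫⁻ x, ‖f x‖ₑ^4 := by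
      simp only [NNReal.coe_ofNat] at this
      exact_mod_cast this
    by_contra hh
    rw [not_lt, top_le_iff] at hh
    rw [hh] at e
    rw [← e] at i4
    simp at i4
  · rw [eLpNorm_two_le_iff]
    calc _ = ∫⁻ x, ‖f x‖ₑ^4 := by
          congr 1; ext x; rw [enorm_pow, enorm_norm, ← pow_mul]
      _ ≤ D := i4
      _ ≤ _ := by
        have : D ≤ (D+1)^2 := by nlinarith [zero_le (a := D)]
        exact_mod_cast this

lemma int_conv {F : ℕ → Pt 3 → ℂ} {f g : Pt 3 → ℂ} (hF : ∀ n, MemLp (F n) 2) (hf : MemLp f 2) (hg : MemLp g 2)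
    (h : Tendsto (fun n => eLpNorm (fun x => F n x - f x) 2 volume) atTop (𝓝 0)) :
    Tendsto (fun n => ∫ x, F n x * g x) atTop (𝓝 (∫ x, f x * g x)) := by
  rw [tendsto_iff_edist_tendsto_0]
  refine tendsto_of_tendsto_of_tendsto_of_le_of_le tendsto_const_nhds
    (h := fun n => eLpNorm (fun x => F n x - f x) 2 volume * eLpNorm g 2 volume) ?_ (fun n => zero_le) fun n => ?_
  · simpa using ENNReal.Tendsto.mul_const h (Or.inr hg.2.ne)
  · have := hol ((hF n).sub hf).1 hg.1
    refine le_trans (le_of_eq ?_) this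
    have e := integral_sub ((hF n).integrable_mul hg) (hf.integrable_mul hg)
    simp only [Pi.mul_apply] at e
    rw [edist_eq_enorm_sub, ← e]
    congr 2; ext x; simp; ring

lemma conj_conv {F : ℕ → Pt 3 → ℂ} {f : Pt 3 → ℂ}
    (h : Tendsto (fun n => eLpNorm (fun x => F n x - f x) 2 volume) atTop (𝓝 0)) :
    Tendsto (fun n => eLpNorm (fun x => (starRingEnd ℂ) (F n x) - (starRingEnd ℂ) (f x)) 2 volume) atTop (𝓝 0) := by
  refine h.congr fun n => ?_
  refine eLpNorm_congr_norm_ae (.of_forall fun x => ?_)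
  rw [← map_sub, RCLike.norm_conj]

lemma norm_conv {F : ℕ → Pt 3 → ℂ} {f : Pt 3 → ℂ} (hF : ∀ n, MemLp (F n) 2) (hf : MemLp f 2)
    (h : Tendsto (fun n => eLpNorm (fun x => F n x - f x) 2 volume) atTop (𝓝 0)) :
    Tendsto (fun n => ∫ x, ‖F n x‖^2) atTop (𝓝 (∫ x, ‖f x‖^2)) := by
  have key : ∀ f : Pt 3 → ℂ, MemLp f 2 → ∫ x, ‖f x‖^2 = (eLpNorm f 2 volume).toReal^2 := by
    intro f hf
    rw [← ENNReal.toReal_pow, eLpNorm_two_sq, integral_eq_lintegral_of_nonneg_ae (.of_forall fun x => sq_nonneg _) (hf.1.norm.pow 2)]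
    congr 2; ext x
    rw [ENNReal.ofReal_pow (norm_nonneg _), ofReal_norm]
  simp only [key _ hf, fun n => key _ (hF n)]
  refine Tendsto.pow ?_ 2
  refine (ENNReal.tendsto_toReal hf.2.ne).comp ?_
  have hd : ∀ n, MemLp (fun x => F n x - f x) 2 := fun n => (hF n).sub hf
  refine tendsto_of_tendsto_of_tendsto_of_le_of_le (g := fun n => eLpNorm f 2 volume - eLpNorm (fun x => F n x - f x) 2 volume)
    (h := fun n => eLpNorm f 2 volume + eLpNorm (fun x => F n x - f x) 2 volume) ?_ ?_ (fun n => ?_) fun n => ?_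
  · simpa using ENNReal.Tendsto.sub (tendsto_const_nhds (x := eLpNorm f 2 volume)) h (Or.inl hf.2.ne)
  · simpa using (tendsto_const_nhds (x := eLpNorm f 2 volume)).add h
  · rw [tsub_le_iff_right]
    have := eLpNorm_sub_le (p := 2) (hF n).1 (hd n).1 (by norm_num)
    refine le_trans (le_of_eq ?_) this
    congr 1; ext x; simp
  · have := eLpNorm_add_le (p := 2) hf.1 (hd n).1 (by norm_num)
    refine le_trans (le_of_eq ?_) this
    congr 1; ext x; simp

/-- the convergence package -/
structure Pack (Ω γ : ℝ) (g : Fin 3 → ℝ) (c0 c1 m q : ℝ) (A : ℝ≥0) (Φ : ℕ → Tri) (U : Tri) : Prop where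
  lb : ∀ Ψ, Good Ψ → mass Ψ = 1 → m ≤ QQ Ω γ g 0 Ψ + WW c0 c1 Ψ
  good : ∀ n, Good (Φ n)
  mass1 : ∀ n, mass (Φ n) = 1
  hq : Tendsto (fun n => QQ Ω γ g 0 (Φ n)) atTop (𝓝 q)
  hw : Tendsto (fun n => WW c0 c1 (Φ n)) atTop (𝓝 (m - q))
  b2 : ∀ n k, eLpNorm (Φ n k) 2 volume ≤ A
  bT : ∀ n k, TL (Φ n k) A
  bx : ∀ n k, eLpNorm (fun x => ‖x‖ * ‖Φ n k x‖) 2 volume ≤ A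
  bd : ∀ n k j, eLpNorm (pd (Φ n k) j) 2 volume ≤ A
  u2 : ∀ k, MemLp (U k) 2
  uT : ∀ k, TL (U k) A
  ux : ∀ k, eLpNorm (fun x => ‖x‖ * ‖U k x‖) 2 volume ≤ A
  ub : ∀ k, eLpNorm (U k) 2 volume ≤ A
  um : mass U = 1
  sub : ∀ k, Cvg (fun n => Φ n k) (U k)

lemma pack_exists {Ω γ a b e c0 c1 : ℝ} (ha : 0 < a) (hb : 0 < b) (he : 0 < e) (hΩ : |Ω| < min a b)
    (hc : (0 ≤ c0 ∧ 0 ≤ c1) ∨ (c1 ≤ 0 ∧ 0 ≤ c0 + c1)) :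
    ∃ m q A Φ U, Pack Ω γ (gam a b e) c0 c1 m q A Φ U := by
  obtain ⟨m, Φ, A, lb, hg, hm, hlim, hq, hbd⟩ := min_seq (γ := γ) ha hb he hΩ hc
  obtain ⟨φ0, f0, v0, hv0, s0⟩ := sub1 (fun n => Φ n 0) A (fun n => (hg n).m2 0) (fun n => (hbd n 0).1) (fun n => (hbd n 0).2.1) (fun n => (hbd n 0).2.2.1)
  obtain ⟨φ1, f1, v1, hv1, s1⟩ := sub1 (fun n => Φ (φ0 n) 1) A (fun n => (hg _).m2 1) (fun n => (hbd _ 1).1) (fun n => (hbd _ 1).2.1) (fun n => (hbd _ 1).2.2.1)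
  obtain ⟨φ2, f2, v2, hv2, s2⟩ := sub1 (fun n => Φ (φ0 (φ1 n)) 2) A (fun n => (hg _).m2 2) (fun n => (hbd _ 2).1) (fun n => (hbd _ 2).2.1) (fun n => (hbd _ 2).2.2.1)
  obtain ⟨q, -, φ3, f3, s3⟩ := (isCompact_Icc (a := -(A:ℝ)) (b := A)).tendsto_subseq (x := fun n => QQ Ω γ (gam a b e) 0 (Φ (φ0 (φ1 (φ2 n)))))
    (fun n => abs_le.1 (hq _))
  set σ : ℕ → ℕ := fun n => φ0 (φ1 (φ2 (φ3 n)))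
  have hσ : StrictMono σ := f0.comp (f1.comp (f2.comp f3))
  set U : Tri := ![v0, v1, v2]
  have hu2 : ∀ k, MemLp (U k) 2 := by intro k; fin_cases k; exacts [hv0, hv1, hv2]
  have hsub : ∀ k, Cvg (fun n => Φ (σ n) k) (U k) := by
    intro k; fin_cases k
    exacts [s0.comp (f1.comp (f2.comp f3)), s1.comp (f2.comp f3), s2.comp f3]
  refine ⟨m, q, A, fun n => Φ (σ n), U, lb, fun n => hg _, fun n => hm _, s3, ?_, fun n k => (hbd _ k).1, fun n k => (hbd _ k).2.1,
    fun n k => (hbd _ k).2.2.1, fun n k => (hbd _ k).2.2.2, hu2, ?_, ?_, ?_, ?_, hsub⟩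
  · have := (hlim.comp hσ.tendsto_atTop).sub s3
    refine this.congr fun n => ?_
    simp [σ]
  · exact fun k => TL_lim (fun n => (hg _).m2 k) (fun n => (hbd (σ n) k).2.1) (hsub k).2
  · refine fun k => fatou_eLp (f := fun n x => ‖x‖ * ‖Φ (σ n) k x‖) (fun n => ?_) ?_ fun n => (hbd (σ n) k).2.2.1
    · exact continuous_norm.aestronglyMeasurable.mul ((hg _).m2 k).1.norm
    · exact (hsub k).2.mono fun x hx => hx.norm.const_mul _
  · exact fun k => fatou_eLp (fun n => ((hg _).m2 k).1) (hsub k).2 fun n => (hbd (σ n) k).1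
  · have e : ∀ Ψ : Tri, (∀ k, MemLp (Ψ k) 2) → mass Ψ = ∑ k, ∫ x, ‖Ψ k x‖^2 := fun Ψ h => by
      unfold mass rh
      exact integral_finsetSum _ fun k _ => (memLp_two_iff_integrable_sq_norm (h k).1).1 (h k)
    have h1 : Tendsto (fun n => mass (Φ (σ n))) atTop (𝓝 (mass U)) := by
      simp only [e _ hu2, fun n => e _ (hg (σ n)).m2]
      exact tendsto_finsetSum _ fun k _ => norm_conv (fun n => (hg _).m2 k) (hu2 k) (hsub k).1
    simp only [hm] at h1
    exact tendsto_nhds_unique h1 tendsto_const_nhds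

end

section
open scoped ENNReal NNReal Topology FourierTransform ContDiff SchwartzMap Convolution
open Filter

lemma TL.conj {u : Pt 3 → ℂ} {K : ℝ≥0} (h : TL u K) : TL (fun x => (starRingEnd ℂ) (u x)) K := by
  intro y
  refine le_trans (le_of_eq ?_) (h y)
  refine eLpNorm_congr_norm_ae (.of_forall fun x => ?_)
  rw [← map_sub, RCLike.norm_conj]

lemma om_conv {n : V3 → ℂ} {C B : ℝ≥0}
    (hn : ∀ p q, ‖n p - n q‖ ≤ C * (∑ k, ‖p k‖ + ∑ k, ‖q k‖) ^ 2 * ∑ k, ‖p k - q k‖)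
    {F : ℕ → Tri} {U : Tri} (hF : ∀ n k, MemLp (F n k) 2) (hU : ∀ k, MemLp (U k) 2)
    (bF : ∀ n k, eLpNorm (fun x => ‖F n k x‖^2) 2 volume ≤ B) (bU : ∀ k, eLpNorm (fun x => ‖U k x‖^2) 2 volume ≤ B)
    (hc : ∀ k, Tendsto (fun n => eLpNorm (fun x => F n k x - U k x) 2 volume) atTop (𝓝 0))
    {η : Pt 3 → ℂ} (hη : CC η) (iF : ∀ i, Integrable (fun x => n (fun k => F i k x) * η x)) (iU : Integrable (fun x => n (fun k => U k x) * η x)) :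
    Tendsto (fun i => ∫ x, n (fun k => F i k x) * η x) atTop (𝓝 (∫ x, n (fun k => U k x) * η x)) := by
  obtain ⟨M, hM⟩ := hη.1.continuous.bounded_above_of_compact_support hη.2
  have hM0 : 0 ≤ M := (norm_nonneg _).trans (hM 0)
  set c : ℝ := C * 6 * M
  have mF : ∀ i k, AEStronglyMeasurable (fun x => ‖F i k x‖^2) volume := fun i k => (hF i k).1.norm.pow 2
  have mU : ∀ k, AEStronglyMeasurable (fun x => ‖U k x‖^2) volume := fun k => (hU k).1.norm.pow 2
  set G1 : ℕ → Pt 3 → ℝ := fun i x => ∑ k, ‖F i k x‖^2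
  set G2 : Pt 3 → ℝ := fun x => ∑ k, ‖U k x‖^2
  set d : ℕ → Pt 3 → ℝ := fun i x => ∑ k, ‖F i k x - U k x‖
  have mG1 : ∀ i, AEStronglyMeasurable (G1 i) volume := fun i => Finset.aestronglyMeasurable_fun_sum _ fun k _ => mF i k
  have mG2 : AEStronglyMeasurable G2 volume := Finset.aestronglyMeasurable_fun_sum _ fun k _ => mU k
  have md : ∀ i, AEStronglyMeasurable (d i) volume := fun i => Finset.aestronglyMeasurable_fun_sum _ fun k _ => ((hF i k).sub (hU k)).1.norm
  have bG1 : ∀ i, eLpNorm (G1 i) 2 volume ≤ 3 * B := fun i => by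
    have := eLpNorm_sum_le (p := 2) (μ := volume) (s := Finset.univ) (f := fun k x => ‖F i k x‖^2) (fun k _ => mF i k) (by norm_num)
    have e : (∑ k, fun x => ‖F i k x‖^2) = G1 i := by ext x; simp [G1]
    rw [e] at this
    refine this.trans ((Finset.sum_le_sum fun k _ => bF i k).trans (by simp))
  have bG2 : eLpNorm G2 2 volume ≤ 3 * B := by
    have := eLpNorm_sum_le (p := 2) (μ := volume) (s := Finset.univ) (f := fun k x => ‖U k x‖^2) (fun k _ => mU k) (by norm_num)
    have e : (∑ k, fun x => ‖U k x‖^2) = G2 := by ext x; simp [G2]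
    rw [e] at this
    refine this.trans ((Finset.sum_le_sum fun k _ => bU k).trans (by simp))
  have bd : ∀ i, eLpNorm (d i) 2 volume ≤ ∑ k, eLpNorm (fun x => F i k x - U k x) 2 volume := fun i => by
    have := eLpNorm_sum_le (p := 2) (μ := volume) (s := Finset.univ) (f := fun k x => ‖F i k x - U k x‖) (fun k _ => ((hF i k).sub (hU k)).1.norm) (by norm_num)
    have e : (∑ k, fun x => ‖F i k x - U k x‖) = d i := by ext x; simp [d]
    rw [e] at this
    refine this.trans (Finset.sum_le_sum fun k _ => ?_)
    exact (eLpNorm_norm (fun x => F i k x - U k x)).le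
  have bG : ∀ i, eLpNorm (fun x => c * (G1 i x + G2 x)) 2 volume ≤ ‖c‖ₑ * (3 * B + 3 * B) := fun i => by
    have e : (fun x => c * (G1 i x + G2 x)) = c • (G1 i + G2) := by ext x; simp
    rw [e, eLpNorm_const_smul]
    gcongr
    exact (eLpNorm_add_le (mG1 i) mG2 (by norm_num)).trans (add_le_add (bG1 i) bG2)
  rw [tendsto_iff_edist_tendsto_0]
  refine tendsto_of_tendsto_of_tendsto_of_le_of_le tendsto_const_nhds
    (h := fun i => ‖c‖ₑ * (3 * B + 3 * B) * ∑ k, eLpNorm (fun x => F i k x - U k x) 2 volume) ?_ (fun n => zero_le) fun i => ?_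
  · have h0 := tendsto_finsetSum Finset.univ fun k _ => hc k
    have := ENNReal.Tendsto.const_mul (a := ‖c‖ₑ * (3 * (B:ℝ≥0∞) + 3 * B)) h0 (Or.inr (by finiteness))
    simpa using this
  · show edist _ _ ≤ _
    rw [edist_eq_enorm_sub, ← integral_sub (iF i) iU]
    refine (enorm_integral_le_lintegral_enorm _).trans ?_
    calc ∫⁻ x, ‖n (fun k => F i k x) * η x - n (fun k => U k x) * η x‖ₑ 
        ≤ ∫⁻ x, ‖((fun x => c * (G1 i x + G2 x)) • d i) x‖ₑ := by
          refine lintegral_mono fun x => ?_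
          rw [← ofReal_norm, ← ofReal_norm]
          refine ENNReal.ofReal_le_ofReal ?_
          have dn : 0 ≤ d i x := Finset.sum_nonneg fun _ _ => norm_nonneg _
          have g1 : (∑ k, ‖F i k x‖)^2 ≤ 3 * G1 i x := by
            simpa using sq_sum_le_card_mul_sum_sq (s := Finset.univ) (f := fun k => ‖F i k x‖)
          have g2 : (∑ k, ‖U k x‖)^2 ≤ 3 * G2 x := by
            simpa using sq_sum_le_card_mul_sum_sq (s := Finset.univ) (f := fun k => ‖U k x‖)
          have gn : 0 ≤ G1 i x + G2 x := by nlinarith [sq_nonneg (∑ k, ‖F i k x‖), sq_nonneg (∑ k, ‖U k x‖)]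
          have e : ‖((fun x => c * (G1 i x + G2 x)) • d i) x‖ = c * (G1 i x + G2 x) * d i x := by
            simp only [Pi.smul_apply', smul_eq_mul]
            exact Real.norm_of_nonneg (by positivity)
          rw [e, ← sub_mul, norm_mul]
          calc _ ≤ (C * (∑ k, ‖F i k x‖ + ∑ k, ‖U k x‖) ^ 2 * d i x) * M := by
                gcongr
                · exact hn _ _
                · exact hM x
            _ ≤ (C * (6 * (G1 i x + G2 x)) * d i x) * M := by
                gcongr
                nlinarith [sq_nonneg (∑ k, ‖F i k x‖ - ∑ k, ‖U k x‖)]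
            _ = _ := by simp only [c]; ring
      _ = eLpNorm ((fun x => c * (G1 i x + G2 x)) • d i) 1 volume := eLpNorm_one_eq_lintegral_enorm.symm
      _ ≤ eLpNorm (fun x => c * (G1 i x + G2 x)) 2 volume * eLpNorm (d i) 2 volume := 
        eLpNorm_smul_le_mul_eLpNorm (p := 2) (q := 2) (r := 1) (md i) (((mG1 i).add mG2).const_mul c)
      _ ≤ _ := mul_le_mul' (bG i) (bd i)

def sg (Φ η : Tri) : ℂ := ∑ k, ∫ x, (starRingEnd ℂ) (Φ k x) * η k x
def om (c0 c1 : ℝ) (Φ η : Tri) : ℂ := ∑ k, ∫ x, nn c0 c1 k (fun k => (starRingEnd ℂ) (Φ k x)) * η k x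
def BB (Ω γ : ℝ) (g : Fin 3 → ℝ) (Φ η : Tri) : ℂ := ∑ k, ∫ x, (starRingEnd ℂ) (Φ k x) * TT Ω γ g 0 η k x

lemma int_quad {a b c : Pt 3 → ℝ} (ha : Integrable a) (hb : Integrable b) (hc : Integrable c) (s t : ℝ) :
    ∫ x, (a x + s * b x + t * c x) = (∫ x, a x) + s * (∫ x, b x) + t * ∫ x, c x := by
  have h1 : Integrable (fun x => a x + s * b x) := ha.add (hb.const_mul s)
  rw [← integral_const_mul, ← integral_const_mul, ← integral_add ha (hb.const_mul _), ← integral_add h1 (hc.const_mul _)]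

lemma mass_expand {Φ η : Tri} (h : ∀ k, MemLp (Φ k) 2) (h' : ∀ k, MemLp (η k) 2) (t : ℝ) :
    mass (fun k x => Φ k x + (t:ℂ) * η k x) = mass Φ + t * (2 * (sg Φ η).re) + t^2 * mass η := by
  have i : ∀ k, Integrable (fun x => (starRingEnd ℂ) (Φ k x) * η k x) := fun k => int_conj (h k) (h' k)
  have iS : Integrable (fun x => ∑ k, (starRingEnd ℂ) (Φ k x) * η k x) := integrable_finsetSum _ fun k _ => i k
  have e : 2 * (sg Φ η).re = ∫ x, R1 (fun k => Φ k x) (fun k => η k x) := by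
    unfold sg R1
    rw [← integral_finsetSum _ fun k _ => i k, integral_const_mul]
    congr 1
    exact (integral_re iS).symm
  have iR : Integrable (fun x => R1 (fun k => Φ k x) (fun k => η k x)) := iS.re.const_mul 2
  rw [e]
  unfold mass
  rw [← int_quad (rh_int h) iR (rh_int h')]
  congr 1; ext x
  exact (polar _ _ t).1

lemma QQ_expand {Φ η : Tri} (h : Good Φ) (h' : Good η) (Ω γ : ℝ) (g : Fin 3 → ℝ) (C t : ℝ) :
    QQ Ω γ g C (fun k x => Φ k x + (t:ℂ) * η k x) = QQ Ω γ g C Φ + t * (∫ x, (be Ω γ (pot g C) Φ η x + be Ω γ (pot g C) η Φ x)) + t^2 * QQ Ω γ g C η := by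
  unfold QQ
  have i1 := be_int h h Ω γ g C
  have i2 : Integrable (fun x => be Ω γ (pot g C) Φ η x + be Ω γ (pot g C) η Φ x) := (be_int h h' Ω γ g C).add (be_int h' h Ω γ g C)
  have i3 := be_int h' h' Ω γ g C
  rw [← int_quad i1 i2 i3]
  congr 1; ext x
  exact be_expand h h' Ω γ _ t x

lemma nn_int {Φ η : Tri} (h : ∀ k, H1 (Φ k)) (hη : ∀ k, CC (η k)) (c0 c1 : ℝ) (k) :
    Integrable (fun x => nn c0 c1 k (fun k => (starRingEnd ℂ) (Φ k x)) * η k x) := by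
  obtain ⟨C, hC⟩ := nn_lip' c0 c1
  have := n_mem2 (u := fun k x => (starRingEnd ℂ) (Φ k x)) (nn_cont c0 c1) (nn_zero c0 c1) hC (fun k => ⟨(h k).1.star, (h k).2.choose, (h k).2.choose_spec.conj⟩) k
  exact this.integrable_mul ((hη k).memLp 2)

lemma WW_expand (c0 c1 : ℝ) {η : Tri} (hη : ∀ k, CC (η k)) : ∃ K : ℝ, ∀ Φ : Tri, Good Φ → (∀ k, H1 (Φ k)) → mass Φ = 1 → ∀ t : ℝ, |t| ≤ 1 →
    WW c0 c1 (fun k x => Φ k x + (t:ℂ) * η k x) ≤ WW c0 c1 Φ + t * (om c0 c1 Φ η).re + t^2 * K := by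
  have hb : ∃ M : ℝ, ∀ x, rh (fun k => η k x) ≤ M := by
    choose M hM using fun k => (hη k).1.continuous.bounded_above_of_compact_support (hη k).2
    refine ⟨∑ k, M k ^ 2, fun x => Finset.sum_le_sum fun k _ => ?_⟩
    exact pow_le_pow_left₀ (norm_nonneg _) (hM k x) 2
  obtain ⟨M, hM⟩ := hb
  set K0 := 5*|c0| + 25*|c1|
  have hK0 : 0 ≤ K0 := by positivity
  refine ⟨K0 * M * (1 + mass η), fun Φ hg hH hm t ht => ?_⟩
  have gη := good_CC hη
  have i1 := wd_int (hg.add (gη.cmul t)).m4 c0 c1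
  have i2 := wd_int hg.m4 c0 c1
  have i3 : Integrable (fun x => ∑ k, nn c0 c1 k (fun k => (starRingEnd ℂ) (Φ k x)) * η k x) := integrable_finsetSum _ fun k _ => nn_int hH hη c0 c1 k
  have i4 : Integrable (fun x => rh (fun k => Φ k x) + rh (fun k => η k x)) := (rh_int hg.m2).add (rh_int gη.m2)
  have e3 : (om c0 c1 Φ η).re = ∫ x, (∑ k, nn c0 c1 k (fun k => (starRingEnd ℂ) (Φ k x)) * η k x).re := by
    unfold om
    rw [← integral_finsetSum _ fun k _ => nn_int hH hη c0 c1 k]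
    exact (integral_re i3).symm
  have e4 : 1 + mass η = ∫ x, (rh (fun k => Φ k x) + rh (fun k => η k x)) := by
    rw [integral_add (rh_int hg.m2) (rh_int gη.m2), ← hm]; rfl
  rw [e3, e4]
  unfold WW
  have i3' : Integrable (fun x => (∑ k, nn c0 c1 k (fun k => (starRingEnd ℂ) (Φ k x)) * η k x).re) := i3.re
  have i5 : Integrable (fun x => wd c0 c1 (fun k => Φ k x) + t * (∑ k, nn c0 c1 k (fun k => (starRingEnd ℂ) (Φ k x)) * η k x).re) := i2.add (i3'.const_mul t)
  rw [← mul_assoc, ← integral_const_mul, ← integral_const_mul, ← integral_add i2 (i3'.const_mul t), ← integral_add i5 (i4.const_mul _)]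
  refine integral_mono i1 (i5.add (i4.const_mul _)) fun x => ?_
  have := (abs_le.1 (wd_rem c0 c1 (fun k => Φ k x) (fun k => η k x) t ht)).2
  have h2 : t^2 * (K0 * ((rh (fun k => Φ k x) + rh (fun k => η k x)) * rh (fun k => η k x))) ≤ t^2 * (K0 * M) * (rh (fun k => Φ k x) + rh (fun k => η k x)) := by
    have a := rh_nonneg (fun k => Φ k x); have b := rh_nonneg (fun k => η k x)
    calc _ ≤ t^2 * (K0 * ((rh (fun k => Φ k x) + rh (fun k => η k x)) * M)) := by gcongr; exact hM x
      _ = _ := by ring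
  simp only
  linarith

lemma poly_zero {σ s q B Q m w K : ℝ}
    (h : ∀ t : ℝ, |t| ≤ 1 → 0 ≤ (1 + t*σ + t^2*s) * (q + t*B + t^2*Q) + ((m - q) + t*w + t^2*K) - m * (1 + t*σ + t^2*s)^2) :
    σ * q + B + w - 2*m*σ = 0 := by
  have d : ∀ a b c : ℝ, HasDerivAt (fun t : ℝ => a + t*b + t^2*c) b 0 := by
    intro a b c
    have := (((hasDerivAt_id (0:ℝ)).mul_const b).const_add a).add (((hasDerivAt_id (0:ℝ)).pow 2).mul_const c)
    simp at this
    exact this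
  have D := (((d 1 σ s).mul (d q B Q)).add (d (m-q) w K)).sub (((d 1 σ s).pow 2).const_mul m)
  have L : IsLocalMin (((fun t : ℝ => 1 + t*σ + t^2*s) * (fun t : ℝ => q + t*B + t^2*Q) + fun t => (m - q) + t*w + t^2*K) - fun t => m * ((fun t => 1 + t*σ + t^2*s)^2) t) 0 := by
    have : ∀ᶠ t : ℝ in 𝓝 0, |t| ≤ 1 := by
      filter_upwards [Metric.closedBall_mem_nhds (0:ℝ) one_pos] with t ht
      simpa [Real.dist_eq] using ht
    filter_upwards [this] with t ht
    have := h t ht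
    simp
    linarith
  have := L.hasDerivAt_eq_zero D
  simp at this
  linarith

end

section
open scoped ENNReal NNReal Topology FourierTransform ContDiff SchwartzMap Convolution
open Filter

section
variable {Ω γ : ℝ} {g : Fin 3 → ℝ} {c0 c1 m q : ℝ} {A : ℝ≥0} {Φ : ℕ → Tri} {U : Tri}

lemma Pack.H (P : Pack Ω γ g c0 c1 m q A Φ U) (n k) : H1 (Φ n k) := ⟨(P.good n).m2 k, A, P.bT n k⟩
lemma Pack.HU (P : Pack Ω γ g c0 c1 m q A Φ U) (k) : H1 (U k) := ⟨P.u2 k, A, P.uT k⟩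

lemma Pack.sg_lim (P : Pack Ω γ g c0 c1 m q A Φ U) {ψ : Tri} (hψ : ∀ k, MemLp (ψ k) 2) :
    Tendsto (fun n => sg (Φ n) ψ) atTop (𝓝 (sg U ψ)) :=
  tendsto_finsetSum _ fun k _ => int_conv (fun n => ((P.good n).m2 k).star) (P.u2 k).star (hψ k) (conj_conv (P.sub k).1)

lemma Pack.om_lim (P : Pack Ω γ g c0 c1 m q A Φ U) {η : Tri} (hη : ∀ k, CC (η k)) :
    Tendsto (fun n => om c0 c1 (Φ n) η) atTop (𝓝 (om c0 c1 U η)) := by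
  obtain ⟨C, hC⟩ := nn_lip' c0 c1
  obtain ⟨B, hB⟩ := L4bd A
  refine tendsto_finsetSum _ fun k _ => ?_
  refine om_conv (C := C) (B := B) (F := fun n k x => (starRingEnd ℂ) (Φ n k x)) (U := fun k x => (starRingEnd ℂ) (U k x)) (hC k) (fun n k => ((P.good n).m2 k).star) (fun k => (P.u2 k).star) ?_ ?_
    (fun k => conj_conv (P.sub k).1) (hη k) (fun n => nn_int (P.H n) hη c0 c1 k) (nn_int P.HU hη c0 c1 k)
  · intro n k
    have := (hB _ ((P.good n).m2 k) (P.b2 n k) (P.bT n k)).2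
    simpa only [RCLike.norm_conj] using this
  · intro k
    have := (hB _ (P.u2 k) (P.ub k) (P.uT k)).2
    simpa only [RCLike.norm_conj] using this

lemma Pack.EL_re (P : Pack Ω γ g c0 c1 m q A Φ U) (hc : (0 ≤ c0 ∧ 0 ≤ c1) ∨ (c1 ≤ 0 ∧ 0 ≤ c0 + c1)) {η : Tri} (hη : ∀ k, CC (η k)) :
    2 * (sg U η).re * q + (BB Ω γ g U η).re + (om c0 c1 U η).re - 2 * m * (2 * (sg U η).re) = 0 := by
  have gη := good_CC hη
  obtain ⟨K, hK⟩ := WW_expand c0 c1 hη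
  refine poly_zero (s := mass η) (Q := QQ Ω γ g 0 η) (K := K) fun t ht => ?_
  have h1 : ∀ n, 0 ≤ (1 + t * (2 * (sg (Φ n) η).re) + t^2 * mass η) * (QQ Ω γ g 0 (Φ n) + t * (BB Ω γ g (Φ n) η).re + t^2 * QQ Ω γ g 0 η)
      + (WW c0 c1 (Φ n) + t * (om c0 c1 (Φ n) η).re + t^2 * K) - m * (1 + t * (2 * (sg (Φ n) η).re) + t^2 * mass η)^2 := by
    intro n
    have h := scaled hc P.lb ((P.good n).add (gη.cmul t))
    have h2 := hK (Φ n) (P.good n) (P.H n) (P.mass1 n) t ht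
    rw [mass_expand (P.good n).m2 gη.m2, QQ_expand (P.good n) gη, P.mass1 n, B_eq (P.good n) hη] at h
    unfold BB
    linarith
  have re : ∀ {f : ℕ → ℂ} {z : ℂ}, Tendsto f atTop (𝓝 z) → Tendsto (fun n => (f n).re) atTop (𝓝 z.re) := fun h => (Complex.continuous_re.tendsto _).comp h
  have ts := re (P.sg_lim gη.m2)
  have tB : Tendsto (fun n => (BB Ω γ g (Φ n) η).re) atTop (𝓝 (BB Ω γ g U η).re) := re (P.sg_lim (ψ := TT Ω γ g 0 η) fun k => (TT_CC Ω γ g 0 hη k).memLp 2)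
  have tO := re (P.om_lim hη)
  have tm : Tendsto (fun n => 1 + t * (2 * (sg (Φ n) η).re) + t^2 * mass η) atTop (𝓝 (1 + t * (2 * (sg U η).re) + t^2 * mass η)) :=
    (((ts.const_mul 2).const_mul t).const_add 1).add_const _
  refine ge_of_tendsto' (((tm.mul ((P.hq.add (tB.const_mul t)).add_const _)).add ((P.hw.add (tO.const_mul t)).add_const _)).sub ((tm.pow 2).const_mul m)) h1

lemma Lap_cmul {f : Pt 3 → ℂ} (hf : CC f) (c : ℂ) (x) : Lap (fun x => c * f x) x = c * Lap f x := by
  unfold Lap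
  rw [Finset.mul_sum]
  refine Finset.sum_congr rfl fun j _ => ?_
  have : pd (fun x => c * f x) j = fun x => c * pd f j x := by
    ext x; exact pd_const_mul (hf.1.differentiable (by simp) x) c j
  rw [this, pd_const_mul ((hf.pd j).1.differentiable (by simp) x)]

lemma TT_cmul {η : Tri} (hη : ∀ k, CC (η k)) (c : ℂ) (k x) :
    TT Ω γ g 0 (fun k x => c * η k x) k x = c * TT Ω γ g 0 η k x := by
  unfold TT
  have : ∀ l j, pd (fun x => c * η l x) j x = c * pd (η l) j x := fun l j => pd_const_mul ((hη l).1.differentiable (by simp) x) c j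
  simp only [this, Lap_cmul (hη k)]
  simp only [Finset.mul_sum, mul_add]
  congr 1; congr 1
  · ring
  · ring
  · exact Finset.sum_congr rfl fun _ _ => Finset.sum_congr rfl fun _ _ => by ring

lemma Pack.EL (P : Pack Ω γ g c0 c1 m q A Φ U) (hc : (0 ≤ c0 ∧ 0 ≤ c1) ∨ (c1 ≤ 0 ∧ 0 ≤ c0 + c1)) {η : Tri} (hη : ∀ k, CC (η k)) :
    BB Ω γ g U η + om c0 c1 U η + (2*q - 4*m : ℝ) * sg U η = 0 := by
  have h1 := P.EL_re hc hη
  have h2 := P.EL_re hc (η := fun k x => I * η k x) fun k => (hη k).cmul I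
  have es : sg U (fun k x => I * η k x) = I * sg U η := by
    simp only [sg, Finset.mul_sum, ← integral_const_mul]
    exact Finset.sum_congr rfl fun k _ => by congr 1; ext x; ring
  have eo : om c0 c1 U (fun k x => I * η k x) = I * om c0 c1 U η := by
    simp only [om, Finset.mul_sum, ← integral_const_mul]
    exact Finset.sum_congr rfl fun k _ => by congr 1; ext x; ring
  have eB : BB Ω γ g U (fun k x => I * η k x) = I * BB Ω γ g U η := by
    simp only [BB, Finset.mul_sum, ← integral_const_mul, TT_cmul hη]
    exact Finset.sum_congr rfl fun k _ => by congr 1; ext x; ring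
  rw [es, eo, eB] at h2
  simp only [I_mul_re] at h2
  apply Complex.ext
  · simp only [add_re, re_ofReal_mul, zero_re]; linarith
  · simp only [add_im, im_ofReal_mul, zero_im]; linarith

lemma pd_zero (j x) : pd (fun _ => 0) j x = 0 := by simp [pd]
lemma pd_zero' (j x) : pd 0 j x = 0 := by simp [pd]

lemma Pack.C1 (P : Pack Ω γ g c0 c1 m q A Φ U) (hc : (0 ≤ c0 ∧ 0 ≤ c1) ∨ (c1 ≤ 0 ∧ 0 ≤ c0 + c1)) (l) :
    ∃ v : Pt 3 → ℂ, ContDiff ℝ 1 v ∧ U l =ᵐ[volume] v := by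
  obtain ⟨C, hC⟩ := nn_lip' c0 c1
  set u : Tri := fun k x => (starRingEnd ℂ) (U k x)
  have hu : ∀ k, H1 (u k) := fun k => ⟨(P.u2 k).star, A, (P.uT k).conj⟩
  have hw : ∀ l ζ, CC ζ → ∫ x, u l x * Lap ζ x = (∑ j, ∫ x, (∑ k, (2 * Ac Ω γ k l j x) * u k x) * pd ζ j x)
      + ∫ x, ((∑ k, (if l = k then 2 * (pot g 0 x : ℂ) + (2*q - 4*m : ℝ) else 0) * u k x) + nn c0 c1 l (fun k => u k x)) * ζ x := by
    intro l ζ hζ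
    set η : Tri := fun k x => if k = l then ζ x else 0
    have hη : ∀ k, CC (η k) := by
      intro k
      by_cases h : k = l
      · simpa [η, h] using hζ
      · simpa [η, h] using CC.zero
    have EL := P.EL hc hη
    have eη : ∀ k, k ≠ l → η k = fun _ => 0 := fun k h => by ext x; simp [η, h]
    have eηl : η l = ζ := by ext x; simp [η]
    have es : sg U η = ∫ x, u l x * ζ x := by
      unfold sg
      rw [Finset.sum_eq_single l (fun k _ h => by simp [eη k h]) (by simp), eηl]
    have eo : om c0 c1 U η = ∫ x, nn c0 c1 l (fun k => u k x) * ζ x := by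
      unfold om
      rw [Finset.sum_eq_single l (fun k _ h => by simp [eη k h]) (by simp), eηl]
    have i0 : ∀ {f : Pt 3 → ℂ} k, CC f → Integrable (fun x => u k x * f x) := fun k hf => (hu k).1.integrable_mul (hf.memLp 2)
    have iA : ∀ k j, Integrable (fun x => u k x * (2 * Ac Ω γ k l j x * pd ζ j x)) := fun k j => i0 k ((hζ.pd j).smul (contDiff_const.mul (Ac_smooth Ω γ k l j)))
    have iL : Integrable (fun x => u l x * Lap ζ x) := i0 l hζ.Lap
    have iP : Integrable (fun x => u l x * (2 * (pot g 0 x:ℂ) * ζ x)) := i0 l (hζ.smul (contDiff_const.mul (pot_smooth g 0)))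
    have iN : Integrable (fun x => nn c0 c1 l (fun k => u k x) * ζ x) := by simpa [eηl] using nn_int P.HU hη c0 c1 l
    have iAA : ∀ k, Integrable (fun x => ∑ j, u k x * (2 * Ac Ω γ k l j x * pd ζ j x)) := fun k => integrable_finsetSum _ fun j _ => iA k j
    have eT : ∀ k x, u k x * TT Ω γ g 0 η k x = (if k = l then u l x * (2 * (pot g 0 x:ℂ) * ζ x) - u l x * Lap ζ x else 0) + ∑ j, u k x * (2 * Ac Ω γ k l j x * pd ζ j x) := by
      intro k x
      have : ∑ l', ∑ j, Ac Ω γ k l' j x * pd (η l') j x = ∑ j, Ac Ω γ k l j x * pd ζ j x := by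
        rw [Finset.sum_eq_single l (fun k _ h => by simp [eη k h, pd_zero]) (by simp), eηl]
      unfold TT
      rw [this]
      by_cases h : k = l
      · subst h
        rw [eηl, if_pos rfl]
        simp only [Finset.mul_sum, mul_add]
        rw [show u k x * (-Lap ζ x) + u k x * (2 * (pot g 0 x:ℂ) * ζ x) = u k x * (2 * (pot g 0 x:ℂ) * ζ x) - u k x * Lap ζ x by ring]
        congr 1
        exact Finset.sum_congr rfl fun _ _ => by ring
      · rw [eη k h, if_neg h]
        simp only [Lap, Finset.mul_sum, mul_add]
        have : ∀ j, pd (fun _ => (0:ℂ)) j = fun _ => 0 := fun j => by ext x; exact pd_zero j x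
        simp only [this, Finset.sum_const_zero, neg_zero, mul_zero, zero_add]
        exact Finset.sum_congr rfl fun _ _ => by ring
    have eB : BB Ω γ g U η = ((∫ x, u l x * (2 * (pot g 0 x:ℂ) * ζ x)) - ∫ x, u l x * Lap ζ x) + ∑ j, ∑ k, ∫ x, u k x * (2 * Ac Ω γ k l j x * pd ζ j x) := by
      have : ∀ k, ∫ x, u k x * TT Ω γ g 0 η k x = (if k = l then ((∫ x, u l x * (2 * (pot g 0 x:ℂ) * ζ x)) - ∫ x, u l x * Lap ζ x) else 0) + ∑ j, ∫ x, u k x * (2 * Ac Ω γ k l j x * pd ζ j x) := by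
        intro k
        simp only [eT]
        rw [← integral_finsetSum _ fun j _ => iA k j, ← integral_sub iP iL]
        by_cases h : k = l
        · simp only [h, if_true]
          exact integral_add (iP.sub iL) (iAA l)
        · simp [h]
      show ∑ k, ∫ x, u k x * TT Ω γ g 0 η k x = _
      simp only [this]
      rw [Finset.sum_add_distrib, Finset.sum_ite_eq' , if_pos (Finset.mem_univ _), Finset.sum_comm]
    have e1 : ∀ j, ∫ x, (∑ k, (2 * Ac Ω γ k l j x) * u k x) * pd ζ j x = ∑ k, ∫ x, u k x * (2 * Ac Ω γ k l j x * pd ζ j x) := by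
      intro j
      rw [← integral_finsetSum _ fun k _ => iA k j]
      congr 1; ext x
      rw [Finset.sum_mul]
      exact Finset.sum_congr rfl fun _ _ => by ring
    have e2 : ∫ x, ((∑ k, (if l = k then 2 * (pot g 0 x : ℂ) + (2*q - 4*m : ℝ) else 0) * u k x) + nn c0 c1 l (fun k => u k x)) * ζ x
       = (∫ x, u l x * (2 * (pot g 0 x:ℂ) * ζ x)) + (2*q - 4*m : ℝ) * (∫ x, u l x * ζ x) + ∫ x, nn c0 c1 l (fun k => u k x) * ζ x := by
      have i1 : Integrable (fun x => u l x * (2 * (pot g 0 x:ℂ) * ζ x) + (2*q - 4*m : ℝ) * (u l x * ζ x)) := iP.add ((i0 l hζ).const_mul _)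
      rw [← integral_const_mul, ← integral_add iP ((i0 l hζ).const_mul _), ← integral_add i1 iN]
      congr 1; ext x
      simp only [ite_mul, zero_mul, Finset.sum_ite_eq, Finset.mem_univ, if_true]
      ring
    simp only [e1]
    rw [e2]
    rw [es, eo, eB] at EL
    linear_combination -EL
  obtain ⟨v, hv, e⟩ := reg (u := u) (a := fun l j k x => 2 * Ac Ω γ k l j x) (b := fun l k x => if l = k then 2 * (pot g 0 x : ℂ) + (2*q - 4*m : ℝ) else 0)
    (n := nn c0 c1) (C := C) hu (fun l j k => contDiff_const.mul (Ac_smooth Ω γ k l j)) (fun l k => by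
      split_ifs
      · exact (contDiff_const.mul (pot_smooth g 0)).add contDiff_const
      · exact contDiff_const) (nn_cont c0 c1) (nn_zero c0 c1) hC hw l
  refine ⟨fun x => (starRingEnd ℂ) (v x), Complex.conjCLE.contDiff.comp hv, ?_⟩
  filter_upwards [e] with x hx
  rw [← hx]; simp [u]
end

end

section
open scoped ENNReal NNReal Topology FourierTransform ContDiff SchwartzMap Convolution
open Filter

section
variable {Ω γ : ℝ} {g : Fin 3 → ℝ} {c0 c1 m q : ℝ} {A : ℝ≥0} {Φ : ℕ → Tri} {U W : Tri}

lemma Pack.congr (P : Pack Ω γ g c0 c1 m q A Φ U) (h : ∀ k, U k =ᵐ[volume] W k) : Pack Ω γ g c0 c1 m q A Φ W where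
  lb := P.lb
  good := P.good
  mass1 := P.mass1
  hq := P.hq
  hw := P.hw
  b2 := P.b2
  bT := P.bT
  bx := P.bx
  bd := P.bd
  u2 k := (memLp_congr_ae (h k)).1 (P.u2 k)
  uT k := (P.uT k).congr (h k)
  ux k := by
    refine le_trans (le_of_eq (eLpNorm_congr_ae ?_)) (P.ux k)
    filter_upwards [h k] with x hx
    rw [hx]
  ub k := (eLpNorm_congr_ae (h k)).symm.le.trans (P.ub k)
  um := by
    rw [← P.um]
    unfold mass
    refine integral_congr_ae ?_
    have : ∀ᵐ x, ∀ k, U k x = W k x := ae_all_iff.2 h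
    filter_upwards [this] with x hx
    simp [hx]
  sub k := by
    refine ⟨(P.sub k).1.congr fun n => ?_, ?_⟩
    · refine eLpNorm_congr_ae ?_
      filter_upwards [h k] with x hx
      rw [hx]
    · filter_upwards [h k, (P.sub k).2] with x hx h2
      rwa [← hx]

lemma x_le (x : Pt 3) (i : Fin 3) (z : ℂ) : ‖(x i : ℂ) * z‖ ≤ ‖‖x‖ * ‖z‖‖ := by
  rw [norm_mul, Real.norm_of_nonneg (by positivity), Complex.norm_real]
  gcongr
  exact PiLp.norm_apply_le x i

lemma Pack.goodU (P : Pack Ω γ g c0 c1 m q A Φ U) (h : ∀ k, ContDiff ℝ 1 (U k)) : Good U where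
  diff k := (h k).differentiable (by simp)
  m2 := P.u2
  m4 k := by
    obtain ⟨B, hB⟩ := L4bd A
    exact (hB _ (P.u2 k) (P.ub k) (P.uT k)).1
  d2 k j := by
    have c : Continuous (pd (U k) j) := ((h k).continuous_fderiv (by simp)).clm_apply continuous_const
    refine ⟨c.aestronglyMeasurable, (TL_fderiv (P.uT k) ((h k).differentiable (by simp)) (ee j)).trans_lt ?_⟩
    finiteness
  x2 k i := by
    refine ⟨((coord_smooth i).continuous.mul (h k).continuous).aestronglyMeasurable, ?_⟩
    exact ((eLpNorm_mono fun x => x_le x i _).trans (P.ux k)).trans_lt (by finiteness)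

def IN (F : ℕ → Pt 3 → ℂ) : Prop := (∀ n, Integrable (F n)) ∧ Tendsto (fun n => ∫ x, F n x) atTop (𝓝 0)

lemma IN.add {F G : ℕ → Pt 3 → ℂ} (hF : IN F) (hG : IN G) : IN (fun n x => F n x + G n x) := by
  refine ⟨fun n => (hF.1 n).add (hG.1 n), ?_⟩
  have := hF.2.add hG.2
  rw [add_zero] at this
  exact this.congr fun n => (integral_add (hF.1 n) (hG.1 n)).symm
lemma IN.cmul {F : ℕ → Pt 3 → ℂ} (hF : IN F) (c : ℂ) : IN (fun n x => c * F n x) := by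
  refine ⟨fun n => (hF.1 n).const_mul c, ?_⟩
  have := hF.2.const_mul c
  rw [mul_zero] at this
  exact this.congr fun n => (integral_const_mul _ _).symm
lemma IN.sum {F : Fin 3 → ℕ → Pt 3 → ℂ} (hF : ∀ k, IN (F k)) : IN (fun n x => ∑ k, F k n x) := by
  simp only [Fin.sum_univ_three]
  exact ((hF 0).add (hF 1)).add (hF 2)
lemma IN.conj {F : ℕ → Pt 3 → ℂ} (hF : IN F) : IN (fun n x => (starRingEnd ℂ) (F n x)) := by
  refine ⟨fun n => Complex.conjCLE.toContinuousLinearMap.integrable_comp (hF.1 n), ?_⟩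
  have := (Complex.continuous_conj.tendsto _).comp hF.2
  rw [map_zero] at this
  exact this.congr fun n => integral_conj.symm
lemma IN.congr {F G : ℕ → Pt 3 → ℂ} (hF : IN F) (h : ∀ n x, F n x = G n x) : IN G := by
  have : F = G := by ext n x; exact h n x
  rwa [← this]

def WN (d : ℕ → Pt 3 → ℂ) : Prop := (∀ n, MemLp (d n) 2) ∧ ∀ a : Pt 3 → ℂ, MemLp a 2 → Tendsto (fun n => ∫ x, d n x * a x) atTop (𝓝 0)

lemma WN.IN0 {d : ℕ → Pt 3 → ℂ} (h : WN d) {a : Pt 3 → ℂ} (ha : MemLp a 2) : IN (fun n x => d n x * a x) :=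
  ⟨fun n => (h.1 n).integrable_mul ha, h.2 a ha⟩
lemma WN.IN1 {d : ℕ → Pt 3 → ℂ} (h : WN d) {a : Pt 3 → ℂ} (ha : MemLp a 2) : IN (fun n x => (starRingEnd ℂ) (a x) * d n x) :=
  (h.IN0 ha.star).congr fun n x => mul_comm _ _
lemma WN.IN2 {d : ℕ → Pt 3 → ℂ} (h : WN d) {a : Pt 3 → ℂ} (ha : MemLp a 2) : IN (fun n x => (starRingEnd ℂ) (d n x) * a x) :=
  (h.IN1 ha).conj.congr fun n x => by rw [map_mul, conj_conj, mul_comm]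
lemma WN.add {d e : ℕ → Pt 3 → ℂ} (h : WN d) (h' : WN e) : WN (fun n x => d n x + e n x) :=
  ⟨fun n => (h.1 n).add (h'.1 n), fun a ha => (((h.IN0 ha).add (h'.IN0 ha)).congr fun n x => (add_mul _ _ _).symm).2⟩
lemma WN.cmul {d : ℕ → Pt 3 → ℂ} (h : WN d) (c : ℂ) : WN (fun n x => c * d n x) :=
  ⟨fun n => (h.1 n).const_mul c, fun a ha => (((h.IN0 ha).cmul c).congr fun n x => (mul_assoc _ _ _).symm).2⟩
lemma WN.congr {F G : ℕ → Pt 3 → ℂ} (hF : WN F) (h : ∀ n x, F n x = G n x) : WN G := by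
  have : F = G := by ext n x; exact h n x
  rwa [← this]
lemma WN.zero : WN (fun _ _ => 0) := ⟨fun _ => MemLp.zero, fun a _ => by simp⟩

lemma WN_of {F : ℕ → Pt 3 → ℂ} {f : Pt 3 → ℂ} (hF : ∀ n, MemLp (F n) 2) (hA : ∀ n, eLpNorm (F n) 2 volume ≤ A)
    (hf : MemLp f 2) (h : ∀ ψ, CC ψ → Tendsto (fun n => ∫ x, F n x * ψ x) atTop (𝓝 (∫ x, f x * ψ x))) :
    WN (fun n x => F n x + (-1:ℂ) * f x) := by
  refine ⟨fun n => (hF n).add (hf.const_mul _), fun a ha => ?_⟩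
  have := (weak hF hA hf h ha).sub_const (∫ x, f x * a x)
  rw [sub_self] at this
  refine this.congr fun n => ?_
  have e := integral_sub ((hF n).integrable_mul ha) (hf.integrable_mul ha)
  simp only [Pi.mul_apply] at e
  rw [← e]
  congr 1; ext x; ring

/-- difference -/
def Df (Φ : ℕ → Tri) (U : Tri) (n : ℕ) : Tri := fun k x => Φ n k x + (-1:ℂ) * U k x

lemma Pack.goodD (P : Pack Ω γ g c0 c1 m q A Φ U) (h : Good U) (n) : Good (Df Φ U n) := (P.good n).add (h.cmul (-1))

lemma Pack.pdD (P : Pack Ω γ g c0 c1 m q A Φ U) (h : Good U) (n k j x) : pd (Df Φ U n k) j x = pd (Φ n k) j x + (-1:ℂ) * pd (U k) j x := by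
  unfold Df
  rw [pd_add ((P.good n).diff k x) ((h.diff k x).const_mul _), pd_const_mul (h.diff k x)]

lemma Pack.W0 (P : Pack Ω γ g c0 c1 m q A Φ U) (k) : WN (fun n => Df Φ U n k) :=
  WN_of (A := A) (fun n => (P.good n).m2 k) (fun n => P.b2 n k) (P.u2 k) fun ψ hψ => int_conv (fun n => (P.good n).m2 k) (P.u2 k) (hψ.memLp 2) (P.sub k).1

lemma Pack.Wx (P : Pack Ω γ g c0 c1 m q A Φ U) (h : Good U) (k) (i : Fin 3) : WN (fun n x => (x i : ℂ) * Df Φ U n k x) := by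
  have := WN_of (A := A) (F := fun n x => (x i : ℂ) * Φ n k x) (f := fun x => (x i : ℂ) * U k x) (fun n => (P.good n).x2 k i)
    (fun n => (eLpNorm_mono fun x => x_le x i _).trans (P.bx n k)) (h.x2 k i) fun ψ hψ => by
      have := int_conv (fun n => (P.good n).m2 k) (P.u2 k) ((hψ.smul (coord_smooth i)).memLp 2) (P.sub k).1
      have e : ∀ f : Pt 3 → ℂ, ∫ x, f x * ((x i : ℂ) * ψ x) = ∫ x, (x i : ℂ) * f x * ψ x := fun f => by congr 1; ext x; ring
      simpa only [e] using this
  refine this.congr fun n x => ?_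
  simp only [Df]; ring

lemma Pack.Wd (P : Pack Ω γ g c0 c1 m q A Φ U) (h : Good U) (k j) : WN (fun n => pd (Df Φ U n k) j) := by
  have := WN_of (A := A) (F := fun n => pd (Φ n k) j) (f := pd (U k) j) (fun n => (P.good n).d2 k j)
    (fun n => P.bd n k j) (h.d2 k j) fun ψ hψ => by
      have := (int_conv (fun n => (P.good n).m2 k) (P.u2 k) ((hψ.pd j).memLp 2) (P.sub k).1).neg
      rw [ibp (h.diff k) (h.m2 k) j (h.d2 k j) hψ]
      refine this.congr fun n => ?_
      rw [ibp ((P.good n).diff k) ((P.good n).m2 k) j ((P.good n).d2 k j) hψ]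
  exact this.congr fun n x => (P.pdD h n k j x).symm

lemma Pack.WA (P : Pack Ω γ g c0 c1 m q A Φ U) (h : Good U) (k l j) : WN (fun n x => (starRingEnd ℂ) (Ac Ω γ k l j x) * Df Φ U n k x) := by
  have hr : WN (fun n x => rotv x j * Df Φ U n k x) := by
    fin_cases j
    · exact ((P.Wx h k 1).cmul (-1)).congr fun n x => by simp [rotv]
    · exact (P.Wx h k 0).congr fun n x => by simp [rotv]
    · exact WN.zero.congr fun n x => by simp [rotv]
  have h1 := (P.W0 k).cmul (-(γ:ℂ) * (starRingEnd ℂ) (Smat k l j))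
  have h2 : WN (fun n x => (starRingEnd ℂ) ((if k = l then (Ω:ℂ) * I * rotv x j else 0)) * Df Φ U n k x) := by
    split_ifs
    · refine (hr.cmul ((starRingEnd ℂ) ((Ω:ℂ) * I))).congr fun n x => ?_
      have : (starRingEnd ℂ) (rotv x j) = rotv x j := by fin_cases j <;> simp [rotv]
      rw [map_mul, map_mul, map_mul, this]; ring
    · exact WN.zero.congr fun n x => by simp
  refine (h2.add h1).congr fun n x => ?_
  simp only [Ac, map_sub, map_mul, conj_ofReal]; ring

lemma Pack.X_lim (P : Pack Ω γ g c0 c1 m q A Φ U) (h : Good U) (C : ℝ) :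
    Tendsto (fun n => ∫ x, (be Ω γ (pot g C) U (Df Φ U n) x + be Ω γ (pot g C) (Df Φ U n) U x)) atTop (𝓝 0) := by
  have a1 : IN (fun n x => bc Ω γ (pot g C x) x (fun k => U k x) (fun k j => pd (U k) j x) (fun k => Df Φ U n k x) (fun k j => pd (Df Φ U n k) j x)) := by
    unfold bc
    refine IN.add (IN.add (IN.cmul (IN.sum fun k => IN.sum fun j => (P.Wd h k j).IN1 (h.d2 k j)) _) ?_) (IN.sum fun k => IN.sum fun l => IN.sum fun j => ?_)
    · have := IN.sum fun k => (IN.sum fun i => ((P.Wx h k i).IN1 (h.x2 k i)).cmul (g i)).add (((P.W0 k).IN1 (h.m2 k)).cmul C)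
      refine this.congr fun n x => ?_
      simp only [pot, Fin.sum_univ_three, map_mul, conj_ofReal]
      push_cast; ring
    · refine ((P.Wd h l j).IN1 (h.A2 Ω γ k l j)).congr fun n x => ?_
      simp only [map_mul, conj_conj]; ring
  have a2 : IN (fun n x => bc Ω γ (pot g C x) x (fun k => Df Φ U n k x) (fun k j => pd (Df Φ U n k) j x) (fun k => U k x) (fun k j => pd (U k) j x)) := by
    unfold bc
    refine IN.add (IN.add (IN.cmul (IN.sum fun k => IN.sum fun j => (P.Wd h k j).IN2 (h.d2 k j)) _) ?_) (IN.sum fun k => IN.sum fun l => IN.sum fun j => ?_)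
    · have := IN.sum fun k => (IN.sum fun i => ((P.Wx h k i).IN2 (h.x2 k i)).cmul (g i)).add (((P.W0 k).IN2 (h.m2 k)).cmul C)
      refine this.congr fun n x => ?_
      simp only [pot, Fin.sum_univ_three, map_mul, conj_ofReal]
      push_cast; ring
    · refine ((P.WA h k l j).IN2 (h.d2 l j)).congr fun n x => ?_
      simp only [map_mul, conj_conj]; ring
  have a := a1.add a2
  have := (Complex.continuous_re.tendsto _).comp a.2
  rw [zero_re] at this
  exact this.congr fun n => (integral_re (a.1 n)).symm

lemma Pack.Q_le (P : Pack Ω γ g c0 c1 m q A Φ U) (h : Good U) {C c : ℝ} (hc : 0 < c)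
    (hco : ∀ (x : Pt 3) (p : Fin 3 → ℂ) (D : Fin 3 → Fin 3 → ℂ), 
      c * (∑ k, ∑ j, ‖D k j‖^2 + (∑ i, (x i)^2) * rh p + rh p) ≤ (bc Ω γ (pot g C x) x p D p D).re) :
    QQ Ω γ g 0 U ≤ q := by
  have key : ∀ n, QQ Ω γ g 0 U + (∫ x, (be Ω γ (pot g C) U (Df Φ U n) x + be Ω γ (pot g C) (Df Φ U n) U x)) ≤ QQ Ω γ g 0 (Φ n) := by
    intro n
    have e := QQ_expand h (P.goodD h n) Ω γ g C 1
    have e1 : (fun k x => U k x + ((1:ℝ):ℂ) * Df Φ U n k x) = Φ n := by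
      ext k x; simp [Df]
    have pos : 0 ≤ QQ Ω γ g C (Df Φ U n) := by
      refine integral_nonneg fun x => le_trans ?_ (hco x _ _)
      have := rh_nonneg (fun k => Df Φ U n k x)
      positivity
    rw [e1, QQ_const _ _ _ _ (P.good n), QQ_const _ _ _ _ h, P.mass1, P.um] at e
    linarith
  have := ((P.X_lim h C).const_add (QQ Ω γ g 0 U))
  rw [add_zero] at this
  exact le_of_tendsto_of_tendsto' this P.hq key

lemma Pack.W_le (P : Pack Ω γ g c0 c1 m q A Φ U) (h : Good U) (hc : (0 ≤ c0 ∧ 0 ≤ c1) ∨ (c1 ≤ 0 ∧ 0 ≤ c0 + c1)) :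
    WW c0 c1 U ≤ m - q := by
  have e : ∀ Ψ : Tri, Good Ψ → eLpNorm (fun x => wd c0 c1 (fun k => Ψ k x)) 1 volume = ENNReal.ofReal (WW c0 c1 Ψ) := by
    intro Ψ hΨ
    rw [eLpNorm_one_eq_lintegral_enorm]
    unfold WW
    rw [ofReal_integral_eq_lintegral_ofReal (wd_int hΨ.m4 c0 c1) (.of_forall fun x => wd_nonneg hc _)]
    congr 1; ext x
    rw [← ofReal_norm, Real.norm_of_nonneg (wd_nonneg hc _)]
  have hlim : ∀ᵐ x, Tendsto (fun n => wd c0 c1 (fun k => Φ n k x)) atTop (𝓝 (wd c0 c1 (fun k => U k x))) := by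
    filter_upwards [ae_all_iff.2 fun k => (P.sub k).2] with x hx
    exact ((wd_cont c0 c1).tendsto _).comp (tendsto_pi_nhds.2 hx)
  have := Lp.eLpNorm_lim_le_liminf_eLpNorm (p := 1) (fun n => (wd_int (P.good n).m4 c0 c1).1) _ hlim
  simp only [e _ h, fun n => e _ (P.good n)] at this
  have l : Tendsto (fun n => ENNReal.ofReal (WW c0 c1 (Φ n))) atTop (𝓝 (ENNReal.ofReal (m - q))) :=
    (ENNReal.continuous_ofReal.tendsto _).comp P.hw
  rw [l.liminf_eq] at this
  refine (ENNReal.ofReal_le_ofReal_iff ?_).1 this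
  exact ge_of_tendsto' P.hw fun n => WW_nonneg hc _
end

lemma ground {Ω γ a b e c0 c1 : ℝ} (ha : 0 < a) (hb : 0 < b) (he : 0 < e) (hΩ : |Ω| < min a b)
    (hc : (0 ≤ c0 ∧ 0 ≤ c1) ∨ (c1 ≤ 0 ∧ 0 ≤ c0 + c1)) :
    ∃ U : Tri, Good U ∧ mass U = 1 ∧ ∀ Ψ, Good Ψ → mass Ψ = 1 → QQ Ω γ (gam a b e) 0 U + WW c0 c1 U ≤ QQ Ω γ (gam a b e) 0 Ψ + WW c0 c1 Ψ := by
  obtain ⟨m, q, A, Φ, U0, P0⟩ := pack_exists (γ := γ) ha hb he hΩ hc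
  obtain ⟨C, c, hc0, hco⟩ := coer (γ := γ) ha hb he hΩ
  choose U hU e using P0.C1 hc
  have P := P0.congr e
  have h := P.goodU hU
  refine ⟨U, h, P.um, fun Ψ hΨ hm => le_trans ?_ (P.lb Ψ hΨ hm)⟩
  have := P.Q_le h hc0 hco
  have := P.W_le h hc
  linarith

end

/-- Existence of a ground state in 3D: if `|Ω| < min{γx, γy}` and either
`c₀, c₁ ≥ 0` or (`c₁ ≤ 0` and `c₀ + c₁ ≥ 0`), the energy attains its infimum on `M`. -/
theorem stmt7 (c0 c1 Ω γ γx γy γz : ℝ) (hγx : 0 < γx) (hγy : 0 < γy) (hγz : 0 < γz)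
    (hΩ : |Ω| < min γx γy)
    (hc : (0 ≤ c0 ∧ 0 ≤ c1) ∨ (c1 ≤ 0 ∧ 0 ≤ c0 + c1))
    (V : Pt 3 → ℝ)
    (hV : ∀ x : Pt 3, V x = 1 / 2 * (γx ^ 2 * (x 0) ^ 2 + γy ^ 2 * (x 1) ^ 2 + γz ^ 2 * (x 2) ^ 2)) :
    ∃ g1 g0 gm1 : Pt 3 → ℂ, InM 3 V g1 g0 gm1 ∧
      ∀ φ1 φ0 φm1 : Pt 3 → ℂ, InM 3 V φ1 φ0 φm1 →
        Etot 3 V c0 c1 Ω γ g1 g0 gm1 ≤ Etot 3 V c0 c1 Ω γ φ1 φ0 φm1 := by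
  have hV' := pot_eq hV
  subst hV'
  obtain ⟨U, h, hm, hmin⟩ := ground (γ := γ) hγx hγy hγz hΩ hc
  refine ⟨U 0, U 1, U 2, good_InM _ h hm, fun φ1 φ0 φm1 hφ => ?_⟩
  obtain ⟨T, rfl, rfl, rfl⟩ : ∃ T : Tri, T 0 = φ1 ∧ T 1 = φ0 ∧ T 2 = φm1 :=
    ⟨![φ1, φ0, φm1], rfl, rfl, rfl⟩
  obtain ⟨hg, hm2⟩ := InM_good hγx hγy hγz hφ
  have e1 := Etot_eq c0 c1 Ω γ (gam γx γy γz) h hm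
  have e2 := Etot_eq c0 c1 Ω γ (gam γx γy γz) hg hm2
  exact (e1.le.trans (hmin _ hg hm2)).trans e2.ge

end
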